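/- Let K be a number field with ring of integers 𝓞_K, let d ≥ 2, let c ∈ 𝓞_K, and let f(x) = x^d + c. If it is not the case that d = 2 and c = −2 (i.e., f is not the Chebyshev polynomial x² − 2), then for every ε > 0 there are infinitely many nonzero prime ideals 𝔭 of 𝓞_K with #Per(f_𝔭) ≤ ε·(N(𝔭) + 1); that is, the liminf over primes 𝔭 of #Per(f_𝔭)/(N(𝔭)+1) is 0. -/

import Mathlib

open NumberField Polynomial

/-- The number of periodic points of the self-map of `R ⧸ I` induced by a polynomial
`f ∈ R[x]` (reduce the coefficients of `f` modulo `I` and iterate evaluation). -/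
noncomputable def perCount {R : Type*} [CommRing R] (f : Polynomial R) (I : Ideal R) : ℕ :=
  Set.ncard {z : R ⧸ I | ∃ m : ℕ, 0 < m ∧
    (fun w => (f.map (Ideal.Quotient.mk I)).eval w)^[m] z = z}

set_option linter.unusedSectionVars false
set_option linter.unusedVariables false
set_option linter.style.haveILetI false

namespace PC

section Ord
variable {k B : Type*} [Field k] [CommRing B] [Algebra k B]

/-- vanishing to order `n` at the point `ψ`, measured by the derivation `D` -/
def Ord (D : Derivation k B B) (ψ : B →ₐ[k] k) : ℕ → B → Prop
  | 0, _ => True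
  | n + 1, h => ψ h = 0 ∧ Ord D ψ n (D h)

variable {D : Derivation k B B} {ψ : B →ₐ[k] k}

lemma Ord.zero (n : ℕ) : Ord D ψ n 0 := by
  induction n with
  | zero => trivial
  | succ n ih => exact ⟨map_zero _, by simpa using ih⟩

lemma Ord.add {n : ℕ} {x y : B} (hx : Ord D ψ n x) (hy : Ord D ψ n y) : Ord D ψ n (x + y) := by
  induction n generalizing x y with
  | zero => trivial
  | succ n ih => exact ⟨by rw [map_add, hx.1, hy.1, add_zero], by
      rw [map_add]; exact ih hx.2 hy.2⟩

lemma Ord.sum {n : ℕ} {ι : Type*} (s : Finset ι) {x : ι → B} (hx : ∀ i ∈ s, Ord D ψ n (x i)) :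
    Ord D ψ n (∑ i ∈ s, x i) := by
  classical
  induction s using Finset.induction_on with
  | empty => simpa using Ord.zero n
  | insert a s ha ih =>
    rw [Finset.sum_insert ha]
    exact (hx _ (Finset.mem_insert_self _ _)).add
      (ih fun i hi => hx i (Finset.mem_insert_of_mem hi))

lemma Ord.of_succ {n : ℕ} {x : B} (hx : Ord D ψ (n + 1) x) : Ord D ψ n x := by
  induction n generalizing x with
  | zero => trivial
  | succ n ih => exact ⟨hx.1, ih hx.2⟩

lemma Ord.mono {m n : ℕ} (h : m ≤ n) {x : B} (hx : Ord D ψ n x) : Ord D ψ m x := by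
  induction n, h using Nat.le_induction with
  | base => exact hx
  | succ n _ ih => exact ih hx.of_succ

lemma Ord.mul_aux (N : ℕ) : ∀ {m n : ℕ} {x y : B}, m + n = N → Ord D ψ m x → Ord D ψ n y →
    Ord D ψ (m + n) (x * y) := by
  induction N with
  | zero =>
    intro m n x y h _ _
    obtain ⟨rfl, rfl⟩ : m = 0 ∧ n = 0 := by omega
    trivial
  | succ N ih =>
    intro m n x y h hx hy
    rw [h]
    refine ⟨?_, ?_⟩
    · rw [map_mul]
      rcases m with _ | m
      · rcases n with _ | n
        · omega
        · rw [hy.1, mul_zero]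
      · rw [hx.1, zero_mul]
    · rw [Derivation.leibniz, smul_eq_mul, smul_eq_mul]
      refine Ord.add ?_ ?_
      · rcases n with _ | n
        · rcases m with _ | m
          · omega
          · have := ih (by omega : m + 0 = N) hx.of_succ (y := D y) trivial
            exact this.mono (by omega)
        · have := ih (by omega : m + n = N) hx hy.2
          exact this.mono (by omega)
      · rcases m with _ | m
        · rcases n with _ | n
          · omega
          · have := ih (by omega : n + 0 = N) hy.of_succ (y := D x) trivial
            exact this.mono (by omega)
        · have := ih (by omega : n + m = N) hy hx.2
          exact this.mono (by omega)

lemma Ord.mul {m n : ℕ} {x y : B} (hx : Ord D ψ m x) (hy : Ord D ψ n y) :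
    Ord D ψ (m + n) (x * y) := Ord.mul_aux _ rfl hx hy

lemma Ord.prod {ι : Type*} (s : Finset ι) {m : ι → ℕ} {x : ι → B}
    (hx : ∀ i ∈ s, Ord D ψ (m i) (x i)) : Ord D ψ (∑ i ∈ s, m i) (∏ i ∈ s, x i) := by
  classical
  induction s using Finset.induction_on with
  | empty => trivial
  | insert a s ha ih =>
    rw [Finset.sum_insert ha, Finset.prod_insert ha]
    exact (hx _ (Finset.mem_insert_self _ _)).mul
      (ih fun i hi => hx i (Finset.mem_insert_of_mem hi))

lemma Ord.pow {x : B} (hx : ψ x = 0) (n : ℕ) : Ord D ψ n (x ^ n) := by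
  have := Ord.prod (D := D) (ψ := ψ) (Finset.range n) (m := fun _ => 1) (x := fun _ => x)
    (fun i _ => ⟨hx, trivial⟩)
  simpa using this

lemma Ord.of_forall {n : ℕ} {x : B} (h : ∀ i < n, ψ (D^[i] x) = 0) : Ord D ψ n x := by
  induction n generalizing x with
  | zero => trivial
  | succ n ih => exact ⟨h 0 (by omega), ih fun i hi => h (i + 1) (by omega)⟩

variable [Algebra k[X] B] [IsScalarTower k k[X] B]

lemma deriv_algebraMap {π : k[X]} (hD : D (algebraMap k[X] B X) = algebraMap k[X] B π) (P : k[X]) :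
    D (algebraMap k[X] B P) = algebraMap k[X] B (derivative P * π) := by
  have h : ∀ Q : k[X], algebraMap k[X] B Q = aeval (algebraMap k[X] B X) Q := by
    intro Q
    rw [aeval_algebraMap_apply, aeval_X_left_apply]
  rw [h P, Derivation.map_aeval, hD, ← h, smul_eq_mul, map_mul]

lemma point_algebraMap (P : k[X]) :
    ψ (algebraMap k[X] B P) = P.eval (ψ (algebraMap k[X] B X)) := by
  have h : algebraMap k[X] B P = aeval (algebraMap k[X] B X) P := by
    rw [aeval_algebraMap_apply, aeval_X_left_apply]
  rw [h, ← aeval_algHom_apply, coe_aeval_eq_eval]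

lemma not_ord_of {π : k[X]} (hD : D (algebraMap k[X] B X) = algebraMap k[X] B π)
    (hπ : π.eval (ψ (algebraMap k[X] B X)) ≠ 0) (j : ℕ) (hj : ∀ i : ℕ, 0 < i → i ≤ j → (i : k) ≠ 0)
    (R : k[X]) (hR : R.eval (ψ (algebraMap k[X] B X)) ≠ 0) :
    ¬ Ord D ψ (j + 1) (algebraMap k[X] B ((X - C (ψ (algebraMap k[X] B X))) ^ j * R)) := by
  set t0 := ψ (algebraMap k[X] B X) with ht0
  induction j generalizing R with
  | zero =>
    rintro ⟨h, -⟩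
    rw [point_algebraMap] at h
    simp [← ht0] at h
    exact hR h
  | succ j ih =>
    rintro ⟨-, h⟩
    rw [deriv_algebraMap hD] at h
    have e : derivative ((X - C t0) ^ (j + 1) * R) * π =
        (X - C t0) ^ j * ((C ((j + 1 : ℕ) : k) * R + (X - C t0) * derivative R) * π) := by
      rw [derivative_mul, derivative_X_sub_C_pow]
      simp
      ring
    rw [e] at h
    refine ih (fun i h1 h2 => hj i h1 (by omega)) _ ?_ h
    rw [eval_mul]
    refine mul_ne_zero ?_ hπ
    simp only [eval_add, eval_mul, eval_C, eval_sub, eval_X, sub_self, zero_mul, add_zero]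
    exact mul_ne_zero (hj (j + 1) (by omega) le_rfl) hR

lemma dvd_of_ord {p : ℕ} [hp : Fact p.Prime] [CharP k p] {π : k[X]}
    (hD : D (algebraMap k[X] B X) = algebraMap k[X] B π)
    (hπ : π.eval (ψ (algebraMap k[X] B X)) ≠ 0) (m : ℕ) (hm : m ≤ p) (Q : k[X])
    (hQ : Ord D ψ m (algebraMap k[X] B Q)) : (X - C (ψ (algebraMap k[X] B X))) ^ m ∣ Q := by
  rcases eq_or_ne Q 0 with rfl | hQ0
  · exact dvd_zero _
  set t0 := ψ (algebraMap k[X] B X) with ht0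
  rw [← le_rootMultiplicity_iff hQ0]
  by_contra hlt
  push Not at hlt
  obtain ⟨R, hR, hRd⟩ := exists_eq_pow_rootMultiplicity_mul_and_not_dvd Q hQ0 t0
  set j := rootMultiplicity t0 Q with hj
  have : R.eval t0 ≠ 0 := fun h => hRd (dvd_iff_isRoot.2 h)
  refine not_ord_of hD hπ j ?_ R this ?_
  · intro i h1 h2 h3
    rw [CharP.cast_eq_zero_iff k p] at h3
    exact absurd (Nat.le_of_dvd h1 h3) (by omega)
  · rw [← ht0, ← hR]; exact hQ.mono hlt

end Ord
end PC

namespace PC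

/-- data needed to run Stepanov's method -/
structure SD {k B Γ : Type*} [Field k] [CommRing B] [Algebra k B] [Algebra k[X] B]
    [IsScalarTower k k[X] B] [Group Γ] [Fintype Γ] [MulSemiringAction Γ B]
    (π : k[X]) (D : Derivation k B B) (W : ℕ → Submodule k B) (e : Γ → B) (C0 C1 : ℕ) : Prop where
  hDX : D (algebraMap k[X] B X) = algebraMap k[X] B π
  inj : Function.Injective (algebraMap k[X] B)
  fix : ∀ (g : Γ) (P : k[X]), g • algebraMap k[X] B P = algebraMap k[X] B P
  inv : ∀ h : B, (∀ g : Γ, g • h = h) → ∃ P, algebraMap k[X] B P = h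
  comm : ∀ (g : Γ) (h : B), D (g • h) = g • D h
  mono : Monotone W
  one_mem : (1 : B) ∈ W 0
  X_mem : algebraMap k[X] B X ∈ W 1
  mul_mem : ∀ {m n x y}, x ∈ W m → y ∈ W n → x * y ∈ W (m + n)
  smul_mem : ∀ (g : Γ) {m x}, x ∈ W m → g • x ∈ W m
  D_mem : ∀ {m x}, x ∈ W m → D x ∈ W (m + C1)
  deg : ∀ {m Q}, algebraMap k[X] B Q ∈ W m → natDegree Q ≤ m
  e_mem : ∀ i, e i ∈ W C0
  lin : LinearIndependent k[X] e
  finrank_le : ∀ m, Module.finrank k (W m) ≤ Fintype.card Γ * (m + C0 + 1)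
  finite : ∀ m, Module.Finite k (W m)
  pt : ∀ t0 : k, ∃ ψ : B →ₐ[k] k, ψ (algebraMap k[X] B X) = t0
  π_ne : π ≠ 0

section
variable {k B Γ : Type*} [Field k] [CommRing B] [IsDomain B] [Algebra k B] [Algebra k[X] B]
    [IsScalarTower k k[X] B] [Group Γ] [Fintype Γ] [MulSemiringAction Γ B]
    {π : k[X]} {D : Derivation k B B} {W : ℕ → Submodule k B} {e : Γ → B} {C0 C1 : ℕ}

lemma SD.norm (h : SD π D W e C0 C1) (x : B) :
    ∃ Q, algebraMap k[X] B Q = ∏ g : Γ, g • x := by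
  apply h.inv
  intro g
  rw [Finset.smul_prod']
  simp_rw [smul_smul]
  exact Fintype.prod_equiv (Equiv.mulLeft g) _ _ (fun _ => rfl)

lemma SD.norm_mem (h : SD π D W e C0 C1) {m : ℕ} {x : B} (hx : x ∈ W m) :
    ∏ g : Γ, g • x ∈ W (Fintype.card Γ * m) := by
  have : ∀ s : Finset Γ, ∏ g ∈ s, g • x ∈ W (s.card * m) := by
    classical
    intro s
    induction s using Finset.induction_on with
    | empty => simpa using h.one_mem
    | insert a s ha ih =>
      rw [Finset.prod_insert ha, Finset.card_insert_of_notMem ha]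
      exact h.mono (by ring_nf; exact le_rfl) (h.mul_mem (h.smul_mem a hx) ih)
  exact this _

lemma SD.norm_ne (h : SD π D W e C0 C1) {x : B} (hx : x ≠ 0) : ∏ g : Γ, g • x ≠ 0 :=
  Finset.prod_ne_zero_iff.2 fun g _ => fun h0 => hx ((smul_eq_zero_iff_eq g).1 h0)

lemma SD.pow_mem (h : SD π D W e C0 C1) {m : ℕ} {x : B} (hx : x ∈ W m) (n : ℕ) :
    x ^ n ∈ W (n * m) := by
  induction n with
  | zero => simpa using h.one_mem
  | succ n ih => rw [pow_succ]; exact h.mono (by ring_nf; exact le_rfl) (h.mul_mem ih hx)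

lemma SD.iter_mem (h : SD π D W e C0 C1) {m : ℕ} {x : B} (hx : x ∈ W m) (n : ℕ) :
    D^[n] x ∈ W (m + n * C1) := by
  induction n with
  | zero => simpa using hx
  | succ n ih =>
    rw [Function.iterate_succ_apply']
    exact h.mono (by ring_nf; exact le_rfl) (h.D_mem ih)

/-- monomials `T ^ s * e i` -/
noncomputable def mon (e : Γ → B) (a : ℕ) (x : Fin a × Γ) : B := (X : k[X]) ^ (x.1 : ℕ) • e x.2

lemma SD.mon_mem (h : SD π D W e C0 C1) (a : ℕ) (x : Fin a × Γ) :
    mon (k := k) e a x ∈ W (a + C0) := by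
  rw [mon, Algebra.smul_def, map_pow]
  refine h.mono ?_ (h.mul_mem (h.pow_mem h.X_mem _) (h.e_mem _))
  have := x.1.2
  omega

lemma SD.mon_lin (h : SD π D W e C0 C1) (a : ℕ) : LinearIndependent k (mon (k := k) e a) := by
  have h1 : LinearIndependent k (fun s : Fin a => (X : k[X]) ^ (s : ℕ)) := by
    have := (Polynomial.basisMonomials k).linearIndependent.comp (fun s : Fin a => (s : ℕ))
      Fin.val_injective
    convert this using 1
    ext s : 1
    simp [X_pow_eq_monomial]
  exact linearIndependent_smul h1 h.lin

lemma SD.eq_zero_of_points (h : SD π D W e C0 C1) [Infinite k] {w : B}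
    (hw : ∀ ψ : B →ₐ[k] k, π.eval (ψ (algebraMap k[X] B X)) ≠ 0 → ψ w = 0) : w = 0 := by
  by_contra hw0
  obtain ⟨Q, hQ⟩ := h.norm (Γ := Γ) w
  have hQ0 : Q ≠ 0 := by
    rintro rfl
    rw [map_zero] at hQ
    exact h.norm_ne hw0 hQ.symm
  refine (mul_ne_zero h.π_ne hQ0) (Polynomial.funext fun t0 => ?_)
  rw [eval_mul, eval_zero]
  obtain ⟨ψ, hψ⟩ := h.pt t0
  by_cases hπ : π.eval t0 = 0
  · rw [hπ, zero_mul]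
  · have := hw ψ (by rwa [hψ])
    have e1 := point_algebraMap (ψ := ψ) Q
    rw [hQ, hψ, map_prod] at e1
    rw [← e1, Finset.prod_eq_zero (Finset.mem_univ 1) (by rwa [one_smul]), mul_zero]

variable {p : ℕ} [hp : Fact p.Prime] [CharP k p]

lemma D_pow_q [CharP B p] {f : ℕ} (hf : 0 < f) (u w : B) : D (u * w ^ p ^ f) = D u * w ^ p ^ f := by
  rw [Derivation.leibniz, Derivation.leibniz_pow]
  have : ((p ^ f : ℕ) : B) = 0 := by
    rw [Nat.cast_pow, CharP.cast_eq_zero, zero_pow hf.ne']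
  rw [nsmul_eq_mul, this]
  simp [mul_comm]

lemma D_iter_q [CharP B p] {f : ℕ} (hf : 0 < f) (u w : B) (i : ℕ) :
    D^[i] (u * w ^ p ^ f) = D^[i] u * w ^ p ^ f := by
  induction i with
  | zero => rfl
  | succ i ih => rw [Function.iterate_succ_apply', ih, D_pow_q hf, Function.iterate_succ_apply']

lemma D_iter_sum {ι : Type*} (s : Finset ι) (x : ι → B) (i : ℕ) :
    D^[i] (∑ j ∈ s, x j) = ∑ j ∈ s, D^[i] (x j) := by
  induction i with
  | zero => rfl
  | succ i ih => simp_rw [Function.iterate_succ_apply', ih, map_sum]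

/-- the auxiliary function does not vanish -/
lemma SD.aux_ne_zero [IsAlgClosed k] [CharP B p] (h : SD π D W e C0 C1) {f : ℕ} (hf : 0 < f)
    (a b : ℕ) (hp1 : Fintype.card Γ * (a + C0) + 1 ≤ p)
    (c : (Fin a × Γ) → (Fin b × Γ) → k) (hc : c ≠ 0) :
    ∑ y, (∑ x, c x y • mon (k := k) e a x) * (mon (k := k) e b y) ^ p ^ f ≠ 0 := by
  classical
  intro hH
  apply hc
  have hq : p ^ f ≠ 0 := pow_ne_zero _ hp.1.ne_zero
  choose c' hc' using fun x y => IsAlgClosed.exists_pow_nat_eq (c x y) (Nat.pos_of_ne_zero hq)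
  have hfrobB : ∀ x y : B, (x - y) ^ p ^ f = x ^ p ^ f - y ^ p ^ f := fun x y =>
    sub_pow_char_pow (p := p) x y f
  -- each point kills E
  have key : ∀ x, ∑ y, c' x y • mon (k := k) e b y = 0 := by
    intro x
    apply h.eq_zero_of_points
    intro ψ hψ
    have hE : ∑ y, (∑ x, c x y • mon (k := k) e a x) *
        (algebraMap k B (ψ (mon (k := k) e b y))) ^ p ^ f = 0 := by
      set E := ∑ y, (∑ x, c x y • mon (k := k) e a x) *
        (algebraMap k B (ψ (mon (k := k) e b y))) ^ p ^ f with hEdef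
      have hord : Ord D ψ (p ^ f) E := by
        have : E = ∑ y, (-(∑ x, c x y • mon (k := k) e a x)) * (mon (k := k) e b y -
            algebraMap k B (ψ (mon (k := k) e b y))) ^ p ^ f := by
          rw [← sub_eq_zero, hEdef, ← Finset.sum_sub_distrib, ← hH]
          refine Finset.sum_congr rfl fun y _ => ?_
          rw [hfrobB]; ring
        rw [this]
        refine Ord.sum _ fun y _ => ?_
        have := (Ord.pow (D := D) (ψ := ψ) (x := mon (k := k) e b y -
            algebraMap k B (ψ (mon (k := k) e b y))) (by simp) (p ^ f))
        have h2 := Ord.mul (D := D) (ψ := ψ) (m := 0)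
          (x := (-(∑ x, c x y • mon (k := k) e a x))) trivial this
        exact h2.mono (by omega)
      have hEW : E ∈ W (a + C0) := by
        refine Submodule.sum_mem _ fun y _ => ?_
        rw [← map_pow, mul_comm, ← Algebra.smul_def]
        refine Submodule.smul_mem _ _ (Submodule.sum_mem _ fun x _ => ?_)
        exact Submodule.smul_mem _ _ (h.mon_mem a x)
      obtain ⟨Q, hQ⟩ := h.norm (Γ := Γ) E
      by_contra hE0
      have hQ0 : Q ≠ 0 := by
        rintro rfl
        rw [map_zero] at hQ
        exact h.norm_ne hE0 hQ.symm
      have hdeg : natDegree Q ≤ Fintype.card Γ * (a + C0) := by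
        apply h.deg; rw [hQ]; exact h.norm_mem hEW
      have hordQ : Ord D ψ (Fintype.card Γ * (a + C0) + 1) (algebraMap k[X] B Q) := by
        rw [hQ, ← Finset.mul_prod_erase _ _ (Finset.mem_univ (1 : Γ)), one_smul]
        have h2 := Ord.mul (D := D) (ψ := ψ) (n := 0)
          (y := ∏ g ∈ Finset.univ.erase (1 : Γ), g • E) hord trivial
        refine h2.mono (hp1.trans ?_)
        simpa using Nat.le_self_pow hf.ne' p
      have hdvd := dvd_of_ord (p := p) h.hDX hψ _ hp1 Q hordQ
      have := natDegree_le_of_dvd hdvd hQ0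
      rw [natDegree_pow, natDegree_X_sub_C] at this
      omega
    have hE2 : ∑ x, (∑ y, c x y * ψ (mon (k := k) e b y) ^ p ^ f) • mon (k := k) e a x = 0 := by
      rw [← hE]
      simp_rw [Finset.sum_smul, Finset.sum_mul]
      rw [Finset.sum_comm]
      refine Finset.sum_congr rfl fun y _ => Finset.sum_congr rfl fun x _ => ?_
      rw [← map_pow (algebraMap k B), mul_comm _ (algebraMap k B _), ← Algebra.smul_def, smul_smul, mul_comm]
    have h3 := (Fintype.linearIndependent_iff.1 (h.mon_lin a)) _ hE2 x
    have h4 : (ψ (∑ y, c' x y • mon (k := k) e b y)) ^ p ^ f = 0 := by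
      rw [map_sum, sum_pow_char_pow, ← h3]
      refine Finset.sum_congr rfl fun y _ => ?_
      rw [map_smul, smul_eq_mul, mul_pow, hc']
    exact pow_eq_zero_iff hq |>.1 h4
  funext x y
  have := (Fintype.linearIndependent_iff.1 (h.mon_lin b)) _ (key x) y
  rw [← hc', this, zero_pow hq]; rfl

/-- Stepanov's bound -/
theorem SD.core [IsAlgClosed k] [CharP B p] (h : SD π D W e C0 C1) {f : ℕ} (hf : 0 < f)
    (b M a : ℕ) (hM : M + 1 = Fintype.card Γ * b)
    (ha : a = (M + 1) * (b + 3 * C0 + M * C1 + 1))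
    (hp1 : Fintype.card Γ * (a + C0) + 1 ≤ p) (hp2 : Fintype.card Γ * M ≤ p)
    (θ : B →+* B)
    (hθW : ∀ {m x}, x ∈ W m → θ x ∈ W m)
    (ψ : k → (B →ₐ[k] k)) (hψ : ∀ t0, ψ t0 (algebraMap k[X] B X) = t0)
    (S : Finset (k × Γ)) (hS1 : ∀ s ∈ S, π.eval s.1 ≠ 0)
    (hS2 : ∀ s ∈ S, ∀ x : B, (ψ s.1 (s.2 • x)) ^ p ^ f = ψ s.1 (s.2 • θ x)) :
    M * S.card ≤ Fintype.card Γ * (a + C0 + p ^ f * (b + C0)) := by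
  classical
  set R := a + C0 + M * C1 + (b + C0) with hR
  have hfinite := h.finite R
  -- the linear conditions
  let Tκ (κ : ℕ) : ((Fin a × Γ) × (Fin b × Γ) → k) →ₗ[k] B :=
    ∑ y : Fin b × Γ, (LinearMap.mulRight k (θ (mon (k := k) e b y))) ∘ₗ
      ((D : B →ₗ[k] B) ^ κ) ∘ₗ
      (∑ x : Fin a × Γ, (LinearMap.proj (x, y) :
        ((Fin a × Γ) × (Fin b × Γ) → k) →ₗ[k] k).smulRight (mon (k := k) e a x))
  have hTκ : ∀ κ c, Tκ κ c = ∑ y, D^[κ] (∑ x, c (x, y) • mon (k := k) e a x) *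
      θ (mon (k := k) e b y) := by
    intro κ c
    simp only [Tκ, LinearMap.sum_apply, LinearMap.comp_apply, LinearMap.mulRight_apply,
      Module.End.pow_apply, LinearMap.smulRight_apply, LinearMap.proj_apply]
    rfl
  have hmem : ∀ κ : Fin M, ∀ c, Tκ κ c ∈ W R := by
    intro κ c
    rw [hTκ]
    refine Submodule.sum_mem _ fun y _ => ?_
    have h1 : (∑ x, c (x, y) • mon (k := k) e a x) ∈ W (a + C0) :=
      Submodule.sum_mem _ fun x _ => Submodule.smul_mem _ _ (h.mon_mem a x)
    refine h.mono ?_ (h.mul_mem (h.iter_mem h1 κ) (hθW (h.mon_mem b y)))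
    have : (κ : ℕ) * C1 ≤ M * C1 := Nat.mul_le_mul_right _ κ.2.le
    omega
  let Φ : ((Fin a × Γ) × (Fin b × Γ) → k) →ₗ[k] (Fin M → W R) :=
    LinearMap.pi fun κ => (Tκ κ).codRestrict (W R) (hmem κ)
  have hcard : Module.finrank k (Fin M → W R) <
      Module.finrank k ((Fin a × Γ) × (Fin b × Γ) → k) := by
    rw [Module.finrank_pi_fintype, Module.finrank_fintype_fun_eq_card]
    simp only [Finset.sum_const, Finset.card_univ, Fintype.card_fin, Fintype.card_prod, smul_eq_mul]
    have h1 := h.finrank_le R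
    set G := Fintype.card Γ with hG
    have hGpos : 0 < G := Fintype.card_pos
    have h2 : R + C0 + 1 = a + (b + 3 * C0 + M * C1 + 1) := by omega
    rw [h2] at h1
    set K' := b + 3 * C0 + M * C1 + 1 with hK'
    calc M * Module.finrank k (W R) ≤ M * (G * (a + K')) := Nat.mul_le_mul_left _ h1
      _ = G * (M * (a + K')) := by ring
      _ < G * (a * (M + 1)) := by
          apply Nat.mul_lt_mul_of_pos_left _ hGpos
          have : M * K' < a := by
            rw [ha]
            have : 0 < K' := by omega
            nlinarith
          nlinarith
      _ = a * G * (b * G) := by rw [hM]; ring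
  have hker : LinearMap.ker Φ ≠ ⊥ := LinearMap.ker_ne_bot_of_finrank_lt hcard
  obtain ⟨c, hcker, hc0⟩ := Submodule.exists_mem_ne_zero_of_ne_bot hker
  have hT0 : ∀ κ < M, ∑ y, D^[κ] (∑ x, c (x, y) • mon (k := k) e a x) *
      θ (mon (k := k) e b y) = 0 := by
    intro κ hκ
    rw [← hTκ]
    have := congrFun (LinearMap.mem_ker.1 hcker) ⟨κ, hκ⟩
    simpa [Φ, Subtype.ext_iff] using this
  set H := ∑ y, (∑ x, c (x, y) • mon (k := k) e a x) * (mon (k := k) e b y) ^ p ^ f with hH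
  have hH0 : H ≠ 0 := by
    refine h.aux_ne_zero hf a b hp1 (fun x y => c (x, y)) ?_
    intro h0
    apply hc0
    funext z
    exact congrFun (congrFun h0 z.1) z.2
  have hHW : H ∈ W (a + C0 + p ^ f * (b + C0)) := by
    refine Submodule.sum_mem _ fun y _ => ?_
    exact h.mul_mem (Submodule.sum_mem _ fun x _ => Submodule.smul_mem _ _ (h.mon_mem a x))
      (h.pow_mem (h.mon_mem b y) _)
  obtain ⟨Q, hQ⟩ := h.norm (Γ := Γ) H
  have hQ0 : Q ≠ 0 := by
    rintro rfl
    rw [map_zero] at hQ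
    exact h.norm_ne hH0 hQ.symm
  have hdeg : natDegree Q ≤ Fintype.card Γ * (a + C0 + p ^ f * (b + C0)) := by
    apply h.deg; rw [hQ]; exact h.norm_mem hHW
  refine le_trans ?_ hdeg
  -- order of vanishing
  have hDg : ∀ (g : Γ) (i : ℕ) (x : B), D^[i] (g • x) = g • D^[i] x := by
    intro g i x
    induction i with
    | zero => rfl
    | succ i ih => rw [Function.iterate_succ_apply', ih, h.comm, Function.iterate_succ_apply']
  have hordS : ∀ s ∈ S, Ord D (ψ s.1) M (s.2 • H) := by
    intro s hs
    apply Ord.of_forall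
    intro i hi
    have : D^[i] H = ∑ y, D^[i] (∑ x, c (x, y) • mon (k := k) e a x) *
        (mon (k := k) e b y) ^ p ^ f := by
      rw [hH, D_iter_sum]
      exact Finset.sum_congr rfl fun y _ => D_iter_q hf _ _ _
    rw [hDg, this, Finset.smul_sum, map_sum]
    have e0 : ψ s.1 (s.2 • (∑ y, D^[i] (∑ x, c (x, y) • mon (k := k) e a x) *
      θ (mon (k := k) e b y))) = 0 := by rw [hT0 i hi, smul_zero, map_zero]
    rw [← e0, Finset.smul_sum, map_sum]
    refine Finset.sum_congr rfl fun y _ => ?_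
    rw [smul_mul', smul_mul', map_mul, map_mul, smul_pow', map_pow, hS2 s hs]
  -- divisibility
  let mt (t0 : k) : ℕ := (S.filter fun s => s.1 = t0).card
  have hdvd : ∀ t0 ∈ S.image Prod.fst, (X - C t0) ^ (M * mt t0) ∣ Q := by
    intro t0 ht0
    obtain ⟨s0, hs0, rfl⟩ := Finset.mem_image.1 ht0
    have hmt : mt s0.1 = (Finset.univ.filter fun g : Γ => (s0.1, g) ∈ S).card := by
      refine Finset.card_bij' (fun s _ => s.2) (fun g _ => (s0.1, g)) ?_ ?_ ?_ ?_
      · intro s hs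
        simp only [Finset.mem_filter, Finset.mem_univ, true_and] at hs ⊢
        rw [← hs.2]; exact hs.1
      · intro g hg
        simp only [Finset.mem_filter, Finset.mem_univ, true_and] at hg ⊢
        exact ⟨hg, trivial⟩
      · intro s hs
        simp only [Finset.mem_filter] at hs
        rw [← hs.2]
      · intro g hg; rfl
    have hle : mt s0.1 ≤ Fintype.card Γ := by rw [hmt]; exact Finset.card_le_univ _
    have hord : Ord D (ψ s0.1) (M * mt s0.1) (algebraMap k[X] B Q) := by
      rw [hQ, hmt]
      have := Ord.prod (D := D) (ψ := ψ s0.1) Finset.univ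
        (m := fun g : Γ => if (s0.1, g) ∈ S then M else 0) (x := fun g => g • H) ?_
      · rw [← Finset.sum_filter, Finset.sum_const, smul_eq_mul, mul_comm] at this
        exact this
      · intro g _
        by_cases hg : (s0.1, g) ∈ S
        · simp only [hg, if_true]; exact hordS _ hg
        · simp only [hg, if_false]; trivial
    have := dvd_of_ord (p := p) h.hDX (ψ := ψ s0.1) (by rw [hψ]; exact hS1 _ hs0) (M * mt s0.1)
      (by nlinarith) Q hord
    rwa [hψ] at this
  have hprod : ∏ t0 ∈ S.image Prod.fst, (X - C t0) ^ (M * mt t0) ∣ Q := by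
    refine Finset.prod_dvd_of_coprime ?_ hdvd
    intro x _ y _ hxy
    exact (isCoprime_X_sub_C_of_isUnit_sub (sub_ne_zero.2 hxy).isUnit).pow
  have := natDegree_le_of_dvd hprod hQ0
  rw [natDegree_prod_of_monic _ _ (fun t0 _ => (monic_X_sub_C t0).pow _)] at this
  simp only [natDegree_pow, natDegree_X_sub_C, mul_one] at this
  rw [← Finset.mul_sum] at this
  rwa [← Finset.card_eq_sum_card_image] at this

end
end PC

namespace PC

section
variable {k B Γ : Type*} [Field k] [CommRing B] [IsDomain B] [Algebra k B] [Algebra k[X] B]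
    [IsScalarTower k k[X] B] [Group Γ] [Fintype Γ] [MulSemiringAction Γ B]
    {π : k[X]} {D : Derivation k B B} {W : ℕ → Submodule k B} {e : Γ → B} {C0 C1 : ℕ}

lemma SD.smul_const (h : SD π D W e C0 C1) (g : Γ) (a : k) :
    g • algebraMap k B a = algebraMap k B a := by
  rw [IsScalarTower.algebraMap_apply k k[X] B]; exact h.fix g _

/-- a point twisted by a group element -/
def SD.twist (h : SD π D W e C0 C1) (ψ : B →ₐ[k] k) (g : Γ) : B →ₐ[k] k :=
  { ψ.toRingHom.comp (MulSemiringAction.toRingHom Γ B g) with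
    commutes' := fun a => by
      change ψ (g • algebraMap k B a) = _
      rw [h.smul_const]; exact ψ.commutes a }

lemma SD.twist_apply (h : SD π D W e C0 C1) (ψ : B →ₐ[k] k) (g : Γ) (x : B) :
    h.twist ψ g x = ψ (g • x) := rfl

lemma SD.trans (h : SD π D W e C0 C1) (ψ ψ' : B →ₐ[k] k)
    (hh : ψ (algebraMap k[X] B X) = ψ' (algebraMap k[X] B X)) :
    ∃ g : Γ, ∀ x, ψ' x = ψ (g • x) := by
  haveI : SMulCommClass Γ k[X] B := ⟨fun g P x => by
    rw [Algebra.smul_def, Algebra.smul_def, smul_mul', h.fix]⟩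
  haveI : Algebra.IsInvariant k[X] B Γ := ⟨fun b hb => h.inv b hb⟩
  haveI h1 : (RingHom.ker ψ).IsPrime := RingHom.ker_isPrime _
  haveI h2 : (RingHom.ker ψ').IsPrime := RingHom.ker_isPrime _
  have hu : (RingHom.ker ψ).under k[X] = (RingHom.ker ψ').under k[X] := by
    ext P
    rw [Ideal.under_def, Ideal.under_def, Ideal.mem_comap, Ideal.mem_comap, RingHom.mem_ker,
      RingHom.mem_ker]
    rw [point_algebraMap (ψ := ψ) P, point_algebraMap (ψ := ψ') P, hh]
  obtain ⟨g, hg⟩ := Algebra.IsInvariant.exists_smul_of_under_eq k[X] B Γ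
    (RingHom.ker ψ) (RingHom.ker ψ') hu
  refine ⟨g⁻¹, fun x => ?_⟩
  have hx : x - algebraMap k B (ψ' x) ∈ RingHom.ker ψ' := by
    rw [RingHom.mem_ker]; simp
  rw [hg, Ideal.mem_pointwise_smul_iff_inv_smul_mem, RingHom.mem_ker, smul_sub,
    h.smul_const, map_sub] at hx
  have h3 : ψ (algebraMap k B (ψ' x)) = ψ' x := ψ.commutes _
  rw [h3, sub_eq_zero] at hx
  exact hx.symm

variable {p : ℕ} [hp : Fact p.Prime] [CharP k p]

lemma SD.exists_frob (h : SD π D W e C0 C1) [IsAlgClosed k] {f : ℕ}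
    (θ : B →+* B) (hθX : θ (algebraMap k[X] B X) = algebraMap k[X] B X)
    (hθk : ∀ a : k, θ (algebraMap k B a) = algebraMap k B (a ^ p ^ f))
    (ψ : B →ₐ[k] k)
    (hψ : (ψ (algebraMap k[X] B X)) ^ p ^ f = ψ (algebraMap k[X] B X)) :
    ∃ γ : Γ, ∀ x, ψ x ^ p ^ f = ψ (θ (γ • x)) := by
  have hbij : Function.Bijective (iterateFrobenius k p f) := by
    refine ⟨(iterateFrobenius k p f).injective, fun y => ?_⟩
    obtain ⟨z, hz⟩ := IsAlgClosed.exists_pow_nat_eq y (pow_pos hp.1.pos f)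
    exact ⟨z, by rw [iterateFrobenius_def]; exact hz⟩
  let φ : k ≃+* k := RingEquiv.ofBijective _ hbij
  have hφ : ∀ a, φ a = a ^ p ^ f := fun a => by
    change iterateFrobenius k p f a = _; rw [iterateFrobenius_def]
  let ψ' : B →ₐ[k] k :=
    { (φ.symm : k →+* k).comp (ψ.toRingHom.comp θ) with
      commutes' := fun a => by
        change φ.symm (ψ (θ (algebraMap k B a))) = a
        rw [hθk, RingEquiv.symm_apply_eq, hφ]
        exact ψ.commutes _ }
  have hψ' : ∀ x, ψ' x ^ p ^ f = ψ (θ x) := fun x => by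
    change φ.symm (ψ (θ x)) ^ p ^ f = _
    rw [← hφ, RingEquiv.apply_symm_apply]
  have hX : ψ' (algebraMap k[X] B X) = ψ (algebraMap k[X] B X) := by
    apply φ.injective
    rw [hφ, hφ, hψ', hθX, hψ]
  obtain ⟨g, hg⟩ := h.trans ψ' ψ hX
  exact ⟨g, fun x => by rw [hg, hψ']⟩

/-- the bound on the number of points with given Frobenius -/
def StepBound (h : SD π D W e C0 C1) (q : ℕ) (θ : B →+* B) (δ : ℝ) : Prop :=
  ∀ (ψ : k → (B →ₐ[k] k)) (hψ : ∀ t0, ψ t0 (algebraMap k[X] B X) = t0)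
    (γ : Γ) (S : Finset (k × Γ)) (hS1 : ∀ s ∈ S, π.eval s.1 ≠ 0)
    (hS2 : ∀ s ∈ S, ∀ x : B, (ψ s.1 (s.2 • x)) ^ q = ψ s.1 (s.2 • θ (γ • x))),
    (S.card : ℝ) ≤ (1 + δ) * q

open Classical in
lemma SD.equi_upper (h : SD π D W e C0 C1) [IsAlgClosed k] {f : ℕ}
    (θ : B →+* B) (hθX : θ (algebraMap k[X] B X) = algebraMap k[X] B X)
    (hθk : ∀ a : k, θ (algebraMap k B a) = algebraMap k B (a ^ p ^ f))
    {δ : ℝ} (hδ : 0 ≤ δ) (hb : StepBound h (p ^ f) θ δ)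
    (𝔉 : Finset k) (hF : ∀ t ∈ 𝔉, t ^ p ^ f = t)
    (R : k → Prop) (E : Γ → Prop)
    (hRE : ∀ t ∈ 𝔉, π.eval t ≠ 0 → ∀ ψ : B →ₐ[k] k, ψ (algebraMap k[X] B X) = t →
      ∀ γ : Γ, (∀ x, ψ x ^ p ^ f = ψ (θ (γ • x))) → (R t → E γ)) :
    ((𝔉.filter R).card : ℝ) ≤
      ((Finset.univ.filter E).card : ℝ) / Fintype.card Γ * (p ^ f : ℕ) + δ * (p ^ f : ℕ) +
        natDegree π := by
  choose ψ hψ using h.pt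
  have hex : ∀ s : k × Γ, ∃ γ : Γ, s.1 ∈ 𝔉 →
      ∀ x, (ψ s.1 (s.2 • x)) ^ p ^ f = ψ s.1 (s.2 • θ (γ • x)) := by
    intro s
    by_cases hs : s.1 ∈ 𝔉
    · have e1 : h.twist (ψ s.1) s.2 (algebraMap k[X] B X) = s.1 := by
        rw [h.twist_apply, h.fix, hψ]
      obtain ⟨γ, hγ⟩ := h.exists_frob (Γ := Γ) (p := p) θ hθX hθk (h.twist (ψ s.1) s.2)
        (by rw [e1, hF _ hs])
      exact ⟨γ, fun _ => hγ⟩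
    · exact ⟨1, fun h => absurd h hs⟩
  choose γ hγ using hex
  set good := (𝔉.filter R).filter (fun t => π.eval t ≠ 0) with hgood
  set P := good ×ˢ (Finset.univ : Finset Γ) with hP
  have hmaps : ∀ s ∈ P, γ s ∈ Finset.univ.filter E := by
    intro s hs
    rw [hP, Finset.mem_product, hgood, Finset.mem_filter, Finset.mem_filter] at hs
    obtain ⟨⟨⟨h1, h2⟩, h3⟩, -⟩ := hs
    rw [Finset.mem_filter]
    refine ⟨Finset.mem_univ _, hRE s.1 h1 h3 (h.twist (ψ s.1) s.2) ?_ (γ s) ?_ h2⟩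
    · rw [h.twist_apply, h.fix, hψ]
    · exact hγ s h1
  have hcard := Finset.card_eq_sum_card_fiberwise hmaps
  have hfib : ∀ g ∈ Finset.univ.filter E, ((P.filter (fun s => γ s = g)).card : ℝ) ≤
      (1 + δ) * (p ^ f : ℕ) := by
    intro g _
    refine hb ψ hψ g _ ?_ ?_
    · intro s hs
      rw [Finset.mem_filter, hP, Finset.mem_product, hgood, Finset.mem_filter] at hs
      exact hs.1.1.2
    · intro s hs
      rw [Finset.mem_filter, hP, Finset.mem_product, hgood, Finset.mem_filter,
        Finset.mem_filter] at hs
      rw [← hs.2]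
      exact hγ s hs.1.1.1.1
  have h1 : (P.card : ℝ) ≤ (Finset.univ.filter E).card * ((1 + δ) * (p ^ f : ℕ)) := by
    rw [hcard, Nat.cast_sum]
    refine (Finset.sum_le_sum hfib).trans ?_
    rw [Finset.sum_const, nsmul_eq_mul]
  rw [hP, Finset.card_product, Finset.card_univ, Nat.cast_mul] at h1
  have hbad : (𝔉.filter R).card ≤ good.card + natDegree π := by
    have h2 := Finset.card_filter_add_card_filter_not (s := 𝔉.filter R)
      (fun t => π.eval t ≠ 0)
    have h3 : ((𝔉.filter R).filter (fun t => ¬ π.eval t ≠ 0)).card ≤ natDegree π := by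
      refine le_trans (Finset.card_le_card ?_) (le_trans (Multiset.toFinset_card_le _)
        (card_roots' π))
      intro t ht
      rw [Finset.mem_filter, not_not] at ht
      rw [Multiset.mem_toFinset, mem_roots h.π_ne]
      exact ht.2
    rw [hgood]; omega
  have hbad' : ((𝔉.filter R).card : ℝ) ≤ good.card + natDegree π := by exact_mod_cast hbad
  have hG : (0 : ℝ) < Fintype.card Γ := by exact_mod_cast Fintype.card_pos
  have hE : ((Finset.univ.filter E).card : ℝ) ≤ Fintype.card Γ := by
    exact_mod_cast Finset.card_le_univ _
  have hq : (0 : ℝ) ≤ (p ^ f : ℕ) := Nat.cast_nonneg _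
  have h5 : (good.card : ℝ) ≤ ((Finset.univ.filter E).card : ℝ) / Fintype.card Γ * (p ^ f : ℕ)
      + δ * (p ^ f : ℕ) := by
    rw [← mul_le_mul_iff_left₀ hG]
    refine h1.trans ?_
    have : (((Finset.univ.filter E).card : ℝ) / Fintype.card Γ * (p ^ f : ℕ)
      + δ * (p ^ f : ℕ)) * Fintype.card Γ =
      ((Finset.univ.filter E).card : ℝ) * (p ^ f : ℕ) + δ * (p ^ f : ℕ) * Fintype.card Γ := by
      field_simp
    rw [this]
    have : ((Finset.univ.filter E).card : ℝ) * (δ * (p ^ f : ℕ)) ≤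
      δ * (p ^ f : ℕ) * Fintype.card Γ := by
      rw [mul_comm]; exact mul_le_mul_of_nonneg_left hE (by positivity)
    linarith
  linarith

open Classical in
lemma SD.equi_lower (h : SD π D W e C0 C1) [IsAlgClosed k] {f : ℕ}
    (θ : B →+* B) (hθX : θ (algebraMap k[X] B X) = algebraMap k[X] B X)
    (hθk : ∀ a : k, θ (algebraMap k B a) = algebraMap k B (a ^ p ^ f))
    {δ : ℝ} (hδ : 0 ≤ δ) (hb : StepBound h (p ^ f) θ δ)
    (𝔉 : Finset k) (hF : ∀ t ∈ 𝔉, t ^ p ^ f = t) (hFc : 𝔉.card = p ^ f)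
    (R : k → Prop) (E : Γ → Prop)
    (hRE : ∀ t ∈ 𝔉, π.eval t ≠ 0 → ∀ ψ : B →ₐ[k] k, ψ (algebraMap k[X] B X) = t →
      ∀ γ : Γ, (∀ x, ψ x ^ p ^ f = ψ (θ (γ • x))) → (E γ → R t)) :
    ((Finset.univ.filter E).card : ℝ) / Fintype.card Γ * (p ^ f : ℕ) ≤
      ((𝔉.filter R).card : ℝ) + δ * (p ^ f : ℕ) + natDegree π := by
  have h1 : ((𝔉.filter (fun t => ¬ R t)).card : ℝ) ≤
      ((Finset.univ.filter (fun g => ¬ E g)).card : ℝ) / Fintype.card Γ * (p ^ f : ℕ) +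
        δ * (p ^ f : ℕ) + natDegree π := by
    convert h.equi_upper (p := p) θ hθX hθk hδ hb 𝔉 hF (fun t => ¬ R t) (fun g => ¬ E g)
     (fun t h1 h2 ψ h3 γ h4 => mt (hRE t h1 h2 ψ h3 γ h4))
  have h2 := Finset.card_filter_add_card_filter_not (s := 𝔉) R
  have h3 := Finset.card_filter_add_card_filter_not (s := (Finset.univ : Finset Γ)) E
  rw [Finset.card_univ] at h3
  rw [hFc] at h2
  have hG : (0 : ℝ) < Fintype.card Γ := by exact_mod_cast Fintype.card_pos
  have h2' : ((𝔉.filter R).card : ℝ) + (𝔉.filter (fun t => ¬ R t)).card = (p ^ f : ℕ) := by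
    exact_mod_cast h2
  have h3' : ((Finset.univ.filter E).card : ℝ) / Fintype.card Γ +
     ((Finset.univ.filter (fun g => ¬ E g)).card : ℝ) / Fintype.card Γ = 1 := by
    rw [← add_div, div_eq_one_iff_eq hG.ne']; exact_mod_cast h3
  have h4 : ((Finset.univ.filter E).card : ℝ) / Fintype.card Γ * (p ^ f : ℕ) +
     ((Finset.univ.filter (fun g => ¬ E g)).card : ℝ) / Fintype.card Γ * (p ^ f : ℕ)
      = (p ^ f : ℕ) := by rw [← add_mul, h3', one_mul]
  linarith

end

/-- numerical choices -/
lemma step_numeric (D0 C0 C1 : ℕ) (δ : ℝ) (hδ : 0 < δ) :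
    ∃ P0 : ℕ, ∀ G, 0 < G → G ≤ D0 → ∃ b M a : ℕ, M + 1 = G * b ∧
      a = (M + 1) * (b + 3 * C0 + M * C1 + 1) ∧ ∀ p, P0 ≤ p →
        (G * (a + C0) + 1 ≤ p ∧ G * M ≤ p ∧ ∀ q n : ℕ, p ≤ q →
          M * n ≤ G * (a + C0 + q * (b + C0)) → (n : ℝ) ≤ (1 + δ) * q) := by
  have main : ∀ G : ℕ, ∃ P0 : ℕ, 0 < G → ∃ b M a : ℕ, M + 1 = G * b ∧
      a = (M + 1) * (b + 3 * C0 + M * C1 + 1) ∧ ∀ p, P0 ≤ p →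
        (G * (a + C0) + 1 ≤ p ∧ G * M ≤ p ∧ ∀ q n : ℕ, p ≤ q →
          M * n ≤ G * (a + C0 + q * (b + C0)) → (n : ℝ) ≤ (1 + δ) * q) := by
    intro G
    rcases Nat.eq_zero_or_pos G with rfl | hG
    · exact ⟨0, fun h => absurd h (lt_irrefl _)⟩
    -- choose b with  G*C0 + 1 + 1 + δ≤ δ * (G*b-1)
    obtain ⟨b, hb⟩ := exists_nat_gt ((G * C0 + 2 + δ) / δ)
    rw [div_lt_iff₀ hδ] at hb
    have hb1 : 0 < b := by
      rcases Nat.eq_zero_or_pos b with rfl | h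
      · exfalso; simp at hb; nlinarith [mul_nonneg (Nat.cast_nonneg (α := ℝ) G) (Nat.cast_nonneg (α := ℝ) C0)]
      · exact h
    obtain ⟨M, hM⟩ : ∃ M, M + 1 = G * b := ⟨G * b - 1, Nat.sub_add_cancel (Nat.mul_pos hG hb1)⟩
    set a := (M + 1) * (b + 3 * C0 + M * C1 + 1) with ha
    refine ⟨G * (a + C0) + 1 + G * M, fun _ => ⟨b, M, a, hM, ha, fun p hp => ⟨by omega, by omega, ?_⟩⟩⟩
    intro q n hq hn
    have hn' : (M : ℝ) * n ≤ G * (a + C0 + q * (b + C0)) := by exact_mod_cast hn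
    have hM' : (M : ℝ) + 1 = G * b := by exact_mod_cast hM
    have hGq : (G : ℝ) * (a + C0) ≤ q := by
      have : G * (a + C0) ≤ q := by omega
      exact_mod_cast this
    have hG1 : (1 : ℝ) ≤ G := by exact_mod_cast hG
    have hbM : (b : ℝ) ≤ M + 1 := by rw [hM']; nlinarith [Nat.cast_nonneg (α := ℝ) b]
    have hMδ : (G : ℝ) * C0 + 2 ≤ δ * M := by nlinarith
    have hMpos : (0 : ℝ) < M := by
      have : (0 : ℝ) < δ * M := by
        have : (0 : ℝ) ≤ (G : ℝ) * C0 := by positivity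
        linarith
      exact (mul_pos_iff_of_pos_left hδ).1 this
    have hq0 : (0 : ℝ) ≤ q := Nat.cast_nonneg _
    rw [← mul_le_mul_iff_right₀ hMpos]
    refine hn'.trans ?_
    have e1 : (G : ℝ) * (a + C0 + q * (b + C0)) = G * (a + C0) + q * (M + 1) + q * (G * C0) := by
      rw [hM']; ring
    rw [e1]
    nlinarith
  choose P hP using main
  refine ⟨(Finset.range (D0 + 1)).sup P, fun G hG hGD => ?_⟩
  obtain ⟨b, M, a, h1, h2, h3⟩ := hP G hG
  refine ⟨b, M, a, h1, h2, fun p hp => h3 p (le_trans ?_ hp)⟩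
  exact Finset.le_sup (f := P) (Finset.mem_range.2 (by omega))

theorem SD.stepBound {k B Γ : Type*} [Field k] [CommRing B] [IsDomain B] [Algebra k B]
    [Algebra k[X] B]
    [IsScalarTower k k[X] B] [Group Γ] [Fintype Γ] [MulSemiringAction Γ B]
    {π : k[X]} {D : Derivation k B B} {W : ℕ → Submodule k B} {e : Γ → B} {C0 C1 : ℕ}
    (h : SD π D W e C0 C1) [IsAlgClosed k] {p f : ℕ} [hp : Fact p.Prime] [CharP k p] (hf : 0 < f)
    (θ : B →+* B) (hθW : ∀ {m x}, x ∈ W m → θ x ∈ W m) {δ : ℝ}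
    (hnum : ∃ b M a : ℕ, M + 1 = Fintype.card Γ * b ∧
      a = (M + 1) * (b + 3 * C0 + M * C1 + 1) ∧
        (Fintype.card Γ * (a + C0) + 1 ≤ p ∧ Fintype.card Γ * M ≤ p ∧ ∀ q n : ℕ, p ≤ q →
          M * n ≤ Fintype.card Γ * (a + C0 + q * (b + C0)) → (n : ℝ) ≤ (1 + δ) * q)) :
    StepBound h (p ^ f) θ δ := by
  obtain ⟨b, M, a, h1, h2, h3, h4, h5⟩ := hnum
  haveI : CharP B p := charP_of_injective_algebraMap (algebraMap k B).injective p
  intro ψ hψ γ S hS1 hS2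
  refine h5 _ _ (Nat.le_self_pow hf.ne' p) ?_
  exact h.core hf b M a h1 h2 h3 h4 (θ.comp (MulSemiringAction.toRingHom Γ B γ))
    (fun hx => hθW (h.smul_mem γ hx)) ψ hψ S hS1 hS2

end PC

namespace PC

section deriv
variable (k K L : Type*) [Field k] [Field K] [Field L] [Algebra k[X] K] [IsFractionRing k[X] K]
  [Algebra K L] [Algebra k[X] L] [IsScalarTower k[X] K L] [Algebra k L] [IsScalarTower k k[X] L]

include K in
lemma formallyEtale_poly [Algebra.IsSeparable K L] : Algebra.FormallyEtale k[X] L := by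
  have h1 : Algebra.FormallyEtale k[X] K :=
    Algebra.FormallyEtale.of_isLocalization (nonZeroDivisors k[X])
  have h2 : Algebra.FormallyEtale K L := Algebra.FormallyEtale.of_isSeparable K L
  exact Algebra.FormallyEtale.comp k[X] K L

include K in
lemma exists_deriv [Algebra.IsSeparable K L] :
    ∃ D : Derivation k L L, D (algebraMap k[X] L X) = 1 := by
  have := formallyEtale_poly k K L
  let D0 : Derivation k k[X] L := Polynomial.mkDerivation k (1 : L)
  let l := D0.liftKaehlerDifferential
  let l2 := (LinearMap.liftBaseChange L l) ∘ₗ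
    ((KaehlerDifferential.tensorKaehlerEquivOfFormallyEtale k k[X] L).symm : _ ≃ₗ[L] _).toLinearMap
  refine ⟨l2.compDer (KaehlerDifferential.D k L), ?_⟩
  change l2 (KaehlerDifferential.D k L (algebraMap k[X] L X)) = 1
  simp only [l2, LinearMap.comp_apply, LinearEquiv.coe_coe]
  rw [KaehlerDifferential.tensorKaehlerEquivOfFormallyEtale_symm_D_algebraMap]
  rw [LinearMap.liftBaseChange_tmul, one_smul]
  simp [l, D0]

include K in
lemma deriv_unique [Algebra.IsSeparable K L] (D1 D2 : Derivation k L L)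
    (h : D1 (algebraMap k[X] L X) = D2 (algebraMap k[X] L X)) (x : L) : D1 x = D2 x := by
  have := formallyEtale_poly k K L
  have hP : ∀ P, D1 (algebraMap k[X] L P) = D2 (algebraMap k[X] L P) := by
    intro P
    have e : algebraMap k[X] L P = aeval (algebraMap k[X] L X) P := by
      rw [aeval_algebraMap_apply, aeval_X_left_apply]
    rw [e, Derivation.map_aeval, Derivation.map_aeval, h]
  let E : Derivation k[X] L L :=
    { toFun := fun x => D1 x - D2 x
      map_add' := fun x y => by simp only [map_add]; ring
      map_smul' := fun P x => by
        simp only [Algebra.smul_def, Derivation.leibniz, hP, RingHom.id_apply, Algebra.algebraMap_self_apply]; ring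
      map_one_eq_zero' := by simp
      leibniz' := fun x y => by
        simp only [LinearMap.coe_mk, AddHom.coe_mk, Derivation.leibniz, smul_eq_mul]; ring }
  have h0 : Subsingleton (Ω[L⁄k[X]]) := inferInstance
  have h1 : E x = 0 := by
    rw [← Derivation.liftKaehlerDifferential_comp_D E x,
      Subsingleton.elim (KaehlerDifferential.D k[X] L x) 0, map_zero]
  exact sub_eq_zero.1 h1

variable {k L}

lemma deriv_comm [Algebra k K] [IsScalarTower k k[X] K] [IsScalarTower k K L]
    [Algebra.IsSeparable K L] (D : Derivation k L L)
    (hD : D (algebraMap k[X] L X) = 1) (g : L ≃ₐ[K] L) (x : L) : D (g x) = g (D x) := by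
  have hk : ∀ (h : L ≃ₐ[K] L) (a : k), h (algebraMap k L a) = algebraMap k L a := fun h a => by
    rw [IsScalarTower.algebraMap_apply k K L, h.commutes]
  have hX : ∀ (h : L ≃ₐ[K] L) (P : k[X]), h (algebraMap k[X] L P) = algebraMap k[X] L P :=
    fun h P => by rw [IsScalarTower.algebraMap_apply k[X] K L, h.commutes]
  let D' : Derivation k L L :=
    { toFun := fun x => g.symm (D (g x))
      map_add' := fun x y => by simp only [map_add]
      map_smul' := fun a x => by
        simp only [Algebra.smul_def, map_mul, hk, Derivation.leibniz, smul_eq_mul,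
          RingHom.id_apply, Derivation.map_algebraMap, mul_zero, add_zero, Algebra.algebraMap_self_apply]
      map_one_eq_zero' := by simp
      leibniz' := fun x y => by
        simp only [LinearMap.coe_mk, AddHom.coe_mk, map_mul, Derivation.leibniz, smul_eq_mul,
          map_add, AlgEquiv.symm_apply_apply] }
  have h := deriv_unique k K L D' D (by
    change g.symm (D (g _)) = _
    rw [hX, hD, map_one]) x
  have h2 : g.symm (D (g x)) = D x := h
  rw [← h2, AlgEquiv.apply_symm_apply]

end deriv

section basic
variable {k K L : Type*} [Field k] [Field K] [Field L] [Algebra k[X] K] [IsFractionRing k[X] K]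
  [Algebra K L] [Algebra k[X] L] [IsScalarTower k[X] K L] [Algebra k L] [IsScalarTower k k[X] L]

lemma algebraMap_eq_aeval (P : k[X]) : algebraMap k[X] L P = aeval (algebraMap k[X] L X) P := by
  rw [aeval_algebraMap_apply, aeval_X_left_apply]

variable (K) in
include K in
lemma algebraMap_inj : Function.Injective (algebraMap k[X] L) := by
  rw [IsScalarTower.algebraMap_eq k[X] K L]
  exact (algebraMap K L).injective.comp (IsFractionRing.injective k[X] K)

variable (K) in
include K in
lemma transc_T : Transcendental k (algebraMap k[X] L X) := by
  rw [transcendental_iff_injective]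
  intro P Q h
  rw [← algebraMap_eq_aeval, ← algebraMap_eq_aeval] at h
  exact algebraMap_inj K h

variable (K) in
lemma fixed_integral [FiniteDimensional K L] [IsGalois K L] {h : L} (hi : IsIntegral k[X] h)
    (hfix : ∀ g : L ≃ₐ[K] L, g h = h) : ∃ P : k[X], algebraMap k[X] L P = h := by
  obtain ⟨y, hy⟩ := IsGalois.mem_range_algebraMap_iff_fixed (F := K) (E := L) h |>.2 hfix
  subst hy
  have : IsIntegral k[X] y := by
    rwa [isIntegral_algebraMap_iff (algebraMap K L).injective] at hi
  obtain ⟨P, hP⟩ := IsIntegrallyClosed.isIntegral_iff.1 this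
  exact ⟨P, by rw [IsScalarTower.algebraMap_apply k[X] K L, hP]⟩

lemma exists_val {y : L} (hy : Transcendental k y) (y0 : k) :
    ∃ 𝒱 : ValuationSubring L, (∀ a : k, algebraMap k L a ∈ 𝒱) ∧
      𝒱.valuation (y - algebraMap k L y0) < 1 := by
  let A : Subring L := (aeval (R := k) y).range.toSubring
  have hmem : ∀ P : k[X], aeval y P ∈ A := fun P => ⟨P, rfl⟩
  let z : A := ⟨aeval y (X - C y0), hmem _⟩
  have hz : (z : L) = y - algebraMap k L y0 := by simp [z]
  have hI : Ideal.span {z} ≠ ⊤ := by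
    intro h
    rw [Ideal.span_singleton_eq_top] at h
    obtain ⟨⟨w, P, hP⟩, hw⟩ := h.exists_right_inv
    have h1 : aeval y ((X - C y0) * P) = aeval y (1 : k[X]) := by
      have := congrArg (Subtype.val) hw
      rw [map_mul, map_one]
      have hP' : aeval y P = w := hP
      rw [hP']
      exact this
    have h2 := (transcendental_iff_injective.1 hy) h1
    have h3 : IsUnit (X - C y0 : k[X]) := IsUnit.of_mul_eq_one _ h2
    have h4 := natDegree_eq_zero_of_isUnit h3
    rw [natDegree_X_sub_C] at h4
    exact one_ne_zero h4
  obtain ⟨𝒱, h1, h2⟩ := Ideal.image_subset_nonunits_valuationSubring _ hI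
  refine ⟨𝒱, fun a => h1 ⟨C a, by simp⟩, ?_⟩
  rw [← hz]
  rw [← ValuationSubring.mem_nonunits_iff]
  exact h2 ⟨z, Ideal.subset_span rfl, rfl⟩

lemma mem_val_aeval {𝒱 : ValuationSubring L} (hk : ∀ a : k, algebraMap k L a ∈ 𝒱) {x : L}
    (hx : x ∈ 𝒱) (P : k[X]) : aeval x P ∈ 𝒱 := by
  rw [aeval_eq_sum_range]
  refine sum_mem fun i _ => ?_
  rw [Algebra.smul_def]
  exact mul_mem (hk _) (pow_mem hx _)

lemma mem_val_integral {𝒱 : ValuationSubring L} (hk : ∀ a : k, algebraMap k L a ∈ 𝒱)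
    (hT : algebraMap k[X] L X ∈ 𝒱) {h : L} (hi : IsIntegral k[X] h) : h ∈ 𝒱 := by
  let φ : k[X] →+* 𝒱 := (algebraMap k[X] L).codRestrict 𝒱.toSubring fun P => by
    rw [algebraMap_eq_aeval]; exact mem_val_aeval hk hT P
  have h1 : IsIntegral 𝒱 h := by
    obtain ⟨P, hP, hP0⟩ := hi
    refine ⟨P.map φ, hP.map φ, ?_⟩
    rw [eval₂_map]
    exact hP0
  obtain ⟨y, rfl⟩ := IsIntegrallyClosed.isIntegral_iff.1 h1
  exact y.2

variable {Γ₀ : Type*} [LinearOrderedCommGroupWithZero Γ₀]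

lemma val_const {v : Valuation L Γ₀} (hk : ∀ a : k, v (algebraMap k L a) ≤ 1) {a : k}
    (ha : a ≠ 0) : v (algebraMap k L a) = 1 := by
  refine le_antisymm (hk a) ?_
  by_contra hlt
  push Not at hlt
  have h1 := hk a⁻¹
  have h2 : v (algebraMap k L a) * v (algebraMap k L a⁻¹) = 1 := by
    rw [← map_mul, ← map_mul, mul_inv_cancel₀ ha, map_one, map_one]
  have h3 : v (algebraMap k L a) * v (algebraMap k L a⁻¹) < 1 := by
    calc _ ≤ v (algebraMap k L a) * 1 := by gcongr
      _ < 1 := by rwa [mul_one]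
  exact absurd h2 h3.ne

lemma val_aeval_le {v : Valuation L Γ₀} (hk : ∀ a : k, v (algebraMap k L a) ≤ 1) {x : L}
    (hx : 1 ≤ v x) (P : k[X]) {n : ℕ} (hn : P.natDegree ≤ n) : v (aeval x P) ≤ v x ^ n := by
  rw [aeval_eq_sum_range]
  refine Valuation.map_sum_le _ fun i hi => ?_
  rw [Algebra.smul_def, map_mul, map_pow]
  calc _ ≤ 1 * v x ^ i := by gcongr; exact hk _
    _ ≤ v x ^ n := by
      rw [one_mul]; exact pow_le_pow_right₀ hx (by simp at hi; omega)

lemma val_aeval_eq {v : Valuation L Γ₀} (hk : ∀ a : k, v (algebraMap k L a) ≤ 1) {x : L}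
    (hx : 1 < v x) {P : k[X]} (hP : P ≠ 0) : v (aeval x P) = v x ^ P.natDegree := by
  have hl : v (aeval x (C P.leadingCoeff * X ^ P.natDegree)) = v x ^ P.natDegree := by
    rw [map_mul, aeval_C, map_pow, aeval_X, map_mul, map_pow,
      val_const hk (leadingCoeff_ne_zero.2 hP), one_mul]
  rw [← eraseLead_add_C_mul_X_pow P, map_add, eraseLead_add_C_mul_X_pow P]
  rw [← hl]
  apply Valuation.map_add_eq_of_lt_right
  rw [hl]
  rcases Nat.eq_zero_or_pos P.natDegree with h0 | h0
  · have : P.eraseLead = 0 := by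
      rw [eq_C_of_natDegree_eq_zero h0]; exact eraseLead_C _
    rw [this, map_zero, map_zero, h0, pow_zero]; exact zero_lt_one
  · calc _ ≤ v x ^ (P.natDegree - 1) := val_aeval_le hk hx.le _ (eraseLead_natDegree_le P)
      _ < v x ^ P.natDegree := pow_lt_pow_right₀ hx (by omega)

variable (K) in
variable (k L) in
include K in
/-- a valuation at infinity -/
lemma exists_val_infty : ∃ 𝒱 : ValuationSubring L,
    (∀ a : k, 𝒱.valuation (algebraMap k L a) ≤ 1) ∧ 1 < 𝒱.valuation (algebraMap k[X] L X) := by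
  have hT := transc_T (k := k) K (L := L)
  have hy : Transcendental k (algebraMap k[X] L X)⁻¹ := fun h => hT (by simpa using h.inv)
  obtain ⟨𝒱, h1, h2⟩ := exists_val hy 0
  refine ⟨𝒱, fun a => (𝒱.valuation_le_one_iff _).2 (h1 a), ?_⟩
  rw [map_zero, sub_zero, map_inv₀] at h2
  have hne : 𝒱.valuation (algebraMap k[X] L X) ≠ 0 := by
    rw [Valuation.ne_zero_iff]
    intro h0
    rw [h0] at hT
    exact hT isAlgebraic_zero
  exact (inv_lt_one₀ (zero_lt_iff.2 hne)).1 h2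

end basic
end PC

namespace PC

section wt
variable (k : Type*) {L : Type*} [Field k] [Field L] [Algebra k[X] L] [Algebra k L]
  [IsScalarTower k k[X] L]

/-- weight filtration -/
inductive Wt (V : Set L) (e : ℕ) : ℕ → L → Prop
  | const (a : k) : Wt V e 0 (algebraMap k L a)
  | T : Wt V e 1 (algebraMap k[X] L X)
  | root {x : L} (hx : x ∈ V) : Wt V e e x
  | add {m : ℕ} {x y : L} : Wt V e m x → Wt V e m y → Wt V e m (x + y)
  | mul {m n : ℕ} {x y : L} : Wt V e m x → Wt V e n y → Wt V e (m + n) (x * y)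
  | mono {m n : ℕ} {x : L} : m ≤ n → Wt V e m x → Wt V e n x

variable {k} {V : Set L} {e : ℕ}

lemma Wt.one : Wt k V e 0 (1 : L) := by simpa using Wt.const (k := k) (V := V) (e := e) 1
lemma Wt.zero (m : ℕ) : Wt k V e m (0 : L) := by
  simpa using (Wt.const (k := k) (V := V) (e := e) 0).mono (Nat.zero_le m)

lemma Wt.smul (a : k) {m : ℕ} {x : L} (hx : Wt k V e m x) : Wt k V e m (a • x) := by
  rw [Algebra.smul_def]; simpa using (Wt.const a).mul hx

lemma Wt.pow {m : ℕ} {x : L} (hx : Wt k V e m x) (n : ℕ) : Wt k V e (n * m) (x ^ n) := by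
  induction n with
  | zero => simpa using Wt.one
  | succ n ih => rw [pow_succ]; exact (ih.mul hx).mono (by ring_nf; exact le_rfl)

lemma Wt.sum {ι : Type*} (s : Finset ι) {x : ι → L} {m : ℕ} (hx : ∀ i ∈ s, Wt k V e m (x i)) :
    Wt k V e m (∑ i ∈ s, x i) := by
  classical
  induction s using Finset.induction_on with
  | empty => simpa using Wt.zero m
  | insert a s ha ih =>
    rw [Finset.sum_insert ha]
    exact (hx _ (Finset.mem_insert_self _ _)).add
      (ih fun i hi => hx i (Finset.mem_insert_of_mem hi))

lemma Wt.multiset_prod (s : Multiset L) {m : ℕ} (hx : ∀ x ∈ s, Wt k V e m x) :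
    Wt k V e (s.card * m) s.prod := by
  induction s using Multiset.induction_on with
  | empty => simpa using Wt.one
  | cons a s ih =>
    rw [Multiset.prod_cons, Multiset.card_cons]
    exact ((hx _ (Multiset.mem_cons_self _ _)).mul
      (ih fun x hx' => hx x (Multiset.mem_cons_of_mem hx'))).mono (by ring_nf; exact le_rfl)

lemma Wt.prod {ι : Type*} (s : Finset ι) {x : ι → L} {m : ℕ} (hx : ∀ i ∈ s, Wt k V e m (x i)) :
    Wt k V e (s.card * m) (∏ i ∈ s, x i) := by
  have := Wt.multiset_prod (k := k) (V := V) (e := e) (m := m) (s.val.map x) (by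
    intro y hy
    obtain ⟨i, hi, rfl⟩ := Multiset.mem_map.1 hy
    exact hx i hi)
  simpa using this

lemma Wt.aeval {m : ℕ} {x : L} (hx : Wt k V e m x) (P : k[X]) {n : ℕ} (hn : P.natDegree ≤ n) :
    Wt k V e (n * m) (aeval x P) := by
  rw [aeval_eq_sum_range]
  refine Wt.sum _ fun i hi => Wt.smul _ ?_
  refine (hx.pow i).mono (Nat.mul_le_mul_right _ ?_)
  simp at hi; omega

lemma Wt.poly (P : k[X]) {n : ℕ} (hn : P.natDegree ≤ n) : Wt k V e n (algebraMap k[X] L P) := by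
  rw [algebraMap_eq_aeval]; simpa using Wt.T.aeval P hn

lemma Wt.map {θ : L →+* L} {σ : k → k}
    (hk : ∀ a, θ (algebraMap k L a) = algebraMap k L (σ a))
    (hT : θ (algebraMap k[X] L X) = algebraMap k[X] L X) (hV : ∀ x ∈ V, θ x ∈ V) {m : ℕ} {x : L}
    (hx : Wt k V e m x) : Wt k V e m (θ x) := by
  induction hx with
  | const a => rw [hk]; exact Wt.const _
  | T => rw [hT]; exact Wt.T
  | root h => exact Wt.root (hV _ h)
  | add _ _ ih1 ih2 => rw [map_add]; exact ih1.add ih2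
  | mul _ _ ih1 ih2 => rw [map_mul]; exact ih1.mul ih2
  | mono h _ ih => exact ih.mono h

lemma Wt.val {Γ₀ : Type*} [LinearOrderedCommGroupWithZero Γ₀] {v : Valuation L Γ₀}
    (hk : ∀ a : k, v (algebraMap k L a) ≤ 1) (hT : 1 ≤ v (algebraMap k[X] L X))
    (hV : ∀ x ∈ V, v x ≤ v (algebraMap k[X] L X) ^ e) {m : ℕ} {x : L}
    (hx : Wt k V e m x) : v x ≤ v (algebraMap k[X] L X) ^ m := by
  induction hx with
  | const a => simpa using hk a
  | T => simp
  | root h => exact hV _ h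
  | add _ _ ih1 ih2 => exact Valuation.map_add_le _ ih1 ih2
  | mul _ _ ih1 ih2 => rw [map_mul, pow_add]; exact mul_le_mul' ih1 ih2
  | mono h _ ih => exact ih.trans (pow_le_pow_right₀ hT h)

lemma Wt.integral (hV : ∀ x ∈ V, IsIntegral k[X] x) {m : ℕ} {x : L}
    (hx : Wt k V e m x) : IsIntegral k[X] x := by
  induction hx with
  | const a => rw [IsScalarTower.algebraMap_apply k k[X] L]; exact isIntegral_algebraMap
  | T => exact isIntegral_algebraMap
  | root h => exact hV _ h
  | add _ _ ih1 ih2 => exact ih1.add ih2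
  | mul _ _ ih1 ih2 => exact ih1.mul ih2
  | mono h _ ih => exact ih

lemma Wt.deriv {D : Derivation k L L} {C1 : ℕ} (u : L)
    (hT : Wt k V e C1 (u * D (algebraMap k[X] L X)))
    (hV : ∀ x ∈ V, Wt k V e (e + C1) (u * D x)) {m : ℕ} {x : L}
    (hx : Wt k V e m x) : Wt k V e (m + C1) (u * D x) := by
  induction hx with
  | const a => rw [Derivation.map_algebraMap, mul_zero]; exact Wt.zero _
  | T => exact hT.mono (by omega)
  | root h => exact hV _ h
  | add _ _ ih1 ih2 => rw [map_add, mul_add]; exact ih1.add ih2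
  | @mul m n x y h1 h2 ih1 ih2 =>
    rw [Derivation.leibniz, mul_add, smul_eq_mul, smul_eq_mul]
    have e1 : u * (x * D y) = x * (u * D y) := by ring
    have e2 : u * (y * D x) = y * (u * D x) := by ring
    rw [e1, e2]
    exact ((h1.mul ih2).mono (by omega)).add ((h2.mul ih1).mono (by omega))
  | mono h _ ih => exact ih.mono (by omega)

variable (k V e) in
/-- the ring of all elements having a weight -/
def BB : Subalgebra k[X] L where
  carrier := {x | ∃ m, Wt k V e m x}
  mul_mem' := by rintro x y ⟨m, hx⟩ ⟨n, hy⟩; exact ⟨_, hx.mul hy⟩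
  add_mem' := by
    rintro x y ⟨m, hx⟩ ⟨n, hy⟩
    exact ⟨m + n, (hx.mono (by omega)).add (hy.mono (by omega))⟩
  algebraMap_mem' := fun P => ⟨_, Wt.poly P le_rfl⟩

variable (k V e) in
/-- the weight filtration on `BB` -/
def WW (m : ℕ) : Submodule k (BB k V e) where
  carrier := {x | Wt k V e m (x : L)}
  add_mem' := fun hx hy => hx.add hy
  zero_mem' := Wt.zero m
  smul_mem' := fun a x hx => by
    have : ((a • x : BB k V e) : L) = a • (x : L) := rfl
    simp only [Set.mem_ofPred_eq, this]
    exact Wt.smul a hx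

end wt

lemma pow_finrank_eq {K L : Type*} [Field K] [Field L] [Algebra K L] [FiniteDimensional K L]
    (P : Submodule K L) (h1 : (1 : L) ∈ P) :
    P ^ (Module.finrank K L) = P ^ (Module.finrank K L + 1) := by
  have hle : (1 : Submodule K L) ≤ P := by
    rw [Submodule.one_le]; exact h1
  have hmono : ∀ j, P ^ j ≤ P ^ (j + 1) := fun j => pow_le_pow_right₀ hle (Nat.le_succ j)
  have key : ∀ j, j + 1 ≤ Module.finrank K (P ^ j : Submodule K L) ∨ P ^ j = P ^ (j + 1) := by
    intro j
    induction j with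
    | zero =>
      left
      have : Nontrivial (P ^ 0 : Submodule K L) := by
        rw [pow_zero]
        refine ⟨⟨1, ?_⟩, 0, ?_⟩
        · exact Submodule.one_le.1 le_rfl
        · intro h; have := congrArg Subtype.val h; simp at this
      exact Module.finrank_pos
    | succ j ih =>
      rcases eq_or_ne (P ^ j) (P ^ (j + 1)) with h | h
      · right
        rw [pow_succ, h, ← pow_succ]
      · left
        have h2 := ih.resolve_right h
        have := Submodule.finrank_lt_finrank_of_lt (lt_of_le_of_ne (hmono j) h)
        omega
  rcases key (Module.finrank K L) with h | h
  · have := Submodule.finrank_le (P ^ (Module.finrank K L))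
    omega
  · exact h

open scoped Pointwise in
lemma pow_finrank_top {K L : Type*} [Field K] [Field L] [Algebra K L] [FiniteDimensional K L]
    (V : Set L) (hV : IntermediateField.adjoin K V = ⊤) :
    Submodule.span K ((insert 1 V) ^ (Module.finrank K L)) = ⊤ := by
  rw [← Submodule.span_pow]
  set P := Submodule.span K (insert 1 V) with hP
  have h1 : (1 : L) ∈ P := Submodule.subset_span (Set.mem_insert _ _)
  set n := Module.finrank K L with hn
  have hst : P ^ n = P ^ (n + 1) := pow_finrank_eq P h1
  have hle : (1 : Submodule K L) ≤ P := by rw [Submodule.one_le]; exact h1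
  have hstab : ∀ j, P ^ (n + j) = P ^ n := by
    intro j
    induction j with
    | zero => rfl
    | succ j ih => rw [← add_assoc, pow_succ, ih, ← pow_succ, ← hst]
  have hPn : P ≤ P ^ n := by
    calc P = P ^ 1 := (pow_one P).symm
      _ ≤ P ^ (n + 1) := pow_le_pow_right₀ hle (by omega)
      _ = P ^ n := hst.symm
  let A : Subalgebra K L :=
    { carrier := (P ^ n : Submodule K L)
      mul_mem' := fun {a b} ha hb => by
        have : a * b ∈ P ^ n * P ^ n := Submodule.mul_mem_mul ha hb
        rw [← pow_add, hstab] at this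
        exact this
      add_mem' := fun ha hb => Submodule.add_mem _ ha hb
      algebraMap_mem' := fun r => by
        rw [Algebra.algebraMap_eq_smul_one]
        exact Submodule.smul_mem _ _ (hPn h1) }
  have hA : Algebra.adjoin K V ≤ A := Algebra.adjoin_le fun x hx =>
    hPn (Submodule.subset_span (Set.mem_insert_of_mem _ hx))
  rw [eq_top_iff]
  intro x _
  have hx : x ∈ IntermediateField.adjoin K V := by rw [hV]; trivial
  have hx2 : x ∈ Algebra.adjoin K V := by
    have := IntermediateField.adjoin_toSubalgebra_of_isAlgebraic (F := K) (E := L) (S := V)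
      (fun x _ => Algebra.IsAlgebraic.isAlgebraic x)
    rw [← this]; exact hx
  exact hA hx2

end PC

namespace PC

section su
variable {k : Type*} (L : Type*) [Field k] [Field L] [Algebra k[X] L] [Algebra k L]
  [IsScalarTower k k[X] L]

/-- the set of roots of `A(x) = b(T)` -/
def Vs (A b : k[X]) : Set L := {x | aeval x A = algebraMap k[X] L b}

/-- all roots -/
def VV {ι : Type*} (A b : ι → k[X]) : Set L := {x | ∃ i, x ∈ Vs L (A i) (b i)}

/-- local discriminant like factor -/
noncomputable def pil (A b : k[X]) : k[X] :=
  ((derivative A).roots.map (fun r => b - C (A.eval r))).prod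

/-- the bad locus -/
noncomputable def pig {ι : Type*} [Fintype ι] (A b : ι → k[X]) : k[X] := ∏ i, pil (A i) (b i)

lemma exists_quo (A : k[X]) (r : k) : ∃ Q : k[X], Q.natDegree ≤ A.natDegree ∧
    A - C (A.eval r) = (X - C r) * Q := by
  refine ⟨(A - C (A.eval r)) /ₘ (X - C r), ?_, ?_⟩
  · rw [natDegree_divByMonic _ (monic_X_sub_C r)]
    have := natDegree_sub_C (p := A) (a := A.eval r)
    omega
  · rw [eq_comm, mul_divByMonic_eq_iff_isRoot]
    simp

lemma natDegree_pil_le {A b : k[X]} {n : ℕ} (hA : A.natDegree ≤ n) (hb : b.natDegree ≤ n) :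
    (pil A b).natDegree ≤ n * n := by
  unfold pil
  refine (natDegree_multiset_prod_le _).trans ?_
  rw [Multiset.map_map]
  refine (Multiset.sum_le_card_nsmul _ n ?_).trans ?_
  · intro x hx
    obtain ⟨r, hr, rfl⟩ := Multiset.mem_map.1 hx
    simp only [Function.comp]
    rw [natDegree_sub_C]; exact hb
  · rw [Multiset.card_map, smul_eq_mul]
    refine Nat.mul_le_mul_right _ ((card_roots' _).trans ((natDegree_derivative_le _).trans ?_))
    omega

lemma pil_ne {A b : k[X]} (hb : 0 < b.natDegree) : pil A b ≠ 0 := by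
  unfold pil
  rw [Ne, Multiset.prod_eq_zero_iff]
  intro h
  obtain ⟨r, hr, h0⟩ := Multiset.mem_map.1 h
  have := congrArg natDegree h0
  rw [natDegree_sub_C, natDegree_zero] at this
  omega

/-- the assumptions on the covers -/
structure Setup (k K L : Type*) [Field k] [Field K] [Field L] [Algebra k[X] K]
    [Algebra K L] [Algebra k[X] L] [Algebra k L]
    {ι : Type*} [Fintype ι] (A b : ι → k[X]) (n : ℕ) : Prop where
  monic : ∀ i, (A i).Monic
  degA_pos : ∀ i, 0 < (A i).natDegree
  degA : ∀ i, (A i).natDegree ≤ n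
  degb_pos : ∀ i, 0 < (b i).natDegree
  degb : ∀ i, (b i).natDegree ≤ n
  der : ∀ i, derivative (A i) ≠ 0
  splits : ∀ i, ((A i).map (algebraMap k L) - C (algebraMap k[X] L (b i))).Splits
  gen : IntermediateField.adjoin K (VV L A b) = ⊤

variable {L}

lemma Vs_integral {A b : k[X]} (hA : A.Monic) {x : L} (hx : x ∈ Vs L A b) (hd : 0 < A.natDegree) :
    IsIntegral k[X] x := by
  refine ⟨A.map C - C b, ?_, ?_⟩
  · apply Monic.sub_of_left (hA.map _)
    calc (C b : k[X][X]).degree ≤ 0 := degree_C_le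
      _ < (A.map C).degree := by
        rw [degree_map_eq_of_injective C_injective]
        exact natDegree_pos_iff_degree_pos.1 hd
  · rw [eval₂_sub, eval₂_C, eval₂_map]
    have : (algebraMap k[X] L).comp C = algebraMap k L := by
      ext a; rw [IsScalarTower.algebraMap_apply k k[X] L]; rfl
    rw [this]
    have hx' : eval₂ (algebraMap k L) x A = _ := hx
    rw [hx', sub_self]

lemma aeval_ne_of_Vs {A b : k[X]} {x : L} (hx : x ∈ Vs L A b) (hb : 0 < b.natDegree)
    (hinj : Function.Injective (algebraMap k[X] L)) (r : k) : x ≠ algebraMap k L r := by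
  rintro rfl
  have hx' : aeval (algebraMap k L r) A = algebraMap k[X] L b := hx
  rw [aeval_algebraMap_apply, coe_aeval_eq_eval, IsScalarTower.algebraMap_apply k k[X] L] at hx'
  have := hinj hx'
  rw [← this] at hb
  simp at hb

/-- elements of `Vs` are transcendental hence `P(x) ≠ 0` -/
lemma aeval_ne [IsAlgClosed k] {A b : k[X]} {x : L} (hx : x ∈ Vs L A b) (hb : 0 < b.natDegree)
    (hinj : Function.Injective (algebraMap k[X] L)) {P : k[X]} (hP : P ≠ 0) : aeval x P ≠ 0 := by
  rw [(IsAlgClosed.splits P).eq_prod_roots, map_mul, aeval_C, map_multiset_prod, Multiset.map_map]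
  refine mul_ne_zero ?_ ?_
  · rw [Ne, FaithfulSMul.algebraMap_eq_zero_iff]; exact leadingCoeff_ne_zero.2 hP
  · rw [Ne, Multiset.prod_eq_zero_iff]
    intro h
    obtain ⟨r, hr, h0⟩ := Multiset.mem_map.1 h
    simp only [Function.comp, map_sub, aeval_X, aeval_C] at h0
    exact aeval_ne_of_Vs hx hb hinj r (sub_eq_zero.1 h0)

lemma pil_eq [IsAlgClosed k] {A b : k[X]} (hA : derivative A ≠ 0) : ∃ Q : k[X],
    Q.natDegree ≤ A.natDegree * A.natDegree ∧
    ∀ x ∈ Vs L A b, algebraMap k[X] L (pil A b) = aeval x (derivative A) * aeval x Q := by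
  choose Q hQ1 hQ2 using exists_quo A
  refine ⟨C (derivative A).leadingCoeff⁻¹ * ((derivative A).roots.map Q).prod, ?_, ?_⟩
  · refine (natDegree_C_mul_le _ _).trans ((natDegree_multiset_prod_le _).trans ?_)
    rw [Multiset.map_map]
    refine (Multiset.sum_le_card_nsmul _ A.natDegree ?_).trans ?_
    · intro x hx
      obtain ⟨r, hr, rfl⟩ := Multiset.mem_map.1 hx
      exact hQ1 r
    · rw [Multiset.card_map, smul_eq_mul]
      refine Nat.mul_le_mul_right _ ((card_roots' _).trans ((natDegree_derivative_le _).trans ?_))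
      omega
  · intro x hx
    have hx' : aeval x A = algebraMap k[X] L b := hx
    have e : C (derivative A).leadingCoeff * ((derivative A).roots.map (X - C ·)).prod *
        (C (derivative A).leadingCoeff⁻¹ * ((derivative A).roots.map Q).prod)
        = ((derivative A).roots.map (fun r => A - C (A.eval r))).prod := by
      simp_rw [hQ2]
      rw [Multiset.prod_map_mul]
      have : (C (derivative A).leadingCoeff : k[X]) * C (derivative A).leadingCoeff⁻¹ = 1 := by
        rw [← C_mul, mul_inv_cancel₀ (leadingCoeff_ne_zero.2 hA), C_1]
      linear_combination ((derivative A).roots.map (X - C ·)).prod *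
        ((derivative A).roots.map Q).prod * this
    rw [← (IsAlgClosed.splits (derivative A)).eq_prod_roots] at e
    rw [← map_mul, e]
    unfold pil
    rw [map_multiset_prod, map_multiset_prod, Multiset.map_map, Multiset.map_map]
    congr 1
    refine Multiset.map_congr rfl fun r hr => ?_
    simp only [Function.comp, map_sub, hx', aeval_C]
    congr 1
    rw [IsScalarTower.algebraMap_apply k k[X] L]; rfl

end su

section su2
variable {k K L : Type*} [Field k] [IsAlgClosed k] [Field K] [Field L] [Algebra k[X] K]
  [IsFractionRing k[X] K]
  [Algebra K L] [Algebra k[X] L] [IsScalarTower k[X] K L] [Algebra k L] [IsScalarTower k k[X] L]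
  [Algebra k K] [IsScalarTower k k[X] K] [IsScalarTower k K L]
  [FiniteDimensional K L] [IsGalois K L]
  {ι : Type*} [Fintype ι] {A b : ι → k[X]} {n : ℕ}

lemma Setup.VV_map (hs : Setup k K L A b n) (g : L ≃ₐ[K] L) {x : L} {i : ι}
    (hx : x ∈ Vs L (A i) (b i)) : g x ∈ Vs L (A i) (b i) := by
  have hx' : aeval x (A i) = algebraMap k[X] L (b i) := hx
  change aeval (g x) (A i) = _
  have : aeval (g x) (A i) = g (aeval x (A i)) := by
    have := aeval_algHom_apply (g.toAlgHom.restrictScalars k) x (A i)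
    exact this
  rw [this, hx', IsScalarTower.algebraMap_apply k[X] K L, g.commutes]

lemma Setup.integral (hs : Setup k K L A b n) {m : ℕ} {x : L} (hx : Wt k (VV L A b) n m x) :
    IsIntegral k[X] x :=
  hx.integral (by rintro x ⟨i, hi⟩; exact Vs_integral (hs.monic i) hi (hs.degA_pos i))

lemma Setup.val_le (hs : Setup k K L A b n) {𝒱 : ValuationSubring L}
    (hk : ∀ a : k, 𝒱.valuation (algebraMap k L a) ≤ 1)
    (hT : 1 < 𝒱.valuation (algebraMap k[X] L X)) {x : L} (hx : x ∈ VV L A b) :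
    𝒱.valuation x ≤ 𝒱.valuation (algebraMap k[X] L X) ^ n := by
  obtain ⟨i, hi⟩ := hx
  rcases le_or_gt (𝒱.valuation x) 1 with h | h
  · exact h.trans (one_le_pow₀ hT.le)
  · have h1 := val_aeval_eq hk h (hs.monic i).ne_zero
    have hi' : aeval x (A i) = algebraMap k[X] L (b i) := hi
    have hb : b i ≠ 0 := by
      intro h0; have := hs.degb_pos i; rw [h0] at this; simp at this
    rw [hi', algebraMap_eq_aeval, val_aeval_eq hk hT hb] at h1
    calc 𝒱.valuation x = 𝒱.valuation x ^ 1 := (pow_one _).symm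
      _ ≤ 𝒱.valuation x ^ (A i).natDegree := pow_le_pow_right₀ h.le (hs.degA_pos i)
      _ = _ := h1.symm
      _ ≤ _ := pow_le_pow_right₀ hT.le (hs.degb i)

include K in
lemma Setup.deriv_wt (hs : Setup k K L A b n) {D : Derivation k L L}
    (hD : D (algebraMap k[X] L X) = 1) {m : ℕ} {x : L} (hx : Wt k (VV L A b) n m x) :
    Wt k (VV L A b) n (m + (n * n * n + n + Fintype.card ι * (n * n)))
      (algebraMap k[X] L (pig A b) * D x) := by
  classical
  have hpig : Wt k (VV L A b) n (Fintype.card ι * (n * n)) (algebraMap k[X] L (pig A b)) := by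
    refine Wt.poly _ ?_
    unfold pig
    refine (natDegree_prod_le _ _).trans ?_
    refine (Finset.sum_le_card_nsmul _ _ (n * n)
      (fun i _ => natDegree_pil_le (hs.degA i) (hs.degb i))).trans ?_
    simp
  refine Wt.deriv _ ?_ ?_ hx
  · rw [hD, mul_one]
    exact hpig.mono (by omega)
  · rintro x ⟨i, hi⟩
    obtain ⟨Q, hQ1, hQ2⟩ := pil_eq (L := L) (b := b i) (hs.der i)
    have hQ2 := hQ2 x hi
    have hi' : aeval x (A i) = algebraMap k[X] L (b i) := hi
    have hd := congrArg D hi'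
    rw [algebraMap_eq_aeval, Derivation.map_aeval, Derivation.map_aeval, hD, smul_eq_mul,
      smul_eq_mul, mul_one] at hd
    have e : algebraMap k[X] L (pig A b) * D x = aeval x Q *
        aeval (algebraMap k[X] L X) (derivative (b i)) *
        algebraMap k[X] L (∏ j ∈ Finset.univ.erase i, pil (A j) (b j)) := by
      unfold pig
      rw [← Finset.mul_prod_erase _ _ (Finset.mem_univ i), map_mul, hQ2]
      linear_combination (aeval x Q *
        algebraMap k[X] L (∏ j ∈ Finset.univ.erase i, pil (A j) (b j))) * hd
    rw [e]
    have w1 : Wt k (VV L A b) n (n * n * n) (aeval x Q) :=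
      (Wt.root (k := k) (show x ∈ VV L A b from ⟨i, hi⟩)).aeval Q
        (hQ1.trans (Nat.mul_le_mul (hs.degA i) (hs.degA i)))
    have w2 : Wt k (VV L A b) n n (aeval (algebraMap k[X] L X) (derivative (b i))) := by
      rw [← algebraMap_eq_aeval]
      exact Wt.poly _ ((natDegree_derivative_le _).trans (by have := hs.degb i; omega))
    have w3 : Wt k (VV L A b) n (Fintype.card ι * (n * n))
        (algebraMap k[X] L (∏ j ∈ Finset.univ.erase i, pil (A j) (b j))) := by
      refine Wt.poly _ ((natDegree_prod_le _ _).trans ?_)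
      refine (Finset.sum_le_card_nsmul _ _ (n * n)
        (fun i _ => natDegree_pil_le (hs.degA i) (hs.degb i))).trans ?_
      rw [smul_eq_mul]
      exact Nat.mul_le_mul_right _ (Finset.card_le_univ _)
    exact ((w1.mul w2).mul w3).mono (by omega)

end su2
end PC

namespace PC

lemma exists_point {k B : Type*} [Field k] [IsAlgClosed k] [CommRing B] [Algebra k B]
    [Algebra k[X] B] [IsScalarTower k k[X] B] (hIntg : ∀ x : B, IsIntegral k[X] x)
    (hinj : Function.Injective (algebraMap k[X] B)) (t0 : k) :
    ∃ ψ : B →ₐ[k] k, ψ (algebraMap k[X] B X) = t0 := by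
  haveI : Algebra.IsIntegral k[X] B := ⟨hIntg⟩
  have hmax : (Ideal.span {X - C t0} : Ideal k[X]).IsMaximal :=
    PrincipalIdealRing.isMaximal_of_irreducible (irreducible_X_sub_C t0)
  obtain ⟨Q, hQ, hQP⟩ := Ideal.exists_ideal_over_maximal_of_isIntegral (S := B)
    (Ideal.span {X - C t0}) (by
      rw [(RingHom.injective_iff_ker_eq_bot _).1 hinj]; exact bot_le)
  letI := Ideal.Quotient.field Q
  have hX : Ideal.Quotient.mk Q (algebraMap k[X] B X) = algebraMap k (B ⧸ Q) t0 := by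
    have h1 : (X - C t0 : k[X]) ∈ Q.comap (algebraMap k[X] B) := by
      rw [hQP]; exact Ideal.mem_span_singleton_self _
    rw [Ideal.mem_comap, map_sub] at h1
    have h2 := (Ideal.Quotient.mk_eq_mk_iff_sub_mem _ _).2 h1
    rw [h2, ← algebraMap_eq, ← IsScalarTower.algebraMap_apply k k[X] B]
    rfl
  have hcomp : (algebraMap k (B ⧸ Q)).comp (evalRingHom t0) =
      (Ideal.Quotient.mk Q).comp (algebraMap k[X] B) := by
    ext a
    · simp only [RingHom.comp_apply, coe_evalRingHom, eval_C]
      rw [← algebraMap_eq, ← IsScalarTower.algebraMap_apply k k[X] B]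
      rfl
    · simp only [RingHom.comp_apply, coe_evalRingHom, eval_X]
      exact hX.symm
  haveI : Algebra.IsIntegral k (B ⧸ Q) := ⟨fun y => by
    obtain ⟨x, rfl⟩ := Ideal.Quotient.mk_surjective y
    obtain ⟨p, hp, hp0⟩ := hIntg x
    refine ⟨p.map (evalRingHom t0), hp.map _, ?_⟩
    rw [eval₂_map, hcomp, ← hom_eval₂, hp0, map_zero]⟩
  have hb := IsAlgClosed.algebraMap_bijective_of_isIntegral (k := k) (K := B ⧸ Q)
  let E := AlgEquiv.ofBijective (Algebra.ofId k (B ⧸ Q)) hb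
  refine ⟨E.symm.toAlgHom.comp (Ideal.Quotient.mkₐ k Q), ?_⟩
  change E.symm (Ideal.Quotient.mk Q (algebraMap k[X] B X)) = t0
  rw [hX, AlgEquiv.symm_apply_eq]
  rfl

section su2
variable {k K L : Type*} [Field k] [IsAlgClosed k] [Field K] [Field L] [Algebra k[X] K]
  [IsFractionRing k[X] K]
  [Algebra K L] [Algebra k[X] L] [IsScalarTower k[X] K L] [Algebra k L] [IsScalarTower k k[X] L]
  [Algebra k K] [IsScalarTower k k[X] K] [IsScalarTower k K L]
  [FiniteDimensional K L] [IsGalois K L]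
  {ι : Type*} [Fintype ι] {A b : ι → k[X]} {n : ℕ}

lemma gal_k (g : L ≃ₐ[K] L) (a : k) : g (algebraMap k L a) = algebraMap k L a := by
  rw [IsScalarTower.algebraMap_apply k K L, g.commutes]

lemma gal_poly (g : L ≃ₐ[K] L) (P : k[X]) : g (algebraMap k[X] L P) = algebraMap k[X] L P := by
  rw [IsScalarTower.algebraMap_apply k[X] K L, g.commutes]

lemma Setup.wt_map (hs : Setup k K L A b n) (g : L ≃ₐ[K] L) {m : ℕ} {x : L}
    (hx : Wt k (VV L A b) n m x) : Wt k (VV L A b) n m (g x) :=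
  Wt.map (θ := (g : L →+* L)) (σ := id) (fun a => gal_k g a) (gal_poly g X)
    (by rintro x ⟨i, hi⟩; exact ⟨i, hs.VV_map g hi⟩) hx

/-- action of the Galois group on `BB` -/
@[reducible] def Setup.act (hs : Setup k K L A b n) :
    MulSemiringAction (L ≃ₐ[K] L) (BB k (VV L A b) n) where
  smul g x := ⟨g x, by obtain ⟨m, hm⟩ := x.2; exact ⟨m, hs.wt_map g hm⟩⟩
  one_smul x := rfl
  mul_smul g h x := rfl
  smul_zero g := Subtype.ext (map_zero g)
  smul_add g x y := Subtype.ext (map_add g (x : L) y)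
  smul_one g := Subtype.ext (map_one g)
  smul_mul g x y := Subtype.ext (map_mul g (x : L) y)

include K in
/-- the derivation on `BB` -/
noncomputable def Setup.dd (hs : Setup k K L A b n) (D : Derivation k L L)
    (hD : D (algebraMap k[X] L X) = 1) :
    Derivation k (BB k (VV L A b) n) (BB k (VV L A b) n) where
  toFun x := ⟨algebraMap k[X] L (pig A b) * D x, by
    obtain ⟨m, hm⟩ := x.2; exact ⟨_, hs.deriv_wt hD hm⟩⟩
  map_add' x y := Subtype.ext (by
    change _ * D ((x : L) + y) = _ * D x + _ * D y
    rw [map_add, mul_add])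
  map_smul' a x := Subtype.ext (by
    change _ * D (a • (x : L)) = a • (_ * D x)
    rw [Derivation.map_smul, mul_smul_comm])
  map_one_eq_zero' := Subtype.ext (by
    change _ * D (1 : L) = 0
    rw [Derivation.map_one_eq_zero, mul_zero])
  leibniz' x y := Subtype.ext (by
    change _ * D ((x : L) * y) = (x : L) * (_ * D y) + (y : L) * (_ * D x)
    rw [Derivation.leibniz, smul_eq_mul, smul_eq_mul]; ring)

open scoped Pointwise in
lemma Wt.of_pow {V : Set L} {e : ℕ} (j : ℕ) {x : L} (hx : x ∈ (insert 1 V : Set L) ^ j) :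
    Wt k V e (j * e) x := by
  induction j generalizing x with
  | zero => rw [pow_zero] at hx; rw [Set.mem_one.1 hx]; simpa using Wt.one
  | succ j ih =>
    rw [pow_succ] at hx
    obtain ⟨y, hy, z, hz, rfl⟩ := Set.mem_mul.1 hx
    have hz' : Wt k V e e z := by
      rcases hz with rfl | hz
      · exact Wt.one.mono (Nat.zero_le _)
      · exact Wt.root hz
    rw [Nat.succ_mul]
    exact (ih hy).mul hz'

open scoped Pointwise in
/-- a basis with elements of bounded weight -/
lemma Setup.exists_basis (hs : Setup k K L A b n) :
    ∃ e : Module.Basis (L ≃ₐ[K] L) K L, ∀ i, Wt k (VV L A b) n (Module.finrank K L * n) (e i) := by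
  have htop := pow_finrank_top _ hs.gen
  obtain ⟨S, hS1, hS2, hS3⟩ := exists_linearIndependent K
    ((insert 1 (VV L A b) : Set L) ^ (Module.finrank K L))
  let B0 : Module.Basis S K L := Module.Basis.mk hS3 (by
    rw [Subtype.range_coe, hS2, htop])
  haveI : Fintype S := FiniteDimensional.fintypeBasisIndex B0
  have hcard : Fintype.card S = Fintype.card (L ≃ₐ[K] L) := by
    rw [← Module.finrank_eq_card_basis B0, ← Nat.card_eq_fintype_card,
      IsGalois.card_aut_eq_finrank]
  let E := Fintype.equivOfCardEq hcard
  refine ⟨B0.reindex E, fun i => ?_⟩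
  rw [Module.Basis.reindex_apply]
  simp only [B0, Module.Basis.mk_apply]
  exact Wt.of_pow _ (hS1 (E.symm i).2)

theorem Setup.sd (hs : Setup k K L A b n) (D : Derivation k L L)
    (hD : D (algebraMap k[X] L X) = 1) (C0 : ℕ) (hC0 : Module.finrank K L * n ≤ C0) :
    letI := hs.act
    ∃ e : (L ≃ₐ[K] L) → BB k (VV L A b) n,
      SD (Γ := L ≃ₐ[K] L) (pig A b) (hs.dd D hD) (WW k (VV L A b) n) e C0
        (n * n * n + n + Fintype.card ι * (n * n)) := by
  letI := hs.act
  obtain ⟨e0, he0⟩ := hs.exists_basis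
  let e : (L ≃ₐ[K] L) → BB k (VV L A b) n := fun i => ⟨e0 i, _, he0 i⟩
  have hdeg : ∀ {m Q}, Wt k (VV L A b) n m (algebraMap k[X] L Q) → natDegree Q ≤ m := by
    intro m Q hQ
    rcases eq_or_ne Q 0 with rfl | hQ0
    · simp
    obtain ⟨𝒱, h1, h2⟩ := exists_val_infty k K L
    have := hQ.val (v := 𝒱.valuation) h1 h2.le (fun x hx => hs.val_le h1 h2 hx)
    rw [algebraMap_eq_aeval, val_aeval_eq h1 h2 hQ0] at this
    exact (pow_le_pow_iff_right₀ h2).1 this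
  have hinj : Function.Injective (algebraMap k[X] (BB k (VV L A b) n)) := by
    intro P Q h
    exact algebraMap_inj K (congrArg Subtype.val h)
  -- the trace embedding
  have htr : ∀ m, ∃ (N : Submodule k L) (φ : WW k (VV L A b) n m →ₗ[k] ((L ≃ₐ[K] L) → N)),
      Function.Injective φ ∧ Module.Finite k N ∧ Module.finrank k N ≤ m + C0 + 1 := by
    intro m
    let al : k[X] →ₗ[k] L := (IsScalarTower.toAlgHom k k[X] L).toLinearMap
    let N := (degreeLT k (m + C0 + 1)).map al
    have hfin : Module.Finite k (degreeLT k (m + C0 + 1)) :=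
      Module.Finite.equiv (degreeLTEquiv k _).symm
    have hmem : ∀ (x : WW k (VV L A b) n m) (i : L ≃ₐ[K] L),
        (∑ g : L ≃ₐ[K] L, g ((x.1 : L) * e0 i)) ∈ N := by
      intro x i
      have hw : Wt k (VV L A b) n (m + C0) (∑ g : L ≃ₐ[K] L, g ((x.1 : L) * e0 i)) := by
        refine Wt.sum _ fun g _ => ?_
        exact hs.wt_map g ((Wt.mul x.2 (he0 i)).mono (by omega))
      obtain ⟨P, hP⟩ := fixed_integral K (hs.integral hw) (by
        intro g
        rw [map_sum]
        exact Fintype.sum_equiv (Equiv.mulLeft g) _ _ (fun _ => rfl))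
      refine ⟨P, ?_, hP⟩
      rw [← hP] at hw
      have := hdeg hw
      rw [SetLike.mem_coe, mem_degreeLT]
      refine lt_of_le_of_lt degree_le_natDegree ?_
      exact_mod_cast (by omega)
    let φ : WW k (VV L A b) n m →ₗ[k] ((L ≃ₐ[K] L) → N) :=
      { toFun := fun x i => ⟨_, hmem x i⟩
        map_add' := fun x y => by
          funext i
          apply Subtype.ext
          change (∑ g : L ≃ₐ[K] L, g (((x.1 : L) + y.1) * e0 i)) =
            (∑ g : L ≃ₐ[K] L, g ((x.1 : L) * e0 i)) + ∑ g : L ≃ₐ[K] L, g ((y.1 : L) * e0 i)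
          rw [← Finset.sum_add_distrib]
          refine Finset.sum_congr rfl fun g _ => ?_
          rw [add_mul, map_add]
        map_smul' := fun a x => by
          funext i
          apply Subtype.ext
          change (∑ g : L ≃ₐ[K] L, g ((a • (x.1 : L)) * e0 i)) =
            a • (∑ g : L ≃ₐ[K] L, g ((x.1 : L) * e0 i))
          rw [Finset.smul_sum]
          refine Finset.sum_congr rfl fun g _ => ?_
          rw [smul_mul_assoc, Algebra.smul_def, Algebra.smul_def, map_mul, gal_k] }
    refine ⟨N, φ, ?_, inferInstance, ?_⟩
    · intro x y hx
      have h0 : ∀ i, Algebra.trace K L (((x.1 : L) - y.1) * e0 i) = 0 := by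
        intro i
        have h1 : (∑ g : L ≃ₐ[K] L, g ((x.1 : L) * e0 i)) = ∑ g : L ≃ₐ[K] L, g ((y.1 : L) * e0 i) :=
          congrArg Subtype.val (congrFun hx i)
        have h1 : (∑ g : L ≃ₐ[K] L, g (((x.1 : L) - y.1) * e0 i)) = 0 := by
          simp only [sub_mul, map_sub, Finset.sum_sub_distrib, h1, sub_self]
        rw [← trace_eq_sum_automorphisms] at h1
        exact (algebraMap K L).injective (by rw [h1, map_zero])
      have h1 : Algebra.traceForm K L ((x.1 : L) - y.1) = 0 := by
        apply e0.ext
        intro i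
        rw [Algebra.traceForm_apply, h0]; rfl
      have h2 : (x.1 : L) - y.1 = 0 := by
        have := (traceForm_nondegenerate K L)
        exact this.1 _ (fun y => by rw [h1]; rfl)
      exact Subtype.ext (Subtype.ext (sub_eq_zero.1 h2))
    · refine (Submodule.finrank_map_le _ _).trans ?_
      rw [(degreeLTEquiv k (m + C0 + 1)).finrank_eq, Module.finrank_fin_fun]
  refine ⟨e, ?_⟩
  refine
    { hDX := Subtype.ext ?_
      inj := hinj
      fix := fun g P => Subtype.ext (gal_poly g P)
      inv := ?_
      comm := fun g h => Subtype.ext ?_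
      mono := fun m m' h x hx => Wt.mono h hx
      one_mem := Wt.one
      X_mem := Wt.T
      mul_mem := fun hx hy => Wt.mul hx hy
      smul_mem := fun g _ _ hx => hs.wt_map g hx
      D_mem := fun hx => hs.deriv_wt hD hx
      deg := fun hQ => hdeg hQ
      e_mem := fun i => Wt.mono hC0 (he0 i)
      lin := ?_
      finrank_le := ?_
      finite := ?_
      pt := ?_
      π_ne := ?_ }
  · change _ * D (algebraMap k[X] L X) = _
    rw [hD, mul_one]; rfl
  · intro h hh
    obtain ⟨m, hm⟩ := h.2
    obtain ⟨P, hP⟩ := fixed_integral K (hs.integral hm) (fun g => congrArg Subtype.val (hh g))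
    exact ⟨P, Subtype.ext hP⟩
  · change _ * D (g (h : L)) = g (_ * D (h : L))
    rw [map_mul, gal_poly, deriv_comm K D hD]
  · have h1 : LinearIndependent k[X] e0 := by
      refine e0.linearIndependent.restrict_scalars ?_
      intro P Q h
      simp only [Algebra.smul_def, mul_one] at h
      exact IsFractionRing.injective k[X] K h
    refine LinearIndependent.of_comp (BB k (VV L A b) n).val.toLinearMap ?_
    exact h1
  · intro m
    obtain ⟨N, φ, h1, h2, h3⟩ := htr m
    refine (LinearMap.finrank_le_finrank_of_injective h1).trans ?_
    rw [Module.finrank_pi_fintype, Finset.sum_const, Finset.card_univ, smul_eq_mul]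
    exact Nat.mul_le_mul_left _ h3
  · intro m
    obtain ⟨N, φ, h1, h2, h3⟩ := htr m
    exact Module.Finite.of_injective φ h1
  · refine exists_point ?_ hinj
    intro x
    obtain ⟨m, hm⟩ := x.2
    have := hs.integral hm
    exact (isIntegral_algHom_iff (BB k (VV L A b) n).val Subtype.val_injective).1 this
  · unfold pig
    exact Finset.prod_ne_zero_iff.2 fun i _ => pil_ne (hs.degb_pos i)

end su2
end PC

namespace PC

/-- numerical condition -/
def StepNum (D0 C0 C1 : ℕ) (δ : ℝ) (P0 : ℕ) : Prop :=
  ∀ G, 0 < G → G ≤ D0 → ∃ b M a : ℕ, M + 1 = G * b ∧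
      a = (M + 1) * (b + 3 * C0 + M * C1 + 1) ∧ ∀ p, P0 ≤ p →
        (G * (a + C0) + 1 ≤ p ∧ G * M ≤ p ∧ ∀ q n : ℕ, p ≤ q →
          M * n ≤ G * (a + C0 + q * (b + C0)) → (n : ℝ) ≤ (1 + δ) * q)

section su2
variable {k K L : Type*} [Field k] [IsAlgClosed k] [Field K] [Field L] [Algebra k[X] K]
  [IsFractionRing k[X] K]
  [Algebra K L] [Algebra k[X] L] [IsScalarTower k[X] K L] [Algebra k L] [IsScalarTower k k[X] L]
  [Algebra k K] [IsScalarTower k k[X] K] [IsScalarTower k K L]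
  [FiniteDimensional K L] [IsGalois K L]
  {ι : Type*} [Fintype ι] {A b : ι → k[X]} {n : ℕ}

lemma mem_BB {i : ι} {x : L} (hx : x ∈ Vs L (A i) (b i)) : x ∈ BB k (VV L A b) n :=
  ⟨n, Wt.root ⟨i, hx⟩⟩

lemma pil_eval_ne {t : k} {i : ι} (h : (pig A b).eval t ≠ 0) : (pil (A i) (b i)).eval t ≠ 0 := by
  unfold pig at h
  rw [eval_prod] at h
  exact Finset.prod_ne_zero_iff.1 h i (Finset.mem_univ i)

lemma der_ne_of_pil {A b : k[X]} {t a : k} (h : (pil A b).eval t ≠ 0) (hA : derivative A ≠ 0)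
    (ha : A.eval a = b.eval t) : (derivative A).eval a ≠ 0 := by
  intro h0
  apply h
  unfold pil
  rw [eval_multiset_prod, Multiset.prod_eq_zero_iff, Multiset.map_map, Multiset.mem_map]
  exact ⟨a, (mem_roots hA).2 h0, by simp [ha]⟩

lemma psi_eval (ψ : BB k (VV L A b) n →ₐ[k] k) {t : k}
    (hψ : ψ (algebraMap k[X] _ X) = t) {i : ι} (x : BB k (VV L A b) n)
    (hx : (x : L) ∈ Vs L (A i) (b i)) : (A i).eval (ψ x) = (b i).eval t := by
  have hx' : aeval (x : L) (A i) = algebraMap k[X] L (b i) := hx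
  have h1 : aeval x (A i) = algebraMap k[X] (BB k (VV L A b) n) (b i) := by
    apply Subtype.ext
    have := aeval_algHom_apply ((BB k (VV L A b) n).val.restrictScalars k) x (A i)
    exact this.symm.trans hx'
  have h2 := congrArg ψ h1
  rw [point_algebraMap, hψ, ← aeval_algHom_apply] at h2
  exact h2

lemma psi_inj (ψ : BB k (VV L A b) n →ₐ[k] k) {t : k}
    (hψ : ψ (algebraMap k[X] _ X) = t) (ht : (pig A b).eval t ≠ 0)
    {i : ι} (hA : derivative (A i) ≠ 0) (x y : BB k (VV L A b) n)
    (hx : (x : L) ∈ Vs L (A i) (b i)) (hy : (y : L) ∈ Vs L (A i) (b i))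
    (hxy : ψ x = ψ y) : x = y := by
  by_contra hne
  have hx' : aeval (x : L) (A i) = algebraMap k[X] L (b i) := hx
  have hy' : aeval (y : L) (A i) = algebraMap k[X] L (b i) := hy
  have hval : ∀ (z : BB k (VV L A b) n) (P : k[X]), ((aeval z P : BB k (VV L A b) n) : L) =
      aeval (z : L) P := fun z P => by
    have := aeval_algHom_apply ((BB k (VV L A b) n).val.restrictScalars k) z P
    exact this.symm
  have h1 : aeval x (A i) = aeval y (A i) := by
    apply Subtype.ext
    rw [hval, hval, hx', hy']
  obtain ⟨E, hE⟩ := Polynomial.binomExpansion ((A i).map (algebraMap k (BB k (VV L A b) n))) y (x - y)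
  rw [add_sub_cancel, derivative_map, eval_map_algebraMap, eval_map_algebraMap,
    eval_map_algebraMap, h1] at hE
  have h2 : (x - y) * (aeval y (derivative (A i)) + E * (x - y)) = 0 := by linear_combination -hE
  have h3 := (mul_eq_zero.1 h2).resolve_left (sub_ne_zero.2 hne)
  have h4 := congrArg ψ h3
  rw [map_add, map_mul, map_sub, hxy, sub_self, mul_zero, add_zero, map_zero,
    ← aeval_algHom_apply] at h4
  exact der_ne_of_pil (pil_eval_ne ht) hA (psi_eval ψ hψ y hy) h4

lemma psi_surj (hs : Setup k K L A b n) (ψ : BB k (VV L A b) n →ₐ[k] k) {t : k}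
    (hψ : ψ (algebraMap k[X] _ X) = t) {i : ι} {a : k}
    (ha : (A i).eval a = (b i).eval t) :
    ∃ x : BB k (VV L A b) n, (x : L) ∈ Vs L (A i) (b i) ∧ ψ x = a := by
  set P := ((A i).map (algebraMap k L) - C (algebraMap k[X] L (b i))) with hP
  have hmon : P.Monic := by
    apply Monic.sub_of_left ((hs.monic i).map _)
    calc (C (algebraMap k[X] L (b i))).degree ≤ 0 := degree_C_le
      _ < ((A i).map (algebraMap k L)).degree := by
        rw [degree_map_eq_of_injective (algebraMap k L).injective]
        exact natDegree_pos_iff_degree_pos.1 (hs.degA_pos i)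
  have hroots : ∀ v ∈ P.roots, v ∈ Vs L (A i) (b i) := by
    intro v hv
    have := (mem_roots hmon.ne_zero).1 hv
    rw [IsRoot, hP, eval_sub, eval_C, eval_map_algebraMap, sub_eq_zero] at this
    exact this
  have hsp : P = (P.roots.map (X - C ·)).prod := by
    have hs0 : P.Splits := hs.splits i
    have := hs0.eq_prod_roots
    rwa [hmon.leadingCoeff, C_1, one_mul] at this
  have he := congrArg (eval (algebraMap k L a)) hsp
  rw [eval_multiset_prod, Multiset.map_map] at he
  have hlift : ∃ s : Multiset (BB k (VV L A b) n), s.map Subtype.val = P.roots ∧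
      ∀ x ∈ s, (x : L) ∈ Vs L (A i) (b i) := by
    refine ⟨P.roots.pmap (fun v (hv : v ∈ Vs L (A i) (b i)) => ⟨v, mem_BB hv⟩) hroots, ?_, ?_⟩
    · rw [Multiset.map_pmap, Multiset.pmap_eq_map, Multiset.map_id']
    · intro x hx
      obtain ⟨v, hv, rfl⟩ := Multiset.mem_pmap.1 hx
      exact hroots v hv
  obtain ⟨s, hs1, hs2⟩ := hlift
  have h2 : (algebraMap k (BB k (VV L A b) n) ((A i).eval a) -
      algebraMap k[X] (BB k (VV L A b) n) (b i)) =
      (s.map (fun x => algebraMap k (BB k (VV L A b) n) a - x)).prod := by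
    apply Subtype.ext
    have e1 : (((s.map (fun x => algebraMap k (BB k (VV L A b) n) a - x)).prod :
      BB k (VV L A b) n) : L) = (s.map (fun x : BB k (VV L A b) n => algebraMap k L a - (x : L))).prod := by
      have := map_multiset_prod (BB k (VV L A b) n).val
        (s.map (fun x => algebraMap k (BB k (VV L A b) n) a - x))
      rw [Multiset.map_map] at this
      exact this
    rw [e1]
    have e2 : (s.map (fun x : BB k (VV L A b) n => algebraMap k L a - (x : L))).prod =
      eval (algebraMap k L a) P := by
      rw [he, ← hs1, Multiset.map_map]
      simp [Function.comp_def]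
    rw [e2, hP, eval_sub, eval_C, eval_map_algebraMap, aeval_algebraMap_apply]
    rfl
  have h3 := congrArg ψ h2
  rw [map_sub, point_algebraMap, hψ, AlgHom.commutes, Algebra.algebraMap_self_apply, ha, sub_self,
    map_multiset_prod, Multiset.map_map, eq_comm, Multiset.prod_eq_zero_iff, Multiset.mem_map] at h3
  obtain ⟨x, hx, hx0⟩ := h3
  refine ⟨x, hs2 x hx, ?_⟩
  simp only [Function.comp, map_sub, AlgHom.commutes, Algebra.algebraMap_self_apply] at hx0
  exact (sub_eq_zero.1 hx0).symm

open Classical in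
theorem Setup.equi (hs : Setup k K L A b n) {p f : ℕ} [hp : Fact p.Prime] [CharP k p] (hf : 0 < f)
    {D0 P0 : ℕ} {δ : ℝ} (hδ : 0 < δ)
    (hnum : StepNum D0 (D0 * n) (n * n * n + n + Fintype.card ι * (n * n)) δ P0)
    (hPp : P0 ≤ p) (hD0 : Module.finrank K L ≤ D0)
    (θ0 : L →+* L) (hθT : θ0 (algebraMap k[X] L X) = algebraMap k[X] L X)
    (hθk : ∀ a : k, θ0 (algebraMap k L a) = algebraMap k L (a ^ p ^ f))
    (hθV : ∀ i, ∀ x ∈ Vs L (A i) (b i), θ0 x ∈ Vs L (A i) (b i))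
    (𝔉 : Finset k) (hF : ∀ t, t ∈ 𝔉 ↔ t ^ p ^ f = t) (hFc : 𝔉.card = p ^ f)
    (Ψ : (ι → Prop) → Prop) :
    |((𝔉.filter (fun t => Ψ (fun i => ∃ a ∈ 𝔉, (A i).eval a = (b i).eval t))).card : ℝ) -
      ((Finset.univ.filter (fun γ : L ≃ₐ[K] L =>
        Ψ (fun i => ∃ x ∈ Vs L (A i) (b i), θ0 (γ x) = x))).card : ℝ) /
          Fintype.card (L ≃ₐ[K] L) * (p ^ f : ℕ)| ≤
      δ * (p ^ f : ℕ) + (Fintype.card ι * (n * n) : ℕ) := by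
  obtain ⟨D, hD⟩ := exists_deriv k K L
  letI := hs.act
  obtain ⟨e, he⟩ := hs.sd D hD (D0 * n) (Nat.mul_le_mul_right _ hD0)
  have hcard : Fintype.card (L ≃ₐ[K] L) = Module.finrank K L := by
    rw [← Nat.card_eq_fintype_card, IsGalois.card_aut_eq_finrank]
  have hθW : ∀ {m x}, Wt k (VV L A b) n m x → Wt k (VV L A b) n m (θ0 x) := fun hx =>
    Wt.map hθk hθT (by rintro x ⟨i, hi⟩; exact ⟨i, hθV i x hi⟩) hx
  let θ : BB k (VV L A b) n →+* BB k (VV L A b) n :=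
    (θ0.comp (BB k (VV L A b) n).val.toRingHom).codRestrict (BB k (VV L A b) n).toSubring (by
      rintro ⟨x, m, hm⟩
      exact ⟨m, hθW hm⟩)
  have hθ : ∀ x, ((θ x : BB k (VV L A b) n) : L) = θ0 x := fun x => rfl
  have hsb : StepBound he (p ^ f) θ δ := by
    refine he.stepBound hf θ (fun hx => hθW hx) ?_
    obtain ⟨b', M, a, h1, h2, h3⟩ := hnum (Fintype.card (L ≃ₐ[K] L)) Fintype.card_pos
      (hcard ▸ hD0)
    exact ⟨b', M, a, h1, h2, h3 p hPp⟩
  have hdeg : natDegree (pig A b) ≤ Fintype.card ι * (n * n) := by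
    unfold pig
    refine (natDegree_prod_le _ _).trans ?_
    refine (Finset.sum_le_card_nsmul _ _ (n * n)
      (fun i _ => natDegree_pil_le (hs.degA i) (hs.degb i))).trans ?_
    simp
  have hdeg' : (natDegree (pig A b) : ℝ) ≤ (Fintype.card ι * (n * n) : ℕ) := by exact_mod_cast hdeg
  have hRE : ∀ t ∈ 𝔉, (pig A b).eval t ≠ 0 → ∀ ψ : BB k (VV L A b) n →ₐ[k] k,
      ψ (algebraMap k[X] _ X) = t →
      ∀ γ : L ≃ₐ[K] L, (∀ x, ψ x ^ p ^ f = ψ (θ (γ • x))) →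
      ((fun i => ∃ a ∈ 𝔉, (A i).eval a = (b i).eval t) =
        (fun i => ∃ x ∈ Vs L (A i) (b i), θ0 (γ x) = x)) := by
    intro t ht hπ ψ hψ γ hγ
    funext i
    apply propext
    constructor
    · rintro ⟨a, haF, ha⟩
      obtain ⟨x, hx, rfl⟩ := psi_surj hs ψ hψ ha
      refine ⟨x, hx, ?_⟩
      have h1 := hγ x
      rw [(hF _).1 haF] at h1
      have := psi_inj ψ hψ hπ (hs.der i) x (θ (γ • x)) hx (hθV i _ (hs.VV_map γ hx)) h1
      exact (congrArg Subtype.val this).symm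
    · rintro ⟨x, hx, hxγ⟩
      let x' : BB k (VV L A b) n := ⟨x, mem_BB hx⟩
      refine ⟨ψ x', (hF _).2 ?_, psi_eval ψ hψ x' hx⟩
      rw [hγ]
      congr 1
      exact Subtype.ext hxγ
  have up := he.equi_upper (p := p) (f := f) θ (Subtype.ext hθT) (fun a => Subtype.ext (hθk a)) hδ.le hsb 𝔉
    (fun t ht => (hF t).1 ht) (fun t => Ψ (fun i => ∃ a ∈ 𝔉, (A i).eval a = (b i).eval t))
    (fun γ : L ≃ₐ[K] L => Ψ (fun i => ∃ x ∈ Vs L (A i) (b i), θ0 (γ x) = x))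
    (fun t h1 h2 ψ h3 γ h4 h5 => by rw [← hRE t h1 h2 ψ h3 γ h4]; exact h5)
  have lo := he.equi_lower (p := p) (f := f) θ (Subtype.ext hθT) (fun a => Subtype.ext (hθk a)) hδ.le hsb 𝔉
    (fun t ht => (hF t).1 ht) hFc
    (fun t => Ψ (fun i => ∃ a ∈ 𝔉, (A i).eval a = (b i).eval t))
    (fun γ : L ≃ₐ[K] L => Ψ (fun i => ∃ x ∈ Vs L (A i) (b i), θ0 (γ x) = x))
    (fun t h1 h2 ψ h3 γ h4 h5 => by rw [hRE t h1 h2 ψ h3 γ h4]; exact h5)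
  rw [abs_le]
  constructor <;> linarith

end su2
end PC

namespace PC

section fw
variable (k : Type*) {L : Type*} [Field k] [Field L] [Algebra k[X] L] [Algebra k L]
  [IsScalarTower k k[X] L]

/-- finer weight filtration, with inverses of the derivative -/
inductive FW (G z : k[X]) : ℤ → L → Prop
  | const (a : k) : FW G z 0 (algebraMap k L a)
  | zero (w : ℤ) : FW G z w 0
  | T : FW G z G.natDegree (algebraMap k[X] L X)
  | root {x : L} (hx : x ∈ Vs L G z) : FW G z z.natDegree x
  | inv {x : L} (hx : x ∈ Vs L G z) :
      FW G z (-((G.natDegree - 1) * z.natDegree)) (aeval x (derivative G))⁻¹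
  | add {m : ℤ} {x y : L} : FW G z m x → FW G z m y → FW G z m (x + y)
  | mul {m n : ℤ} {x y : L} : FW G z m x → FW G z n y → FW G z (m + n) (x * y)
  | mono {m n : ℤ} {x : L} : m ≤ n → FW G z m x → FW G z n x

variable {k} {G z : k[X]}

lemma FW.one : FW k G z 0 (1 : L) := by simpa using FW.const (k := k) (G := G) (z := z) (L := L) 1

lemma FW.smul (a : k) {m : ℤ} {x : L} (hx : FW k G z m x) : FW k G z m (a • x) := by
  rw [Algebra.smul_def]; simpa using (FW.const a).mul hx

lemma FW.cmul (a : k) {m : ℤ} {x : L} (hx : FW k G z m x) : FW k G z m (algebraMap k L a * x) := by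
  simpa using (FW.const a).mul hx

lemma FW.neg {m : ℤ} {x : L} (hx : FW k G z m x) : FW k G z m (-x) := by
  simpa using hx.smul (-1)

lemma FW.sub {m : ℤ} {x y : L} (hx : FW k G z m x) (hy : FW k G z m y) : FW k G z m (x - y) := by
  rw [sub_eq_add_neg]; exact hx.add hy.neg

lemma FW.pow {m : ℤ} {x : L} (hx : FW k G z m x) (n : ℕ) : FW k G z (n * m) (x ^ n) := by
  induction n with
  | zero => simpa using FW.one
  | succ n ih => rw [pow_succ]; exact (ih.mul hx).mono (by push_cast; ring_nf; exact le_rfl)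

lemma FW.sum {ι : Type*} (s : Finset ι) {x : ι → L} {m : ℤ} (hx : ∀ i ∈ s, FW k G z m (x i)) :
    FW k G z m (∑ i ∈ s, x i) := by
  classical
  induction s using Finset.induction_on with
  | empty => simpa using FW.zero m
  | insert a s ha ih =>
    rw [Finset.sum_insert ha]
    exact (hx _ (Finset.mem_insert_self _ _)).add
      (ih fun i hi => hx i (Finset.mem_insert_of_mem hi))

lemma FW.prod {ι : Type*} (s : Finset ι) {x : ι → L} {m : ℤ} (hx : ∀ i ∈ s, FW k G z m (x i)) :
    FW k G z (s.card * m) (∏ i ∈ s, x i) := by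
  classical
  induction s using Finset.induction_on with
  | empty => simpa using FW.one
  | insert a s ha ih =>
    rw [Finset.prod_insert ha, Finset.card_insert_of_notMem ha]
    refine ((hx _ (Finset.mem_insert_self _ _)).mul
      (ih fun i hi => hx i (Finset.mem_insert_of_mem hi))).mono ?_
    push_cast; ring_nf; exact le_rfl

lemma FW.aeval {m : ℤ} (hm : 0 ≤ m) {x : L} (hx : FW k G z m x) (P : k[X]) {n : ℕ}
    (hn : P.natDegree ≤ n) : FW k G z (n * m) (aeval x P) := by
  rw [aeval_eq_sum_range]
  refine FW.sum _ fun i hi => FW.smul _ ?_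
  refine (hx.pow i).mono ?_
  simp at hi
  have : (i : ℤ) ≤ n := by omega
  exact mul_le_mul_of_nonneg_right this hm

lemma FW.poly (P : k[X]) {n : ℕ} (hn : P.natDegree ≤ n) :
    FW k G z (n * G.natDegree) (algebraMap k[X] L P) := by
  rw [algebraMap_eq_aeval]; exact FW.T.aeval (by positivity) P hn

/-- coefficients of a product of linear factors -/
lemma FW.coeff_prod {ι : Type*} (s : Finset ι) {x : ι → L} {m : ℤ} (hm : 0 ≤ m)
    (hx : ∀ i ∈ s, FW k G z m (x i)) (j : ℕ) :
    FW k G z (s.card * m) ((∏ i ∈ s, (X - C (x i))).coeff j) := by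
  classical
  induction s using Finset.induction_on generalizing j with
  | empty =>
    simp only [Finset.prod_empty, coeff_one]
    split_ifs
    · simpa using FW.one
    · exact FW.zero _
  | insert a s ha ih =>
    have ih' := fun j => ih (fun i hi => hx i (Finset.mem_insert_of_mem hi)) j
    rw [Finset.prod_insert ha, Finset.card_insert_of_notMem ha, sub_mul, coeff_sub, coeff_C_mul]
    refine FW.sub ?_ ?_
    · cases j with
      | zero => simpa using FW.zero _
      | succ j => rw [coeff_X_mul]; exact (ih' j).mono (by push_cast; nlinarith)
    · refine ((hx _ (Finset.mem_insert_self _ _)).mul (ih' j)).mono ?_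
      push_cast; ring_nf; exact le_rfl

lemma FW.map {θ : L →+* L} (hk : ∀ a, θ (algebraMap k L a) = algebraMap k L a)
    (hT : θ (algebraMap k[X] L X) = algebraMap k[X] L X) {m : ℤ} {x : L}
    (hx : FW k G z m x) : FW k G z m (θ x) := by
  have hae : ∀ (x : L) (P : k[X]), θ (Polynomial.aeval x P) = Polynomial.aeval (θ x) P := by
    intro x P
    let θ' : L →ₐ[k] L := { θ with commutes' := hk }
    exact (aeval_algHom_apply θ' x P).symm
  have hV : ∀ x ∈ Vs L G z, θ x ∈ Vs L G z := by
    intro x hx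
    have hx' : Polynomial.aeval x G = algebraMap k[X] L z := hx
    change Polynomial.aeval (θ x) G = _
    rw [← hae, hx', algebraMap_eq_aeval, hae, hT]
  induction hx with
  | const a => rw [hk]; exact FW.const _
  | zero w => rw [map_zero]; exact FW.zero _
  | T => rw [hT]; exact FW.T
  | root h => exact FW.root (hV _ h)
  | inv h => rw [map_inv₀, hae]; exact FW.inv (hV _ h)
  | add _ _ ih1 ih2 => rw [map_add]; exact ih1.add ih2
  | mul _ _ ih1 ih2 => rw [map_mul]; exact ih1.mul ih2
  | mono h _ ih => exact ih.mono h

/-- an endomorphism fixing constants, T, and all roots fixes FW -/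
lemma FW.fixed {θ : L →+* L} (hk : ∀ a, θ (algebraMap k L a) = algebraMap k L a)
    (hT : θ (algebraMap k[X] L X) = algebraMap k[X] L X) (hV : ∀ x ∈ Vs L G z, θ x = x)
    {m : ℤ} {x : L} (hx : FW k G z m x) : θ x = x := by
  have hae : ∀ (x : L) (P : k[X]), θ (Polynomial.aeval x P) = Polynomial.aeval (θ x) P := by
    intro x P
    let θ' : L →ₐ[k] L := { θ with commutes' := hk }
    exact (aeval_algHom_apply θ' x P).symm
  induction hx with
  | const a => rw [hk]
  | zero w => rw [map_zero]
  | T => rw [hT]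
  | root h => exact (hV _ h)
  | inv h => rw [map_inv₀, hae, hV _ h]
  | add _ _ ih1 ih2 => rw [map_add, ih1, ih2]
  | mul _ _ ih1 ih2 => rw [map_mul, ih1, ih2]
  | mono h _ ih => exact ih

lemma FW.deriv {D : Derivation k L L} (hD : D (algebraMap k[X] L X) = 1)
    (hG : 2 ≤ G.natDegree) (hz : 1 ≤ z.natDegree)
    (hne : ∀ x ∈ Vs L G z, Polynomial.aeval x (derivative G) ≠ 0) {m : ℤ} {x : L}
    (hx : FW k G z m x) : FW k G z (m - G.natDegree) (D x) := by
  have hroot : ∀ x ∈ Vs L G z, D x = algebraMap k[X] L (derivative z) *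
      (Polynomial.aeval x (derivative G))⁻¹ := by
    intro x hx
    have hx' : Polynomial.aeval x G = algebraMap k[X] L z := hx
    have hd := congrArg D hx'
    rw [algebraMap_eq_aeval, Derivation.map_aeval, Derivation.map_aeval, hD, smul_eq_mul,
      smul_eq_mul, mul_one, ← algebraMap_eq_aeval] at hd
    have := hne x hx
    field_simp
    linear_combination hd
  have hrootw : ∀ x ∈ Vs L G z, FW k G z (z.natDegree - G.natDegree) (D x) := by
    intro x hx
    rw [hroot x hx]
    refine ((FW.poly (derivative z) (natDegree_derivative_le z)).mul (FW.inv hx)).mono ?_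
    rw [Nat.cast_sub hz]; push_cast; ring_nf; exact le_rfl
  induction hx with
  | const a => rw [Derivation.map_algebraMap]; exact FW.zero _
  | zero w => rw [map_zero]; exact FW.zero _
  | T => rw [hD, sub_self]; exact FW.one
  | root h => exact hrootw _ h
  | @inv x h =>
    rw [Derivation.leibniz_inv, Derivation.map_aeval, smul_eq_mul, smul_eq_mul]
    have e : -(Polynomial.aeval x (derivative G))⁻¹ ^ 2 *
        (Polynomial.aeval x (derivative (derivative G)) * D x) =
      -((Polynomial.aeval x (derivative G))⁻¹ ^ 2 *
        Polynomial.aeval x (derivative (derivative G)) * D x) := by ring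
    rw [e]
    refine (((((FW.inv h).pow 2).mul ((FW.root h).aeval (by positivity)
      (derivative (derivative G)) (n := G.natDegree - 2) ?_)).mul (hrootw x h)).mono ?_).neg
    · refine (natDegree_derivative_le _).trans ?_
      have := natDegree_derivative_le G
      omega
    · rw [Nat.cast_sub hG]; push_cast; ring_nf; exact le_rfl
  | add _ _ ih1 ih2 => rw [map_add]; exact ih1.add ih2
  | @mul m n x y h1 h2 ih1 ih2 =>
    rw [Derivation.leibniz, smul_eq_mul, smul_eq_mul]
    exact ((h1.mul ih2).mono (by omega)).add ((h2.mul ih1).mono (by omega))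
  | mono h _ ih => exact ih.mono (by omega)

variable {Γ₀ : Type*} [LinearOrderedCommGroupWithZero Γ₀]

lemma Vs.val_infty {v : Valuation L Γ₀} (hk : ∀ a : k, v (algebraMap k L a) ≤ 1)
    (hT : 1 < v (algebraMap k[X] L X)) {x : L} (hx : x ∈ Vs L G z) (hG : G ≠ 0)
    (hz : 1 ≤ z.natDegree) : 1 < v x ∧ v x ^ G.natDegree = v (algebraMap k[X] L X) ^ z.natDegree := by
  have hx' : aeval x G = algebraMap k[X] L z := hx
  have hz0 : z ≠ 0 := by rintro rfl; simp at hz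
  have h1 : v (Polynomial.aeval x G) = v (algebraMap k[X] L X) ^ z.natDegree := by
    rw [hx', algebraMap_eq_aeval, val_aeval_eq hk hT hz0]
  have hgt : 1 < v x := by
    by_contra hle
    push Not at hle
    have h2 : v (Polynomial.aeval x G) ≤ 1 := by
      rw [aeval_eq_sum_range]
      refine Valuation.map_sum_le _ fun i hi => ?_
      rw [Algebra.smul_def, map_mul, map_pow]
      exact mul_le_one' (hk _) (pow_le_one' hle i)
    rw [h1] at h2
    exact absurd h2 (not_le.2 (one_lt_pow₀ hT (by omega)))
  exact ⟨hgt, by rw [← h1, val_aeval_eq hk hgt hG]⟩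

lemma FW.val {v : Valuation L Γ₀} (hk : ∀ a : k, v (algebraMap k L a) ≤ 1)
    (hT : 1 < v (algebraMap k[X] L X)) (hG : 2 ≤ G.natDegree) (hz : 1 ≤ z.natDegree)
    (hG' : (derivative G).natDegree = G.natDegree - 1) {m : ℤ} {x : L}
    (hx : FW k G z m x) : v x ^ G.natDegree ≤ v (algebraMap k[X] L X) ^ m := by
  have hG0 : G ≠ 0 := by rintro rfl; simp at hG
  have hT0 : v (algebraMap k[X] L X) ≠ 0 := (zero_lt_one.trans hT).ne'
  induction hx with
  | const a => rw [zpow_zero]; exact pow_le_one' (hk a) _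
  | zero w => rw [map_zero, zero_pow (by omega)]; exact zero_le
  | T => simp
  | root h => rw [(Vs.val_infty hk hT h hG0 hz).2]; simp
  | @inv x h =>
    obtain ⟨h1, h2⟩ := Vs.val_infty hk hT h hG0 hz
    have hd0 : derivative G ≠ 0 := by
      intro h0; rw [h0] at hG'; simp at hG'; omega
    rw [map_inv₀, val_aeval_eq hk h1 hd0, hG', inv_pow, ← pow_mul, mul_comm, pow_mul, h2,
      ← pow_mul, zpow_neg, ← zpow_natCast]
    rw [Nat.cast_mul, Nat.cast_sub (by omega)]
    push_cast
    rw [mul_comm (z.natDegree : ℤ)]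
  | add _ _ ih1 ih2 =>
    rename_i a b _ _
    rcases le_total (v a) (v b) with h | h
    · exact (pow_le_pow_left' (Valuation.map_add_le v h le_rfl) _).trans ih2
    · exact (pow_le_pow_left' (Valuation.map_add_le v le_rfl h) _).trans ih1
  | mul _ _ ih1 ih2 => rw [map_mul, mul_pow, zpow_add₀ hT0]; exact mul_le_mul' ih1 ih2
  | mono h _ ih => exact ih.trans (zpow_le_zpow_right₀ hT.le h)

/-- reduction at a point -/
lemma val_aeval_of_eval_ne {𝒱 : ValuationSubring L} (hk : ∀ a : k, algebraMap k L a ∈ 𝒱) {y : L}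
    {y0 : k} (hy : 𝒱.valuation (y - algebraMap k L y0) < 1) {P : k[X]} (hP : P.eval y0 ≠ 0) :
    𝒱.valuation (aeval y P) = 1 := by
  have hk' : ∀ a : k, 𝒱.valuation (algebraMap k L a) ≤ 1 := fun a =>
    (𝒱.valuation_le_one_iff _).2 (hk a)
  have hy𝒱 : y ∈ 𝒱 := by
    have : y = (y - algebraMap k L y0) + algebraMap k L y0 := by ring
    rw [this]
    exact add_mem ((𝒱.valuation_le_one_iff _).1 hy.le) (hk _)
  obtain ⟨Q, -, hQ⟩ := exists_quo P y0
  have e : aeval y P = (y - algebraMap k L y0) * aeval y Q + algebraMap k L (P.eval y0) := by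
    have := congrArg (aeval y) hQ
    simp only [map_sub, map_mul, aeval_C, aeval_X] at this
    linear_combination this
  have h1 : 𝒱.valuation ((y - algebraMap k L y0) * aeval y Q) < 1 := by
    rw [map_mul]
    have h2 : 𝒱.valuation (aeval y Q) ≤ 1 :=
      (𝒱.valuation_le_one_iff _).2 (mem_val_aeval hk hy𝒱 Q)
    exact mul_lt_one_of_lt_of_le hy h2
  rw [e, Valuation.map_add_eq_of_lt_right]
  · exact val_const hk' hP
  · rw [val_const hk' hP]; exact h1

lemma mem_of_val_sub {𝒱 : ValuationSubring L} (hk : ∀ a : k, algebraMap k L a ∈ 𝒱) {y : L}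
    {y0 : k} (hy : 𝒱.valuation (y - algebraMap k L y0) < 1) : y ∈ 𝒱 := by
  have : y = (y - algebraMap k L y0) + algebraMap k L y0 := by ring
  rw [this]
  exact add_mem ((𝒱.valuation_le_one_iff _).1 hy.le) (hk _)

/-- images of centers -/
lemma val_comp {𝒱 : ValuationSubring L} (hk : ∀ a : k, algebraMap k L a ∈ 𝒱) {y : L}
    {y0 : k} (hy : 𝒱.valuation (y - algebraMap k L y0) < 1) (P : k[X]) :
    𝒱.valuation (aeval y P - algebraMap k L (P.eval y0)) < 1 := by
  obtain ⟨Q, -, hQ⟩ := exists_quo P y0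
  have e : aeval y P - algebraMap k L (P.eval y0) = (y - algebraMap k L y0) * aeval y Q := by
    have := congrArg (aeval y) hQ
    simp only [map_sub, map_mul, aeval_C, aeval_X] at this
    linear_combination this
  rw [e, map_mul]
  have h2 : 𝒱.valuation (aeval y Q) ≤ 1 :=
    (𝒱.valuation_le_one_iff _).2 (mem_val_aeval hk (mem_of_val_sub hk hy) Q)
  exact mul_lt_one_of_lt_of_le hy h2

lemma unit_of_mul {𝒱 : ValuationSubring L} {a b : L} (ha : a ∈ 𝒱) (hb : b ∈ 𝒱)
    (hab : 𝒱.valuation (a * b) = 1) : 𝒱.valuation a = 1 := by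
  refine le_antisymm ((𝒱.valuation_le_one_iff _).2 ha) ?_
  rw [← hab, map_mul]
  exact mul_le_of_le_one_right' ((𝒱.valuation_le_one_iff _).2 hb)

lemma inv_mem_of_val {𝒱 : ValuationSubring L} {a : L} (ha : 𝒱.valuation a = 1) : a⁻¹ ∈ 𝒱 := by
  rw [← 𝒱.valuation_le_one_iff, map_inv₀, ha, inv_one]

lemma FW.mem_val [IsAlgClosed k] {𝒱 : ValuationSubring L} (hk : ∀ a : k, algebraMap k L a ∈ 𝒱)
    {t0 : k} (ht : 𝒱.valuation (algebraMap k[X] L X - algebraMap k L t0) < 1)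
    (hGm : G.Monic) (hG : 2 ≤ G.natDegree) (hG0 : derivative G ≠ 0)
    (hS : (pil G z).eval t0 ≠ 0) {m : ℤ} {x : L} (hx : FW k G z m x) : x ∈ 𝒱 := by
  have hT := mem_of_val_sub hk ht
  have hroot : ∀ x ∈ Vs L G z, x ∈ 𝒱 := fun x hx =>
    mem_val_integral hk hT (Vs_integral hGm hx (by omega))
  induction hx with
  | const a => exact hk a
  | zero w => exact zero_mem _
  | T => exact hT
  | root h => exact hroot _ h
  | @inv x h =>
    obtain ⟨Q, -, hQ⟩ := pil_eq (L := L) (b := z) hG0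
    have h1 := hQ x h
    have h2 := val_aeval_of_eval_ne hk ht hS
    rw [← algebraMap_eq_aeval, h1] at h2
    exact inv_mem_of_val (unit_of_mul (mem_val_aeval hk (hroot x h) _)
      (mem_val_aeval hk (hroot x h) _) h2)
  | add _ _ ih1 ih2 => exact add_mem ih1 ih2
  | mul _ _ ih1 ih2 => exact mul_mem ih1 ih2
  | mono h _ ih => exact ih

end fw
end PC

namespace PC

section integ
variable {k : Type*} [Field k]

/-- a polynomial of small degree with zero derivative is constant -/
lemma eq_C_of_deriv {B : ℕ} (hB : ∀ m : ℕ, 0 < m → m ≤ B → (m : k) ≠ 0) {P : k[X]}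
    (hP : P.natDegree ≤ B) (hd : derivative P = 0) : P = C (P.coeff 0) := by
  ext j
  rw [coeff_C]
  split_ifs with h
  · rw [h]
  · by_cases hj : P.natDegree < j
    · exact coeff_eq_zero_of_natDegree_lt hj
    · have h1 := congrArg (fun Q => Q.coeff (j - 1)) hd
      simp only [coeff_derivative, coeff_zero] at h1
      have e : j - 1 + 1 = j := by omega
      rw [e] at h1
      have h2 := hB j (by omega) (by omega)
      rcases mul_eq_zero.1 h1 with h3 | h3
      · exact h3
      · exact absurd (by
          have : ((j - 1 : ℕ) : k) + 1 = (j : k) := by rw [← e]; push_cast; simp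
          rw [← this]; exact h3) h2

lemma exists_integral {B : ℕ} (hB : ∀ m : ℕ, 0 < m → m ≤ B → (m : k) ≠ 0) {Q : k[X]}
    (hQ : Q.natDegree + 1 ≤ B) : ∃ R : k[X], derivative R = Q ∧ R.natDegree ≤ Q.natDegree + 1 := by
  refine ⟨∑ i ∈ Finset.range (Q.natDegree + 1), C (Q.coeff i / ((i + 1 : ℕ) : k)) * X ^ (i + 1),
    ?_, ?_⟩
  · rw [derivative_sum]
    conv_rhs => rw [Q.as_sum_range_C_mul_X_pow]
    refine Finset.sum_congr rfl fun i hi => ?_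
    have hi' : i < Q.natDegree + 1 := Finset.mem_range.1 hi
    rw [derivative_C_mul_X_pow, div_mul_cancel₀ _ (hB _ (by omega) (by omega))]
    simp
  · refine natDegree_sum_le_of_forall_le _ _ fun i hi => ?_
    have hi' : i < Q.natDegree + 1 := Finset.mem_range.1 hi
    exact (natDegree_C_mul_X_pow_le _ _).trans (by omega)

lemma pil_eq' [IsAlgClosed k] {A : k[X]} (hA : derivative A ≠ 0) :
    ∃ Q : k[X], (pil A X).comp A = derivative A * Q := by
  choose Q hQ1 hQ2 using exists_quo A
  refine ⟨C (derivative A).leadingCoeff⁻¹ * ((derivative A).roots.map Q).prod, ?_⟩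
  have h1 : (pil A X).comp A = ((derivative A).roots.map (fun r => A - C (A.eval r))).prod := by
    rw [pil, multiset_prod_comp, Multiset.map_map]
    congr 1
    refine Multiset.map_congr rfl fun r _ => by simp
  have h2 : derivative A = C (derivative A).leadingCoeff *
      ((derivative A).roots.map (fun r => X - C r)).prod :=
    (IsAlgClosed.splits (derivative A)).eq_prod_roots
  rw [h1]
  have h3 : ((derivative A).roots.map (fun r => A - C (A.eval r))).prod =
      ((derivative A).roots.map (fun r => X - C r)).prod * ((derivative A).roots.map Q).prod := by
    rw [← Multiset.prod_map_mul]
    congr 1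
    exact Multiset.map_congr rfl fun r _ => hQ2 r
  rw [h3]
  have h4 : (C (derivative A).leadingCoeff : k[X]) * C (derivative A).leadingCoeff⁻¹ = 1 := by
    rw [← C_mul, mul_inv_cancel₀ (leadingCoeff_ne_zero.2 hA), C_1]
  calc _ = (C (derivative A).leadingCoeff * C (derivative A).leadingCoeff⁻¹) *
      (((derivative A).roots.map (fun r => X - C r)).prod * ((derivative A).roots.map Q).prod) := by
        rw [h4, one_mul]
    _ = (C (derivative A).leadingCoeff * ((derivative A).roots.map (fun r => X - C r)).prod) *
        (C (derivative A).leadingCoeff⁻¹ * ((derivative A).roots.map Q).prod) := by ring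
    _ = _ := by rw [← h2]
end integ

section gal
variable {k K L : Type*} [Field k] [IsAlgClosed k] [Field K] [Field L] [Algebra k[X] K] [IsFractionRing k[X] K]
  [Algebra K L] [Algebra k[X] L] [IsScalarTower k[X] K L] [Algebra k L] [IsScalarTower k k[X] L]
  [Algebra k K] [IsScalarTower k k[X] K] [IsScalarTower k K L] [FiniteDimensional K L]
  [IsGalois K L]

lemma aeval_gal (g : L ≃ₐ[K] L) (x : L) (P : k[X]) : g (aeval x P) = aeval (g x) P := by
  let θ' : L →ₐ[k] L := { (g : L →+* L) with commutes' := fun a => gal_k g a }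
  exact (aeval_algHom_apply θ' x P).symm

lemma integral_gal (g : L ≃ₐ[K] L) {x : L} (hx : IsIntegral k[X] x) : IsIntegral k[X] (g x) := by
  obtain ⟨P, hP, h0⟩ := hx
  refine ⟨P, hP, ?_⟩
  have h1 : ((g : L →+* L).comp (algebraMap k[X] L)) = algebraMap k[X] L := by
    ext a
    · simp only [RingHom.comp_apply]; exact gal_poly g _
    · exact gal_poly g _
  have := congrArg (g : L →+* L) h0
  rw [hom_eval₂, h1, map_zero] at this
  exact this

variable (K) in
include K in
lemma transc_root {g : k[X]} {Y : L} (hY : aeval Y g = algebraMap k[X] L X) :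
    Transcendental k Y := by
  have h1 : Transcendental k (aeval Y g) := by rw [hY]; exact transc_T (k := k) K (L := L)
  exact transcendental_aeval_iff.1 h1 |>.1

/-- substitution `T = g(X)` -/
lemma subst_eq {g : k[X]} {Y : L} (hY : aeval Y g = algebraMap k[X] L X) (P : k[X][X]) :
    aeval Y P = aeval Y (P.eval₂ (compRingHom g) X) := by
  rw [aeval_def, ← AlgHom.coe_toRingHom (aeval (R := k) Y), hom_eval₂]
  congr 1
  · ext a
    · simp only [RingHom.comp_apply, coe_compRingHom, C_comp, RingHom.coe_coe, aeval_C]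
      rw [IsScalarTower.algebraMap_apply k k[X] L]; rfl
    · simp [hY]
  · simp

lemma exists_conj {g : k[X]} (hg : g.Monic) (hg0 : 0 < g.natDegree) {Y Y' : L}
    (hY : aeval Y g = algebraMap k[X] L X) (hY' : aeval Y' g = algebraMap k[X] L X) :
    ∃ τ : L ≃ₐ[K] L, τ Y = Y' := by
  have hi : IsIntegral k[X] Y := Vs_integral (A := g) (b := X) hg hY hg0
  have hc : IsConjRoot K Y Y' := by
    rw [isConjRoot_iff_aeval_eq_zero (Algebra.IsIntegral.isIntegral Y),
      minpoly.isIntegrallyClosed_eq_field_fractions' K hi, aeval_map_algebraMap, subst_eq hY']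
    have h0 := minpoly.aeval k[X] Y
    rw [subst_eq hY] at h0
    rw [(transcendental_iff.1 (transc_root K hY)) _ h0, map_zero]
  obtain ⟨σ, hσ⟩ := (isConjRoot_iff_exists_algEquiv).1 hc
  exact ⟨σ.symm, by rw [← hσ]; simp⟩

/-- Elements fixed by the stabilizer of `Y`, integral, are polynomials in `Y`. -/
lemma fixed_poly {g : k[X]} (hg : g.Monic) (hg0 : 0 < g.natDegree) {Y : L}
    (hY : aeval Y g = algebraMap k[X] L X) {h : L} (hi : IsIntegral k[X] h)
    (hfix : ∀ σ : L ≃ₐ[K] L, σ Y = Y → σ h = h) : ∃ H : k[X], aeval Y H = h := by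
  have htr := transc_root K hY
  have hinj : Function.Injective (aeval (R := k) Y : k[X] →+* L) :=
    transcendental_iff_injective.1 htr
  let φ : FractionRing k[X] →+* L := IsFractionRing.lift (A := k[X]) hinj
  have hφ : ∀ P : k[X], φ (algebraMap _ _ P) = aeval Y P := fun P =>
    IsFractionRing.lift_algebraMap hinj P
  have hK : ∀ a : K, algebraMap K L a ∈ φ.fieldRange := by
    intro a
    obtain ⟨p, q, hq, rfl⟩ := IsFractionRing.div_surjective (A := k[X]) a
    rw [map_div₀, ← IsScalarTower.algebraMap_apply, ← IsScalarTower.algebraMap_apply]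
    have h1 : ∀ p : k[X], algebraMap k[X] L p ∈ φ.fieldRange := fun p =>
      ⟨algebraMap _ _ (p.comp g), by rw [hφ, aeval_comp, hY, ← algebraMap_eq_aeval]⟩
    exact div_mem (h1 p) (h1 q)
  let F : IntermediateField K L := Subfield.toIntermediateField φ.fieldRange hK
  have hF : IntermediateField.adjoin K {Y} ≤ F := by
    rw [IntermediateField.adjoin_simple_le_iff]
    exact ⟨algebraMap _ _ X, by rw [hφ, aeval_X]⟩
  have hh : h ∈ IntermediateField.adjoin K {Y} := by
    rw [← IsGalois.fixedField_fixingSubgroup (IntermediateField.adjoin K {Y})]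
    rw [IntermediateField.mem_fixedField_iff]
    intro σ hσ
    refine hfix σ ?_
    rw [IntermediateField.mem_fixingSubgroup_iff] at hσ
    exact hσ Y (IntermediateField.mem_adjoin_simple_self K Y)
  obtain ⟨u, hu⟩ := hF hh
  have hui : IsIntegral k[X] u := by
    obtain ⟨P, hP, h0⟩ := hi
    refine ⟨P.map (compRingHom g), hP.map _, φ.injective ?_⟩
    rw [map_zero, eval₂_map, hom_eval₂]
    have : φ.comp ((algebraMap k[X] (FractionRing k[X])).comp (compRingHom g)) =
        algebraMap k[X] L := by
      ext a
      · simp only [RingHom.comp_apply, coe_compRingHom, C_comp, hφ, aeval_C]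
        rw [IsScalarTower.algebraMap_apply k k[X] L]; rfl
      · simp only [RingHom.comp_apply, coe_compRingHom, X_comp, hφ, hY]
    rw [this]
    change eval₂ _ (φ u) P = 0
    have hu' : φ u = h := hu
    rw [hu']; exact h0
  obtain ⟨H, rfl⟩ := IsIntegrallyClosed.isIntegral_iff.1 hui
  exact ⟨H, by rw [← hφ]; exact hu⟩

/-- an element of K regular at a place over each point is a polynomial -/
lemma regular_poly (u : K)
    (hreg : ∀ t0 : k, ∃ 𝒱 : ValuationSubring L, (∀ a : k, algebraMap k L a ∈ 𝒱) ∧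
      𝒱.valuation (algebraMap k[X] L X - algebraMap k L t0) < 1 ∧ algebraMap K L u ∈ 𝒱) :
    ∃ P : k[X], algebraMap k[X] K P = u := by
  obtain ⟨a, b, hab, rfl⟩ := IsFractionRing.exists_reduced_fraction (A := k[X]) u
  have hb0 : (b : k[X]) ≠ 0 := nonZeroDivisors.ne_zero b.2
  by_cases hdeg : (b : k[X]).degree = 0
  · have hu : IsUnit (b : k[X]) := isUnit_iff_degree_eq_zero.2 hdeg
    obtain ⟨w, hw⟩ := hu
    refine ⟨a * (w⁻¹ : k[X]ˣ), ?_⟩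
    rw [IsLocalization.eq_mk'_iff_mul_eq, ← map_mul, mul_assoc, ← hw]
    simp
  · exfalso
    obtain ⟨t0, ht0⟩ := IsAlgClosed.exists_root (b : k[X]) hdeg
    obtain ⟨𝒱, hk, ht, hm⟩ := hreg t0
    have ha0 : a.eval t0 ≠ 0 := by
      intro ha
      have h1 : (X - C t0) ∣ a := dvd_iff_isRoot.2 ha
      have h2 : (X - C t0) ∣ (b : k[X]) := dvd_iff_isRoot.2 ht0
      exact not_isUnit_X_sub_C t0 (hab h1 h2)
    have h1 := val_aeval_of_eval_ne hk ht ha0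
    have h2 := val_comp hk ht (b : k[X])
    rw [ht0.eq_zero, map_zero, sub_zero] at h2
    rw [← algebraMap_eq_aeval] at h1 h2
    have h3 : algebraMap k[X] L a =
        algebraMap K L (IsLocalization.mk' K a b) * algebraMap k[X] L b := by
      rw [IsScalarTower.algebraMap_apply k[X] K L, IsScalarTower.algebraMap_apply k[X] K L,
        ← map_mul, IsLocalization.mk'_spec]
    rw [h3, map_mul] at h1
    have h4 := (𝒱.valuation_le_one_iff _).2 hm
    have h5 := mul_lt_one_of_lt_of_le h2 h4
    rw [mul_comm] at h5
    rw [h1] at h5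
    exact lt_irrefl _ h5

open scoped Pointwise in
lemma mem_span_pow (V : Set L) {x : L} (hx : x ∈ IntermediateField.adjoin K V) :
    x ∈ Submodule.span K ((insert 1 V) ^ (Module.finrank K L)) := by
  rw [← Submodule.span_pow]
  set P := Submodule.span K (insert 1 V) with hP
  have h1 : (1 : L) ∈ P := Submodule.subset_span (Set.mem_insert _ _)
  set n := Module.finrank K L with hn
  have hst : P ^ n = P ^ (n + 1) := pow_finrank_eq P h1
  have hle : (1 : Submodule K L) ≤ P := by rw [Submodule.one_le]; exact h1
  have hstab : ∀ j, P ^ (n + j) = P ^ n := by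
    intro j
    induction j with
    | zero => rfl
    | succ j ih => rw [← add_assoc, pow_succ, ih, ← pow_succ, ← hst]
  have hPn : P ≤ P ^ n := by
    calc P = P ^ 1 := (pow_one P).symm
      _ ≤ P ^ (n + 1) := pow_le_pow_right₀ hle (by omega)
      _ = P ^ n := hst.symm
  let A : Subalgebra K L :=
    { carrier := (P ^ n : Submodule K L)
      mul_mem' := fun {a b} ha hb => by
        have : a * b ∈ P ^ n * P ^ n := Submodule.mul_mem_mul ha hb
        rw [← pow_add, hstab] at this
        exact this
      add_mem' := fun ha hb => Submodule.add_mem _ ha hb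
      algebraMap_mem' := fun r => by
        rw [Algebra.algebraMap_eq_smul_one]
        exact Submodule.smul_mem _ _ (hPn h1) }
  have hA : Algebra.adjoin K V ≤ A := Algebra.adjoin_le fun x hx =>
    hPn (Submodule.subset_span (Set.mem_insert_of_mem _ hx))
  have hx2 : x ∈ Algebra.adjoin K V := by
    have := IntermediateField.adjoin_toSubalgebra_of_isAlgebraic (F := K) (E := L) (S := V)
      (fun x _ => Algebra.IsAlgebraic.isAlgebraic x)
    rw [← this]; exact hx
  exact hA hx2

lemma tr_fixed (M : Subgroup (L ≃ₐ[K] L)) [Fintype M] (x : L) {g : L ≃ₐ[K] L} (hg : g ∈ M) :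
    g (∑ m : M, (m : L ≃ₐ[K] L) x) = ∑ m : M, (m : L ≃ₐ[K] L) x := by
  rw [map_sum]
  exact Fintype.sum_equiv (Equiv.mulLeft ⟨g, hg⟩) _ _ fun m => rfl

open scoped Pointwise in
/-- trace argument -/
lemma fixed_in_base (V : Set L) (M : Subgroup (L ≃ₐ[K] L)) [Fintype M]
    (hM : ∀ g : L ≃ₐ[K] L, (∀ x ∈ V, g x = x) → g ∈ M)
    (hcard : ((Fintype.card M : ℕ) : L) ≠ 0)
    (htr : ∀ s ∈ (insert 1 V) ^ (Module.finrank K L), ∃ a : K,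
      algebraMap K L a = ∑ m : M, (m : L ≃ₐ[K] L) s)
    {x : L} (hx : ∀ g ∈ M, g x = x) : ∃ a : K, algebraMap K L a = x := by
  have hx1 : x ∈ IntermediateField.adjoin K V := by
    rw [← IsGalois.fixedField_fixingSubgroup (IntermediateField.adjoin K V)]
    rw [IntermediateField.mem_fixedField_iff]
    intro σ hσ
    refine hx σ (hM σ fun y hy => ?_)
    rw [IntermediateField.mem_fixingSubgroup_iff] at hσ
    exact hσ y (IntermediateField.subset_adjoin K V hy)
  have hx2 := mem_span_pow V hx1
  have key : ∀ y ∈ Submodule.span K ((insert 1 V) ^ (Module.finrank K L)), ∃ a : K,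
      algebraMap K L a = ∑ m : M, (m : L ≃ₐ[K] L) y := by
    intro y hy
    induction hy using Submodule.span_induction with
    | mem y hy => exact htr y hy
    | zero => exact ⟨0, by simp⟩
    | add y z _ _ h1 h2 =>
      obtain ⟨a, ha⟩ := h1
      obtain ⟨b, hb⟩ := h2
      exact ⟨a + b, by simp only [map_add, Finset.sum_add_distrib, ha, hb]⟩
    | smul c y _ h1 =>
      obtain ⟨a, ha⟩ := h1
      refine ⟨c * a, ?_⟩
      rw [map_mul, ha, Finset.mul_sum]
      refine Finset.sum_congr rfl fun m _ => ?_
      rw [Algebra.smul_def, map_mul, AlgEquiv.commutes]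
  obtain ⟨a, ha⟩ := key x hx2
  have h1 : (∑ m : M, (m : L ≃ₐ[K] L) x) = (Fintype.card M : ℕ) * x := by
    rw [Finset.sum_congr rfl (fun (m : M) _ => hx m.1 m.2)]
    simp
  rw [h1] at ha
  refine ⟨a / (Fintype.card M : ℕ), ?_⟩
  rw [map_div₀, ha, map_natCast]
  field_simp

end gal
end PC

namespace PC

/-- the unicritical polynomial -/
noncomputable def uf {k : Type*} [CommRing k] (d : ℕ) (c : k) : k[X] := X ^ d + C c

section uf
variable {k : Type*} [Field k] {d : ℕ} {c : k}

lemma uf_natDegree (hd : 2 ≤ d) : (uf d c).natDegree = d := by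
  unfold uf; exact natDegree_X_pow_add_C

lemma uf_monic (hd : 2 ≤ d) : (uf d c).Monic := by
  unfold uf; exact monic_X_pow_add_C c (by omega)

lemma uf_comp_monic (hd : 2 ≤ d) : ((uf d c).comp (uf d c)).Monic :=
  (uf_monic hd).comp (uf_monic hd) (by rw [uf_natDegree hd]; omega)

lemma uf_comp_natDegree (hd : 2 ≤ d) : ((uf d c).comp (uf d c)).natDegree = d * d := by
  rw [natDegree_comp, uf_natDegree hd]

lemma uf_derivative : derivative (uf d c) = C (d : k) * X ^ (d - 1) := by
  unfold uf; rw [derivative_add, derivative_X_pow, derivative_C, add_zero]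

lemma expand_of_inv {ζ : k} (hζ : IsPrimitiveRoot ζ d) (hd : 2 ≤ d) {P : k[X]}
    (hP : P.comp (C ζ * X) = P) : expand k d (contract d P) = P := by
  ext m
  rw [coeff_expand (by omega), coeff_contract (by omega)]
  split_ifs with h
  · rw [Nat.div_mul_cancel h]
  · have h1 := congrArg (fun Q => Q.coeff m) hP
    simp only [comp_C_mul_X_coeff] at h1
    have h2 : ζ ^ m ≠ 1 := fun h3 => h ((hζ.pow_eq_one_iff_dvd m).1 h3)
    have h4 : P.coeff m * (ζ ^ m - 1) = 0 := by linear_combination h1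
    exact ((mul_eq_zero.1 h4).resolve_right (sub_ne_zero.2 h2)).symm
end uf

section dj
variable {k K L : Type*} [Field k] [IsAlgClosed k] [Field K] [Field L] [Algebra k[X] K]
  [IsFractionRing k[X] K]
  [Algebra K L] [Algebra k[X] L] [IsScalarTower k[X] K L] [Algebra k L] [IsScalarTower k k[X] L]
  [Algebra k K] [IsScalarTower k k[X] K] [IsScalarTower k K L] [FiniteDimensional K L]
  [IsGalois K L]
  {d : ℕ} {c : k} {G z : k[X]} {B : ℕ}

/-- common hypotheses -/
structure Hyp (d : ℕ) (c : k) (G z : k[X]) (B : ℕ) : Prop where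
  hd : 2 ≤ d
  hGm : G.Monic
  hG : 2 ≤ G.natDegree
  hG' : (derivative G).natDegree = G.natDegree - 1
  hz : 1 ≤ z.natDegree
  hα : (pil G z).eval c ≠ 0
  hB : ∀ m : ℕ, 0 < m → m ≤ B → (m : k) ≠ 0
  hdB : d ≤ B

lemma Hyp.hG0 (H : Hyp d c G z B) : derivative G ≠ 0 := by
  intro h
  have := H.hG'
  rw [h, natDegree_zero] at this
  have := H.hG
  omega

lemma Hyp.hd0 (H : Hyp d c G z B) : (d : k) ≠ 0 := H.hB d (by have := H.hd; omega) H.hdB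

variable (K) in
include K in
lemma Hyp.FW_deriv (H : Hyp d c G z B) {D : Derivation k L L} (hD : D (algebraMap k[X] L X) = 1)
    {m : ℤ} {x : L} (hx : FW k G z m x) : FW k G z (m - G.natDegree) (D x) :=
  hx.deriv hD H.hG H.hz (fun x hx => aeval_ne hx (by have := H.hz; omega) (algebraMap_inj K) H.hG0)

variable (K) in
include K in
lemma Hyp.step2 (H : Hyp d c G z B) {D : Derivation k L L} (hD : D (algebraMap k[X] L X) = 1)
    {y1 : L} (hy1 : aeval y1 (uf d c) = algebraMap k[X] L X) (n : ℕ) (hn : n ≤ B) (W : k[X])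
    (hW : W.natDegree ≤ n) (w : ℤ) (hFW : FW k G z w (aeval y1 W)) :
    ∃ R : k[X], W = R.comp (uf d c) := by
  have hd := H.hd
  have htr := transc_root K hy1
  have hy0 : y1 ≠ 0 := by
    rintro rfl
    exact htr isAlgebraic_zero
  induction n generalizing W w with
  | zero =>
    rw [natDegree_eq_zero.1 (Nat.le_zero.1 hW) |>.choose_spec.symm]
    exact ⟨C _, (C_comp).symm⟩
  | succ n ih =>
    by_cases h0 : derivative W = 0
    · rw [eq_C_of_deriv H.hB (hW.trans hn) h0]
      exact ⟨C _, (C_comp).symm⟩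
    obtain ⟨U, hU, hU0⟩ := exists_eq_pow_rootMultiplicity_mul_and_not_dvd (derivative W) h0 0
    set j := (derivative W).rootMultiplicity 0 with hj
    rw [C_0, sub_zero] at hU hU0
    have hUe : U.eval 0 ≠ 0 := by
      intro h; apply hU0
      rw [X_dvd_iff, coeff_zero_eq_eval_zero]; exact h
    obtain ⟨𝒱, hk, hv⟩ := exists_val htr 0
    have hvT := val_comp hk hv (uf d c)
    rw [hy1] at hvT
    have he : (uf d c).eval 0 = c := by simp [uf, show d ≠ 0 by omega]
    rw [he] at hvT
    have hDW := FW.mem_val hk hvT H.hGm H.hG H.hG0 H.hα (H.FW_deriv K hD hFW)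
    have hvU := val_aeval_of_eval_ne hk hv hUe
    rw [map_zero, sub_zero] at hv
    have hDy : 1 = (d : L) * y1 ^ (d - 1) * D y1 := by
      have := congrArg D hy1
      rw [Derivation.map_aeval, hD, uf_derivative] at this
      simpa using this.symm
    have hDW' : D (aeval y1 W) = aeval y1 (derivative W) * D y1 := by
      rw [Derivation.map_aeval, smul_eq_mul]
    have hWd : aeval y1 (derivative W) = (d : L) * y1 ^ (d - 1) * D (aeval y1 W) := by
      rw [hDW']; linear_combination (aeval y1 (derivative W)) * hDy
    have hkv : ∀ a : k, 𝒱.valuation (algebraMap k L a) ≤ 1 := fun a =>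
      (𝒱.valuation_le_one_iff _).2 (hk a)
    have hjd : d - 1 ≤ j := by
      by_contra hlt
      push Not at hlt
      have h1 : 𝒱.valuation (aeval y1 (derivative W)) = 𝒱.valuation y1 ^ j := by
        conv_lhs => rw [hU]
        rw [map_mul, map_mul, hvU, mul_one, map_pow, aeval_X, map_pow]
      have h2 : 𝒱.valuation (aeval y1 (derivative W)) ≤ 𝒱.valuation y1 ^ (d - 1) := by
        rw [hWd, map_mul, map_mul, map_pow]
        have h3 : 𝒱.valuation (d : L) ≤ 1 := by
          have := hkv (d : k); rwa [map_natCast] at this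
        calc _ ≤ 1 * 𝒱.valuation y1 ^ (d - 1) * 1 := by
              gcongr; exact (𝒱.valuation_le_one_iff _).2 hDW
          _ = _ := by rw [one_mul, mul_one]
      rw [h1] at h2
      have h3 : 𝒱.valuation y1 ^ (d - 1) < 𝒱.valuation y1 ^ j :=
        pow_lt_pow_right_of_lt_one₀ (by rw [Valuation.pos_iff]; exact hy0) hv hlt
      exact absurd h2 (not_le.2 h3)
    have hdk := H.hd0
    set W1 : k[X] := C (d : k)⁻¹ * (X ^ (j - (d - 1)) * U) with hW1
    have hWW : derivative W = C (d : k) * X ^ (d - 1) * W1 := by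
      rw [hW1, hU]
      have e1 : (X : k[X]) ^ j = X ^ (d - 1) * X ^ (j - (d - 1)) := by
        rw [← pow_add]; congr 1; omega
      have e2 : (C (d : k) : k[X]) * C (d : k)⁻¹ = 1 := by
        rw [← C_mul, mul_inv_cancel₀ hdk, C_1]
      rw [e1]
      linear_combination (-(X ^ (d - 1) * X ^ (j - (d - 1)) * U)) * e2
    have hW10 : W1 ≠ 0 := by
      intro h; rw [h, mul_zero] at hWW; exact h0 hWW
    have hdeg : (derivative W).natDegree = (d - 1) + W1.natDegree := by
      rw [hWW, natDegree_mul (mul_ne_zero (C_ne_zero.2 hdk) (pow_ne_zero _ X_ne_zero)) hW10,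
        natDegree_C_mul hdk, natDegree_X_pow]
    have hdegW := natDegree_derivative_le W
    have hval : D (aeval y1 W) = aeval y1 W1 := by
      rw [hDW', hWW, map_mul, map_mul, map_pow, aeval_X, aeval_C, map_natCast]
      linear_combination (-(aeval y1 W1)) * hDy
    obtain ⟨R1, hR1⟩ := ih (by omega) W1 (by omega) _ (hval ▸ H.FW_deriv K hD hFW)
    have hdR : W1.natDegree = R1.natDegree * d := by
      rw [hR1, natDegree_comp, uf_natDegree hd]
    have hRle : R1.natDegree ≤ R1.natDegree * d := Nat.le_mul_of_pos_right _ (by omega)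
    obtain ⟨R, hR, hRd⟩ := exists_integral H.hB (Q := R1) (by omega)
    have h3 : derivative (W - R.comp (uf d c)) = 0 := by
      rw [derivative_sub, derivative_comp, hR, uf_derivative, ← hR1, hWW, sub_self]
    have h4 : (W - R.comp (uf d c)).natDegree ≤ B := by
      refine (natDegree_sub_le _ _).trans (max_le (by omega) ?_)
      rw [natDegree_comp, uf_natDegree hd]
      have : R.natDegree * d ≤ (R1.natDegree + 1) * d := Nat.mul_le_mul_right _ hRd
      rw [add_mul] at this
      omega
    have h5 := eq_C_of_deriv H.hB h4 h3
    refine ⟨R + C ((W - R.comp (uf d c)).coeff 0), ?_⟩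
    rw [add_comp, C_comp, ← h5]; ring

lemma Hyp.step1 (H : Hyp d c G z B) {D : Derivation k L L} (hD : D (algebraMap k[X] L X) = 1)
    {Y : L} (hY : aeval Y ((uf d c).comp (uf d c)) = algebraMap k[X] L X) (P : k[X])
    (hP : P.natDegree ≤ B) (w : ℤ) (hFW : FW k G z w (aeval Y P)) (K : Type*) [Field K]
    [Algebra k[X] K] [IsFractionRing k[X] K]
    [Algebra K L] [IsScalarTower k[X] K L]
    [Algebra k K] [IsScalarTower k k[X] K] [IsScalarTower k K L] [FiniteDimensional K L]
    [IsGalois K L] :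
    ∃ R : k[X], aeval Y P = algebraMap k[X] L R := by
  have hd := H.hd
  have hdk := H.hd0
  haveI : NeZero (d : k) := ⟨hdk⟩
  obtain ⟨ζ, hζ⟩ := HasEnoughRootsOfUnity.exists_primitiveRoot k d
  have hζd : ζ ^ d = 1 := hζ.pow_eq_one
  set y1 : L := aeval Y (uf d c) with hy1d
  have hy1 : aeval y1 (uf d c) = algebraMap k[X] L X := by rw [hy1d, ← aeval_comp, hY]
  have hy1' : y1 = Y ^ d + algebraMap k L c := by rw [hy1d]; simp [uf]
  -- invariant polynomials
  have hinv : ∀ P : k[X], P.natDegree ≤ B → P.comp (C ζ * X) = P → ∀ w, FW k G z w (aeval Y P) →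
      ∃ R : k[X], aeval Y P = algebraMap k[X] L R ∧ P.natDegree = d * (R.natDegree * d) := by
    intro P hP hPi w hw
    have h1 := expand_of_inv hζ hd hPi
    set S := contract d P with hS
    have h2 : aeval Y P = aeval y1 (S.comp (X - C c)) := by
      rw [← h1, aeval_comp, expand_aeval, hy1']; simp
    have h3 : P.natDegree = S.natDegree * d := by rw [← h1, natDegree_expand]
    have h4 : (S.comp (X - C c)).natDegree = S.natDegree := by rw [natDegree_comp]; simp
    obtain ⟨R, hR⟩ := H.step2 K hD hy1 B le_rfl (S.comp (X - C c))
      (by rw [h4]; exact (Nat.le_mul_of_pos_right _ (by omega)).trans (h3 ▸ hP)) w (h2 ▸ hw)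
    refine ⟨R, ?_, ?_⟩
    · rw [h2, hR, aeval_comp, hy1, ← algebraMap_eq_aeval]
    · rw [h3, ← h4, hR, natDegree_comp, uf_natDegree hd]; ring
  -- galois elements
  have hτ : ∀ j : ℕ, ∃ τ : L ≃ₐ[K] L, τ Y = algebraMap k L (ζ ^ j) * Y := by
    intro j
    refine exists_conj (uf_comp_monic hd) (by rw [uf_comp_natDegree hd]; positivity) hY ?_
    rw [aeval_comp]
    have : aeval (algebraMap k L (ζ ^ j) * Y) (uf d c) = y1 := by
      rw [hy1']
      simp only [uf, map_add, map_pow, aeval_X, aeval_C]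
      rw [mul_pow, ← pow_mul, mul_comm j, pow_mul, ← map_pow (algebraMap k L), hζd, map_one, one_pow,
        one_mul]
    rw [this, hy1]
  choose τ hτ using hτ
  let Pi : ℕ → k[X] := fun i =>
    ∑ j ∈ Finset.range d, C (ζ ^ (j * (d - i))) * P.comp (C (ζ ^ j) * X)
  have hcoef : ∀ i m, (Pi i).coeff m = P.coeff m * ∑ j ∈ Finset.range d, (ζ ^ (m + (d - i))) ^ j := by
    intro i m
    simp only [Pi, finsetSum_coeff, coeff_C_mul, comp_C_mul_X_coeff, Finset.mul_sum]
    refine Finset.sum_congr rfl fun j _ => ?_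
    rw [← pow_mul, ← pow_mul]
    rw [show (m + (d - i)) * j = j * (d - i) + j * m by ring, pow_add]; ring
  have hPiFW : ∀ i, FW k G z w (aeval Y (Pi i)) := by
    intro i
    simp only [Pi, map_sum]
    refine FW.sum _ fun j _ => ?_
    rw [map_mul, aeval_C]
    refine FW.cmul _ ?_
    have : aeval Y (P.comp (C (ζ ^ j) * X)) = τ j (aeval Y P) := by
      rw [aeval_gal, hτ, aeval_comp]; simp
    rw [this]
    exact FW.map (θ := (τ j : L →+* L)) (fun a => gal_k (τ j) a) (gal_poly (τ j) X) hFW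
  have hPideg : ∀ i, (Pi i).natDegree ≤ P.natDegree := by
    intro i
    rw [natDegree_le_iff_coeff_eq_zero]
    intro m hm
    rw [hcoef, coeff_eq_zero_of_natDegree_lt hm, zero_mul]
  have hPi0 : ∀ i, 0 < i → i < d → Pi i = 0 := by
    intro i hi0 hid
    by_contra hne
    have hzero : ∀ m, ζ ^ (m + (d - i)) ≠ 1 → (Pi i).coeff m = 0 := by
      intro m hm
      rw [hcoef]
      have h1 := geom_sum_mul (ζ ^ (m + (d - i))) d
      have h1' : (ζ ^ (m + (d - i))) ^ d = 1 := by
        rw [← pow_mul, mul_comm, pow_mul, hζd, one_pow]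
      rw [h1', sub_self] at h1
      rw [(mul_eq_zero.1 h1).resolve_right (sub_ne_zero.2 hm), mul_zero]
    have hlead : ζ ^ ((Pi i).natDegree + (d - i)) = 1 := by
      by_contra h
      exact hne (leadingCoeff_eq_zero.1 (hzero _ h))
    have hinvd : ((Pi i) ^ d).comp (C ζ * X) = (Pi i) ^ d := by
      have h1 : (Pi i).comp (C ζ * X) = C (ζ ^ i) * Pi i := by
        ext m
        rw [comp_C_mul_X_coeff, coeff_C_mul]
        by_cases hm : ζ ^ (m + (d - i)) = 1
        · have : ζ ^ m = ζ ^ i := by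
            have h2 : ζ ^ i * ζ ^ (d - i) = 1 := by
              rw [← pow_add, show i + (d - i) = d by omega, hζd]
            rw [pow_add] at hm
            have h3 : ζ ^ (d - i) ≠ 0 := right_ne_zero_of_mul_eq_one h2
            exact mul_right_cancel₀ h3 (hm.trans h2.symm)
          rw [this]; ring
        · rw [hzero m hm]; ring
      rw [pow_comp, h1, mul_pow, ← C_pow, ← pow_mul, mul_comm i, pow_mul, hζd, one_pow, C_1, one_mul]
    -- use the power : direct via step2
    have h1 := expand_of_inv hζ hd hinvd
    set S := contract d ((Pi i) ^ d) with hS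
    have h2 : aeval Y (Pi i) ^ d = aeval y1 (S.comp (X - C c)) := by
      rw [← map_pow, ← h1, aeval_comp, expand_aeval, hy1']; simp
    have h3 : d * (Pi i).natDegree = S.natDegree * d := by
      rw [← natDegree_pow, ← h1, natDegree_expand]
    have h3' : (Pi i).natDegree = S.natDegree := by
      rw [mul_comm] at h3; exact Nat.eq_of_mul_eq_mul_right (by omega) h3
    have h4 : (S.comp (X - C c)).natDegree = S.natDegree := by rw [natDegree_comp]; simp
    obtain ⟨R, hR⟩ := H.step2 K hD hy1 B le_rfl (S.comp (X - C c))
      (by rw [h4, ← h3']; exact (hPideg i).trans hP) _ (h2 ▸ (hPiFW i).pow d)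
    have h5 : (Pi i).natDegree = R.natDegree * d := by
      rw [h3', ← h4, hR, natDegree_comp, uf_natDegree hd]
    have h6 := (hζ.pow_eq_one_iff_dvd _).1 hlead
    rw [h5] at h6
    have h7 : d ∣ d - i := (Nat.dvd_add_right (Dvd.intro_left _ rfl)).1 h6
    have := Nat.le_of_dvd (by omega) h7
    omega
  have hPinv : P.comp (C ζ * X) = P := by
    ext m
    rw [comp_C_mul_X_coeff]
    by_cases hm : m % d = 0
    · obtain ⟨q, rfl⟩ := Nat.dvd_of_mod_eq_zero hm
      rw [pow_mul, hζd, one_pow, mul_one]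
    · have hlt := Nat.mod_lt m (show 0 < d by omega)
      have h1 := hcoef (m % d) m
      rw [hPi0 _ (by omega) hlt, coeff_zero] at h1
      have h2 : ζ ^ (m + (d - m % d)) = 1 := by
        rw [hζ.pow_eq_one_iff_dvd]
        have := Nat.div_add_mod m d
        refine ⟨m / d + 1, ?_⟩
        rw [mul_add, mul_one]; omega
      rw [h2] at h1
      simp only [one_pow, Finset.sum_const, Finset.card_range, nsmul_eq_mul, mul_one] at h1
      rw [(mul_eq_zero.1 h1.symm).resolve_right hdk, zero_mul]
  obtain ⟨R, hR, -⟩ := hinv P hP hPinv w hFW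
  exact ⟨R, hR⟩

end dj
end PC

namespace PC

section good
variable {k L : Type*} [Field k] [IsAlgClosed k] [Field L] [Algebra k L]

/-- regular elements with regular derivative -/
def goodRing (𝒱 : ValuationSubring L) (D : Derivation k L L) : Subring L where
  carrier := {u | u ∈ 𝒱 ∧ D u ∈ 𝒱}
  mul_mem' := fun {a b} ha hb => ⟨mul_mem ha.1 hb.1, by
    rw [Derivation.leibniz, smul_eq_mul, smul_eq_mul]
    exact add_mem (mul_mem ha.1 hb.2) (mul_mem hb.1 ha.2)⟩
  one_mem' := ⟨one_mem _, by rw [Derivation.map_one_eq_zero]; exact zero_mem _⟩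
  add_mem' := fun {a b} ha hb => ⟨add_mem ha.1 hb.1, by
    rw [map_add]; exact add_mem ha.2 hb.2⟩
  zero_mem' := ⟨zero_mem _, by rw [map_zero]; exact zero_mem _⟩
  neg_mem' := fun {a} ha => ⟨neg_mem ha.1, by rw [map_neg]; exact neg_mem ha.2⟩

lemma good_inv {𝒱 : ValuationSubring L} {D : Derivation k L L} {u : L} (hu : u ∈ goodRing 𝒱 D)
    (hv : 𝒱.valuation u = 1) : u⁻¹ ∈ goodRing 𝒱 D := by
  refine ⟨inv_mem_of_val hv, ?_⟩
  rw [Derivation.leibniz_inv, smul_eq_mul]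
  exact mul_mem (neg_mem (pow_mem (inv_mem_of_val hv) 2)) hu.2

lemma good_const {𝒱 : ValuationSubring L} {D : Derivation k L L}
    (hk : ∀ a : k, algebraMap k L a ∈ 𝒱) (a : k) : algebraMap k L a ∈ goodRing 𝒱 D :=
  ⟨hk a, by rw [Derivation.map_algebraMap]; exact zero_mem _⟩

lemma good_aeval {𝒱 : ValuationSubring L} {D : Derivation k L L}
    (hk : ∀ a : k, algebraMap k L a ∈ 𝒱) {x : L} (hx : x ∈ goodRing 𝒱 D) (P : k[X]) :
    aeval x P ∈ goodRing 𝒱 D := by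
  rw [aeval_eq_sum_range]
  refine sum_mem fun i _ => ?_
  rw [Algebra.smul_def]
  exact mul_mem (good_const hk _) (pow_mem hx _)

/-- differences of distinct roots are units -/
lemma val_root_sub {𝒱 : ValuationSubring L} (hk : ∀ a : k, algebraMap k L a ∈ 𝒱) {F : k[X]}
    {a b : L} (ha : a ∈ 𝒱) (hb : b ∈ 𝒱) (hab : a ≠ b) (hF : aeval a F = aeval b F)
    (hv : 𝒱.valuation (aeval b (derivative F)) = 1) : 𝒱.valuation (a - b) = 1 := by
  let φ : k →+* 𝒱 := (algebraMap k L).codRestrict 𝒱.toSubring hk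
  have hsub : ∀ (x : 𝒱) (P : k[X]), (((P.map φ).eval x : 𝒱) : L) = aeval (x : L) P := by
    intro x P
    rw [eval_map, aeval_def]
    exact hom_eval₂ P φ 𝒱.subtype x
  let a' : 𝒱 := ⟨a, ha⟩
  let b' : 𝒱 := ⟨b, hb⟩
  obtain ⟨r, hr⟩ := Polynomial.binomExpansion (F.map φ) b' (a' - b')
  have h1 := congrArg (fun u : 𝒱 => (u : L)) hr
  simp only [add_sub_cancel, derivative_map] at h1
  push_cast at h1
  rw [hsub, hsub, hsub] at h1
  change aeval a F = aeval b F + aeval b (derivative F) * (a - b) + r * (a - b) ^ 2 at h1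
  have h2 : (a - b) ≠ 0 := sub_ne_zero.2 hab
  have h3 : aeval b (derivative F) = (a - b) * (-(r : L)) := by
    apply mul_right_cancel₀ h2
    linear_combination -h1 + hF
  rw [h3] at hv
  exact unit_of_mul (sub_mem ha hb) (neg_mem r.2) hv

lemma coeff_prod_mem (S : Subring L) {ι : Type*} (s : Finset ι) {x : ι → L}
    (hx : ∀ i ∈ s, x i ∈ S) (j : ℕ) : (∏ i ∈ s, (X - C (x i))).coeff j ∈ S := by
  classical
  induction s using Finset.induction_on generalizing j with
  | empty =>
    simp only [Finset.prod_empty, coeff_one]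
    split_ifs
    · exact one_mem _
    · exact zero_mem _
  | insert a s ha ih =>
    have ih' := fun j => ih (fun i hi => hx i (Finset.mem_insert_of_mem hi)) j
    rw [Finset.prod_insert ha, sub_mul, coeff_sub, coeff_C_mul]
    refine sub_mem ?_ (mul_mem (hx _ (Finset.mem_insert_self _ _)) (ih' j))
    cases j with
    | zero => simp
    | succ j => rw [coeff_X_mul]; exact ih' j
end good

section dj
variable {k K L : Type*} [Field k] [IsAlgClosed k] [Field K] [Field L] [Algebra k[X] K]
  [IsFractionRing k[X] K]
  [Algebra K L] [Algebra k[X] L] [IsScalarTower k[X] K L] [Algebra k L] [IsScalarTower k k[X] L]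
  [Algebra k K] [IsScalarTower k k[X] K] [IsScalarTower k K L] [FiniteDimensional K L]
  [IsGalois K L]
  {d : ℕ} {c : k} {G z : k[X]} {B : ℕ}

lemma FW.gal (g : L ≃ₐ[K] L) {w : ℤ} {x : L} (hx : FW k G z w x) : FW k G z w (g x) :=
  FW.map (θ := (g : L →+* L)) (fun a => gal_k g a) (gal_poly g X) hx

lemma FW.gal_fixed (g : L ≃ₐ[K] L) (hg : ∀ v ∈ Vs L G z, g v = v) {w : ℤ} {x : L}
    (hx : FW k G z w x) : g x = x :=
  FW.fixed (θ := (g : L →+* L)) (fun a => gal_k g a) (gal_poly g X) hg hx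

open scoped Pointwise in
lemma Hyp.pow_FW (H : Hyp d c G z B) (n : ℕ) {s : L} (hs : s ∈ (insert 1 (Vs L G z)) ^ n) :
    FW k G z ((n * z.natDegree : ℕ) : ℤ) s ∧ IsIntegral k[X] s := by
  induction n generalizing s with
  | zero =>
    rw [pow_zero, Set.mem_one] at hs
    subst hs
    exact ⟨by simpa using FW.one, isIntegral_one⟩
  | succ n ih =>
    rw [pow_succ, Set.mem_mul] at hs
    obtain ⟨a, ha, b, hb, rfl⟩ := hs
    obtain ⟨h1, h2⟩ := ih ha
    have h3 : FW k G z z.natDegree b ∧ IsIntegral k[X] b := by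
      rcases hb with rfl | hb
      · exact ⟨FW.one.mono (by positivity), isIntegral_one⟩
      · exact ⟨FW.root hb, Vs_integral H.hGm hb (by have := H.hG; omega)⟩
    exact ⟨(h1.mul h3.1).mono (by push_cast; ring_nf; exact le_rfl), h2.mul h3.2⟩

variable (K) in
include K in
lemma Hyp.deg_T (H : Hyp d c G z B) {P : k[X]} (hP : P ≠ 0) {m : ℤ}
    (h : FW k G z m (algebraMap k[X] L P)) : (P.natDegree * G.natDegree : ℤ) ≤ m := by
  obtain ⟨𝒱, hk, hT⟩ := exists_val_infty k K L
  have h1 := FW.val hk hT H.hG H.hz H.hG' h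
  rw [algebraMap_eq_aeval, val_aeval_eq hk hT hP, ← pow_mul, ← zpow_natCast,
    zpow_le_zpow_iff_right₀ hT] at h1
  exact_mod_cast h1

variable (K) in
include K in
lemma Hyp.deg_Y (H : Hyp d c G z B) {Y : L}
    (hY : aeval Y ((uf d c).comp (uf d c)) = algebraMap k[X] L X) {P : k[X]} (hP : P ≠ 0) {m : ℕ}
    (h : FW k G z m (aeval Y P)) : P.natDegree ≤ d * d * m := by
  obtain ⟨𝒱, hk, hT⟩ := exists_val_infty k K L
  have h1 := FW.val hk hT H.hG H.hz H.hG' h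
  obtain ⟨h2, h3⟩ := Vs.val_infty (G := (uf d c).comp (uf d c)) (z := X) hk hT hY
    (uf_comp_monic H.hd).ne_zero (by simp)
  rw [natDegree_X, pow_one, uf_comp_natDegree H.hd] at h3
  rw [val_aeval_eq hk h2 hP, ← h3, zpow_natCast, ← pow_mul, ← pow_mul,
    pow_le_pow_iff_right₀ h2] at h1
  exact (Nat.le_mul_of_pos_right _ (by have := H.hG; omega)).trans h1

lemma card_le_finrank (M : Subgroup (L ≃ₐ[K] L)) [Fintype M] :
    Fintype.card M ≤ Module.finrank K L := by
  rw [← IsGalois.card_aut_eq_finrank K L, Nat.card_eq_fintype_card]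
  exact Fintype.card_le_of_injective _ Subtype.val_injective

lemma Hyp.claimB (H : Hyp d c G z B) {D : Derivation k L L} (hD : D (algebraMap k[X] L X) = 1)
    {Y : L} (hY : aeval Y ((uf d c).comp (uf d c)) = algebraMap k[X] L X)
    (hB1 : d * d * (Module.finrank K L * z.natDegree) ≤ B) (hB2 : Module.finrank K L ≤ B) {x : L}
    (h2 : ∀ g : L ≃ₐ[K] L, (∀ v ∈ Vs L G z, g v = v) → g x = x)
    (h1 : ∀ g : L ≃ₐ[K] L, g Y = Y → g x = x) : ∃ a : K, algebraMap K L a = x := by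
  classical
  let M : Subgroup (L ≃ₐ[K] L) :=
    fixingSubgroup (L ≃ₐ[K] L) (Vs L G z) ⊔ MulAction.stabilizer (L ≃ₐ[K] L) Y
  have hM1 : ∀ g : L ≃ₐ[K] L, (∀ v ∈ Vs L G z, g v = v) → g ∈ M := fun g hg =>
    (le_sup_left : _ ≤ M) ((mem_fixingSubgroup_iff _).2 hg)
  have hM2 : ∀ g : L ≃ₐ[K] L, g Y = Y → g ∈ M := fun g hg =>
    (le_sup_right : _ ≤ M) (MulAction.mem_stabilizer_iff.2 hg)
  have hMx : M ≤ MulAction.stabilizer (L ≃ₐ[K] L) x := by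
    refine sup_le ?_ ?_
    · intro g hg
      exact MulAction.mem_stabilizer_iff.2 (h2 g ((mem_fixingSubgroup_iff _).1 hg))
    · intro g hg
      exact MulAction.mem_stabilizer_iff.2 (h1 g (MulAction.mem_stabilizer_iff.1 hg))
  refine fixed_in_base (Vs L G z) M hM1 ?_ ?_ (fun g hg => MulAction.mem_stabilizer_iff.1 (hMx hg))
  · rw [← map_natCast (algebraMap k L), Ne, FaithfulSMul.algebraMap_eq_zero_iff]
    exact H.hB _ Fintype.card_pos ((card_le_finrank M).trans hB2)
  · intro s hs
    obtain ⟨hs1, hs2⟩ := H.pow_FW _ hs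
    have hFW : FW k G z ((Module.finrank K L * z.natDegree : ℕ) : ℤ)
        (∑ m : M, (m : L ≃ₐ[K] L) s) := FW.sum _ fun m _ => hs1.gal m.1
    have hIntg : IsIntegral k[X] (∑ m : M, (m : L ≃ₐ[K] L) s) :=
      IsIntegral.sum _ fun m _ => integral_gal m.1 hs2
    obtain ⟨P, hP⟩ := fixed_poly (uf_comp_monic H.hd)
      (by rw [uf_comp_natDegree H.hd]; have := H.hd; positivity) hY hIntg
      (fun σ hσ => tr_fixed M s (hM2 σ hσ))
    rw [← hP] at hFW ⊢
    by_cases hP0 : P = 0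
    · exact ⟨0, by rw [hP0]; simp⟩
    obtain ⟨R, hR⟩ := H.step1 hD hY P ((H.deg_Y K hY hP0 hFW).trans hB1) _ hFW K
    exact ⟨algebraMap k[X] K R, by rw [hR, ← IsScalarTower.algebraMap_apply]⟩

lemma Hyp.trace_dual (H : Hyp d c G z B) {D : Derivation k L L}
    (hD : D (algebraMap k[X] L X) = 1)
    {Y : L} (hY : aeval Y ((uf d c).comp (uf d c)) = algebraMap k[X] L X)
    (hB2 : Module.finrank K L ≤ B) {F : k[X]} (hFm : F.Monic) (hF1 : 0 < F.natDegree)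
    (hF0 : derivative F ≠ 0)
    {𝒱 : ValuationSubring L} (hk : ∀ a : k, algebraMap k L a ∈ 𝒱) {y0 : k}
    (hy : 𝒱.valuation (Y - algebraMap k L y0) < 1)
    (hd0 : (derivative ((uf d c).comp (uf d c))).eval y0 ≠ 0)
    (hF : (pil F X).eval y0 ≠ 0) {h : L} (hi : IsIntegral k[X] h)
    (hfix : ∀ g : L ≃ₐ[K] L, g Y = Y → (∀ v, aeval v F = Y → g v = v) → g h = h) :
    D h ∈ 𝒱 := by
  classical
  set f2 := (uf d c).comp (uf d c) with hf2
  have hf2m : f2.Monic := uf_comp_monic H.hd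
  have hf2d : 0 < f2.natDegree := by
    rw [hf2, uf_comp_natDegree H.hd]; have := H.hd; positivity
  have hY𝒱 := mem_of_val_sub hk hy
  have hT : algebraMap k[X] L X ∈ 𝒱 := by rw [← hY]; exact mem_val_aeval hk hY𝒱 f2
  have hu := val_aeval_of_eval_ne hk hy hd0
  let DY : Derivation k L L := aeval Y (derivative f2) • D
  have hDY : DY Y = 1 := by
    have := congrArg D hY
    rw [Derivation.map_aeval, hD] at this
    simpa [DY] using this
  have hV1int : ∀ v, aeval v F = Y → IsIntegral k[X] v := by
    intro v hv
    refine Vs_integral (A := f2.comp F) (b := X) (hf2m.comp hFm (by omega)) ?_ ?_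
    · change aeval v (f2.comp F) = _
      rw [aeval_comp, hv, hY]
    · rw [natDegree_comp]; positivity
  have hV1𝒱 : ∀ v, aeval v F = Y → v ∈ 𝒱 := fun v hv => mem_val_integral hk hT (hV1int v hv)
  have hV1' : ∀ v, aeval v F = Y → 𝒱.valuation (aeval v (derivative F)) = 1 := by
    intro v hv
    obtain ⟨Q, hQ⟩ := pil_eq' hF0
    have h1 := val_aeval_of_eval_ne hk hy hF
    rw [← hv, ← aeval_comp, hQ, map_mul] at h1
    exact unit_of_mul (mem_val_aeval hk (hV1𝒱 v hv) _) (mem_val_aeval hk (hV1𝒱 v hv) _) h1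
  have hYg : Y ∈ goodRing 𝒱 DY := ⟨hY𝒱, by rw [hDY]; exact one_mem _⟩
  have hV1g : ∀ v, aeval v F = Y → v ∈ goodRing 𝒱 DY := by
    intro v hv
    refine ⟨hV1𝒱 v hv, ?_⟩
    have h1 := congrArg DY hv
    rw [Derivation.map_aeval, hDY, smul_eq_mul] at h1
    have h2 : DY v = (aeval v (derivative F))⁻¹ := eq_inv_of_mul_eq_one_right h1
    rw [h2]
    exact inv_mem_of_val (hV1' v hv)
  let ΓY := MulAction.stabilizer (L ≃ₐ[K] L) Y
  have key : ∀ (a x : (L ≃ₐ[K] L) → L) (s : Finset (L ≃ₐ[K] L)),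
      (∀ σ ∈ s, aeval (a σ) F = Y ∧ aeval (x σ) F = Y) → ∀ b : L, IsIntegral k[X] b →
      ∑ g : ΓY, (∏ σ ∈ s, (a σ - (g : L ≃ₐ[K] L) (x σ))) * (g : L ≃ₐ[K] L) b ∈ goodRing 𝒱 DY := by
    intro a x s
    induction s using Finset.induction_on with
    | empty =>
      intro _ b hb
      simp only [Finset.prod_empty, one_mul]
      have hIntg : IsIntegral k[X] (∑ g : ΓY, (g : L ≃ₐ[K] L) b) :=
        IsIntegral.sum _ fun m _ => integral_gal m.1 hb
      obtain ⟨P, hP⟩ := fixed_poly hf2m hf2d hY hIntg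
        (fun σ hσ => tr_fixed ΓY b (MulAction.mem_stabilizer_iff.2 hσ))
      rw [← hP]
      exact good_aeval hk hYg P
    | insert τ s hτ ih =>
      intro hs b hb
      have ih' := ih (fun σ hσ => hs σ (Finset.mem_insert_of_mem hσ))
      obtain ⟨h1, h2⟩ := hs τ (Finset.mem_insert_self _ _)
      have e : ∑ g : ΓY, (∏ σ ∈ insert τ s, (a σ - (g : L ≃ₐ[K] L) (x σ))) * (g : L ≃ₐ[K] L) b =
          a τ * (∑ g : ΓY, (∏ σ ∈ s, (a σ - (g : L ≃ₐ[K] L) (x σ))) * (g : L ≃ₐ[K] L) b) -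
          ∑ g : ΓY, (∏ σ ∈ s, (a σ - (g : L ≃ₐ[K] L) (x σ))) * (g : L ≃ₐ[K] L) (x τ * b) := by
        rw [Finset.mul_sum, ← Finset.sum_sub_distrib]
        refine Finset.sum_congr rfl fun g _ => ?_
        rw [Finset.prod_insert hτ, map_mul]; ring
      rw [e]
      exact sub_mem (mul_mem (hV1g _ h1) (ih' b hb)) (ih' _ ((hV1int _ h2).mul hb))
  let s : Finset (L ≃ₐ[K] L) := Finset.univ.filter fun g => g Y = Y ∧ ∃ v, aeval v F = Y ∧ g v ≠ v
  have hex : ∀ σ : L ≃ₐ[K] L, ∃ v, σ ∈ s → aeval v F = Y ∧ σ v ≠ v := by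
    intro σ
    by_cases hσ : σ ∈ s
    · obtain ⟨-, v, hv⟩ := (Finset.mem_filter.1 hσ).2
      exact ⟨v, fun _ => hv⟩
    · exact ⟨0, fun h => absurd h hσ⟩
  choose x hx using hex
  have hgV : ∀ g : L ≃ₐ[K] L, g Y = Y → ∀ v, aeval v F = Y → aeval (g v) F = Y := by
    intro g hg v hv
    rw [← aeval_gal, hv, hg]
  have hsY : ∀ σ ∈ s, σ Y = Y := fun σ hσ => (Finset.mem_filter.1 hσ).2.1
  have h1 := key (fun σ => σ (x σ)) x s (fun σ hσ =>
    ⟨hgV σ (hsY σ hσ) _ (hx σ hσ).1, (hx σ hσ).1⟩) h hi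
  set κ := ∏ σ ∈ s, (σ (x σ) - x σ) with hκ
  have hsum : ∑ g : ΓY, (∏ σ ∈ s, (σ (x σ) - (g : L ≃ₐ[K] L) (x σ))) * (g : L ≃ₐ[K] L) h =
      ∑ g : ΓY, if (g : L ≃ₐ[K] L) ∈ s then 0 else κ * h := by
    refine Finset.sum_congr rfl fun g _ => ?_
    have hgY : (g : L ≃ₐ[K] L) Y = Y := MulAction.mem_stabilizer_iff.1 g.2
    split_ifs with hg
    · rw [Finset.prod_eq_zero hg (sub_self _), zero_mul]
    · have hgf : ∀ v, aeval v F = Y → (g : L ≃ₐ[K] L) v = v := by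
        intro v hv
        by_contra hne
        exact hg (Finset.mem_filter.2 ⟨Finset.mem_univ _, hgY, v, hv, hne⟩)
      rw [hfix g hgY hgf, hκ]
      congr 1
      refine Finset.prod_congr rfl fun σ hσ => ?_
      rw [hgf _ (hx σ hσ).1]
  rw [hsum, Finset.sum_ite, Finset.sum_const_zero, zero_add, Finset.sum_const, nsmul_eq_mul] at h1
  set N := (Finset.univ.filter fun g : ΓY => ¬ (g : L ≃ₐ[K] L) ∈ s).card with hN
  have hNpos : 0 < N := by
    refine Finset.card_pos.2 ⟨1, Finset.mem_filter.2 ⟨Finset.mem_univ _, ?_⟩⟩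
    intro h1
    obtain ⟨-, v, -, hv⟩ := (Finset.mem_filter.1 h1).2
    exact hv rfl
  have hNle : N ≤ B := (Finset.card_le_univ _).trans ((card_le_finrank ΓY).trans hB2)
  have hkv : ∀ a : k, 𝒱.valuation (algebraMap k L a) ≤ 1 := fun a =>
    (𝒱.valuation_le_one_iff _).2 (hk a)
  have hNv : 𝒱.valuation (N : L) = 1 := by
    rw [← map_natCast (algebraMap k L)]
    exact val_const hkv (H.hB N hNpos hNle)
  have hκv : 𝒱.valuation κ = 1 := by
    rw [hκ, map_prod]
    refine Finset.prod_eq_one fun σ hσ => ?_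
    have hv1 := (hx σ hσ).1
    have hv2 := hgV σ (hsY σ hσ) _ hv1
    exact val_root_sub hk (hV1𝒱 _ hv2) (hV1𝒱 _ hv1) (hx σ hσ).2 (hv2.trans hv1.symm) (hV1' _ hv1)
  have hκg : κ ∈ goodRing 𝒱 DY := prod_mem fun σ hσ =>
    sub_mem (hV1g _ (hgV σ (hsY σ hσ) _ (hx σ hσ).1)) (hV1g _ (hx σ hσ).1)
  have hNκ : 𝒱.valuation ((N : L) * κ) = 1 := by rw [map_mul, hNv, hκv, one_mul]
  have hne : (N : L) * κ ≠ 0 := by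
    intro h0; rw [h0, map_zero] at hNκ; exact zero_ne_one hNκ
  have hhg : h ∈ goodRing 𝒱 DY := by
    have e : h = ((N : L) * κ)⁻¹ * (N * (κ * h)) := by
      rw [← mul_assoc (N : L), inv_mul_cancel_left₀ hne]
    rw [e]
    exact mul_mem (good_inv (mul_mem (natCast_mem _ _) hκg) hNκ) h1
  have h2 : aeval Y (derivative f2) * D h ∈ 𝒱 := hhg.2
  have hne2 : aeval Y (derivative f2) ≠ 0 := by
    intro h0; rw [h0, map_zero] at hu; exact zero_ne_one hu
  rw [show D h = (aeval Y (derivative f2))⁻¹ * (aeval Y (derivative f2) * D h) by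
    rw [inv_mul_cancel_left₀ hne2]]
  exact mul_mem (inv_mem_of_val hu) h2

end dj
end PC

namespace PC

section dj
variable {k K L : Type*} [Field k] [IsAlgClosed k] [Field K] [Field L] [Algebra k[X] K]
  [IsFractionRing k[X] K]
  [Algebra K L] [Algebra k[X] L] [IsScalarTower k[X] K L] [Algebra k L] [IsScalarTower k k[X] L]
  [Algebra k K] [IsScalarTower k k[X] K] [IsScalarTower k K L] [FiniteDimensional K L]
  [IsGalois K L]
  {d : ℕ} {c : k} {G z : k[X]} {B : ℕ}

/-- second package of hypotheses -/
structure Hyp2 (d : ℕ) (c : k) (G z : k[X]) (F : k[X]) : Prop where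
  hFm : F.Monic
  hF1 : 0 < F.natDegree
  hF0 : derivative F ≠ 0
  hβ : ∀ t0 : k, (pil G z).eval t0 = 0 → ∃ y0 : k, ((uf d c).comp (uf d c)).eval y0 = t0 ∧
    (derivative ((uf d c).comp (uf d c))).eval y0 ≠ 0 ∧ (pil F X).eval y0 ≠ 0

lemma Hyp.claimC (H : Hyp d c G z B) {F : k[X]} (H2 : Hyp2 d c G z F) {D : Derivation k L L}
    (hD : D (algebraMap k[X] L X) = 1)
    {Y : L} (hY : aeval Y ((uf d c).comp (uf d c)) = algebraMap k[X] L X)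
    (hB1 : d * d * (Module.finrank K L * z.natDegree) ≤ B) (hB2 : Module.finrank K L ≤ B)
    {h : L} (hi : IsIntegral k[X] h) {w : ℤ} (hw : FW k G z w h)
    (hfix : ∀ g : L ≃ₐ[K] L, g Y = Y → (∀ v, aeval v F = Y → g v = v) → g h = h) :
    IsIntegral k[X] (D h) := by
  classical
  let ΓY := MulAction.stabilizer (L ≃ₐ[K] L) Y
  have hΓ : ∀ g : ΓY, (g : L ≃ₐ[K] L) Y = Y := fun g => MulAction.mem_stabilizer_iff.1 g.2
  let p : L[X] := ∏ g : ΓY, (X - C ((g : L ≃ₐ[K] L) (D h)))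
  have hDw := H.FW_deriv K hD hw
  have hcomm : ∀ g : L ≃ₐ[K] L, g (D h) = D (g h) := fun g => (deriv_comm K D hD g h).symm
  have hFW : ∀ j, ∃ m, FW k G z m (p.coeff j) := by
    intro j
    refine ⟨_, FW.coeff_prod (Finset.univ : Finset ΓY) (abs_nonneg (w - (G.natDegree:ℤ))) (x := fun g : ΓY => (g : L ≃ₐ[K] L) (D h)) (fun g _ => (hDw.gal (g : L ≃ₐ[K] L)).mono (le_abs_self _)) j⟩
  have hpfix : ∀ σ : L ≃ₐ[K] L, σ Y = Y → ∀ j, σ (p.coeff j) = p.coeff j := by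
    intro σ hσ j
    have h1 : p.map (σ : L →+* L) = p := by
      simp only [p]
      rw [Polynomial.map_prod]
      refine Fintype.prod_equiv (Equiv.mulLeft (⟨σ, MulAction.mem_stabilizer_iff.2 hσ⟩ : ΓY)) _ _
        fun g => ?_
      rw [Polynomial.map_sub, map_X, map_C]
      rfl
    conv_rhs => rw [← h1]
    rw [coeff_map]; rfl
  have hcoefK : ∀ j, ∃ P : k[X], algebraMap k[X] L P = p.coeff j := by
    intro j
    obtain ⟨m, hm⟩ := hFW j
    obtain ⟨a, ha⟩ := H.claimB hD hY hB1 hB2 (fun g hg => hm.gal_fixed g hg)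
      (fun g hg => hpfix g hg j)
    obtain ⟨P, hP⟩ := regular_poly (L := L) a (fun t0 => by
      rw [ha]
      by_cases hS : (pil G z).eval t0 = 0
      · obtain ⟨y0, hy1, hy2, hy3⟩ := H2.hβ t0 hS
        obtain ⟨𝒱, hk, hv⟩ := exists_val (transc_root K hY) y0
        refine ⟨𝒱, hk, ?_, ?_⟩
        · have := val_comp hk hv ((uf d c).comp (uf d c))
          rwa [hY, hy1] at this
        · refine coeff_prod_mem 𝒱.toSubring _ (fun g _ => ?_) j
          rw [hcomm]
          refine H.trace_dual hD hY hB2 H2.hFm H2.hF1 H2.hF0 hk hv hy2 hy3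
            (integral_gal (g : L ≃ₐ[K] L) hi) ?_
          intro σ hσ hσv
          have h1 := hfix ((g : L ≃ₐ[K] L)⁻¹ * σ * g) ?_ ?_
          · have h2 : (g : L ≃ₐ[K] L)⁻¹ (σ ((g : L ≃ₐ[K] L) h)) = h := h1
            have h3 := congrArg (g : L ≃ₐ[K] L) h2
            simpa using h3
          · change (g : L ≃ₐ[K] L)⁻¹ (σ ((g : L ≃ₐ[K] L) Y)) = Y
            have h4 : (g : L ≃ₐ[K] L)⁻¹ Y = Y := hΓ g⁻¹
            rw [hΓ g, hσ, h4]
          · intro v hv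
            change (g : L ≃ₐ[K] L)⁻¹ (σ ((g : L ≃ₐ[K] L) v)) = v
            rw [hσv _ (by rw [← aeval_gal, hv, hΓ g])]
            simp
      · obtain ⟨𝒱, hk, hv⟩ := exists_val (transc_T (k := k) K (L := L)) t0
        exact ⟨𝒱, hk, hv, hm.mem_val hk hv H.hGm H.hG H.hG0 hS⟩)
    exact ⟨P, by rw [IsScalarTower.algebraMap_apply k[X] K L, hP, ha]⟩
  have hlift : p ∈ lifts (algebraMap k[X] L) := by
    rw [lifts_iff_coeff_lifts]
    intro j
    obtain ⟨P, hP⟩ := hcoefK j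
    exact ⟨P, hP⟩
  have hpm : p.Monic := monic_prod_of_monic _ _ fun g _ => monic_X_sub_C _
  obtain ⟨q, hq1, -, hq2⟩ := lifts_and_natDegree_eq_and_monic hlift hpm
  refine ⟨q, hq2, ?_⟩
  rw [← eval_map, hq1]
  simp only [p]
  rw [eval_prod]
  exact Finset.prod_eq_zero (Finset.mem_univ (1 : ΓY)) (by simp)

/-- integral elements of negative weight vanish -/
lemma Hyp.neg_weight (H : Hyp d c G z B) {h : L} (hi : IsIntegral k[X] h) {w : ℤ} (hw : w < 0)
    (hFW : FW k G z w h) (K : Type*) [Field K]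
    [Algebra k[X] K] [IsFractionRing k[X] K]
    [Algebra K L] [IsScalarTower k[X] K L]
    [Algebra k K] [IsScalarTower k k[X] K] [IsScalarTower k K L] [FiniteDimensional K L]
    [IsGalois K L] : h = 0 := by
  obtain ⟨P, hP⟩ := fixed_integral K (h := ∏ g : L ≃ₐ[K] L, g h)
    (IsIntegral.prod _ fun g _ => integral_gal g hi) (fun σ => by
      rw [map_prod]
      exact Fintype.prod_equiv (Equiv.mulLeft σ) _ _ fun g => rfl)
  have h1 : FW k G z _ (∏ g : L ≃ₐ[K] L, g h) := FW.prod _ (fun g _ => hFW.gal g)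
  have hP0 : P = 0 := by
    by_contra hne
    rw [← hP] at h1
    have h2 := H.deg_T K hne h1
    have h3 : (0 : ℤ) < ((Finset.univ : Finset (L ≃ₐ[K] L)).card : ℤ) := by
      exact_mod_cast Finset.card_pos.2 ⟨1, Finset.mem_univ _⟩
    have h4 : (0 : ℤ) ≤ (P.natDegree * G.natDegree : ℤ) := by positivity
    nlinarith
  rw [hP0, map_zero, eq_comm, Finset.prod_eq_zero_iff] at hP
  obtain ⟨g, -, hg⟩ := hP
  exact (map_eq_zero_iff g g.injective).1 hg

/-- integral elements of zero derivative and small weight are constant -/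
lemma Hyp.const_of_deriv (H : Hyp d c G z B) {D : Derivation k L L}
    (hD : D (algebraMap k[X] L X) = 1) {h : L} (hi : IsIntegral k[X] h) {w : ℕ}
    (hFW : FW k G z (w * G.natDegree : ℕ) h) (hDh : D h = 0) (K : Type*) [Field K]
    [Algebra k[X] K] [IsFractionRing k[X] K]
    [Algebra K L] [IsScalarTower k[X] K L]
    [Algebra k K] [IsScalarTower k k[X] K] [IsScalarTower k K L] [FiniteDimensional K L]
    [IsGalois K L] (hB : Module.finrank K L * w ≤ B) : ∃ a : k, algebraMap k L a = h := by
  classical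
  let p : L[X] := ∏ g : L ≃ₐ[K] L, (X - C (g h))
  have hpm : p.Monic := monic_prod_of_monic _ _ fun g _ => monic_X_sub_C _
  have hpfix : ∀ (σ : L ≃ₐ[K] L) j, σ (p.coeff j) = p.coeff j := by
    intro σ j
    have h1 : p.map (σ : L →+* L) = p := by
      simp only [p]
      rw [Polynomial.map_prod]
      refine Fintype.prod_equiv (Equiv.mulLeft σ) _ _ fun g => ?_
      rw [Polynomial.map_sub, map_X, map_C]
      rfl
    conv_rhs => rw [← h1]
    rw [coeff_map]; rfl
  have hpi : ∀ j, IsIntegral k[X] (p.coeff j) := fun j =>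
    coeff_prod_mem (integralClosure k[X] L).toSubring _ (fun g _ => integral_gal g hi) j
  have hpD : ∀ j, D (p.coeff j) = 0 := by
    intro j
    let S : Subring L :=
      { carrier := {u | D u = 0}
        mul_mem' := fun {a b} ha hb => by
          have ha' : D a = 0 := ha
          have hb' : D b = 0 := hb
          change D (a * b) = 0
          rw [Derivation.leibniz, ha', hb']; simp
        one_mem' := D.map_one_eq_zero
        add_mem' := fun {a b} ha hb => by
          have ha' : D a = 0 := ha
          have hb' : D b = 0 := hb
          change D (a + b) = 0
          rw [map_add, ha', hb', add_zero]
        zero_mem' := map_zero D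
        neg_mem' := fun {a} ha => by
          have ha' : D a = 0 := ha
          change D (-a) = 0
          rw [map_neg, ha', neg_zero] }
    exact coeff_prod_mem S _ (fun g _ => by
      change D (g h) = 0
      rw [deriv_comm K D hD g h, hDh, map_zero]) j
  have hpc : ∀ j, ∃ a : k, algebraMap k L a = p.coeff j := by
    intro j
    obtain ⟨P, hP⟩ := fixed_integral K (hpi j) (fun g => hpfix g j)
    have h1 : FW k G z _ (p.coeff j) :=
      FW.coeff_prod _ (by positivity) (fun g _ => hFW.gal g) j
    by_cases hP0 : P = 0
    · exact ⟨0, by rw [← hP, hP0]; simp⟩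
    rw [← hP] at h1
    have h2 := H.deg_T K hP0 h1
    have h3 : ((Finset.univ : Finset (L ≃ₐ[K] L)).card) = Module.finrank K L := by
      rw [← IsGalois.card_aut_eq_finrank K L, Nat.card_eq_fintype_card]; rfl
    rw [h3] at h2
    have h4 : P.natDegree ≤ B := by
      refine le_trans ?_ hB
      have h5 : P.natDegree * G.natDegree ≤ (Module.finrank K L * w) * G.natDegree := by
        rw [mul_assoc]; exact_mod_cast h2
      exact Nat.le_of_mul_le_mul_right h5 (by have := H.hG; omega)
    have h5 : derivative P = 0 := by
      have h6 := hpD j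
      rw [← hP, algebraMap_eq_aeval, Derivation.map_aeval, hD, smul_eq_mul, mul_one,
        ← algebraMap_eq_aeval] at h6
      exact algebraMap_inj K (h6.trans (map_zero _).symm)
    refine ⟨P.coeff 0, ?_⟩
    rw [← hP, eq_C_of_deriv H.hB h4 h5, IsScalarTower.algebraMap_apply k k[X] L]
    simp
  have hlift : p ∈ lifts (algebraMap k L) := by
    rw [lifts_iff_coeff_lifts]
    intro j
    obtain ⟨a, ha⟩ := hpc j
    exact ⟨a, ha⟩
  obtain ⟨q, hq1, -, hq2⟩ := lifts_and_natDegree_eq_and_monic hlift hpm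
  have hIntg : IsIntegral k h := by
    refine ⟨q, hq2, ?_⟩
    rw [← eval_map, hq1]
    simp only [p]
    rw [eval_prod]
    exact Finset.prod_eq_zero (Finset.mem_univ (1 : L ≃ₐ[K] L)) (by simp)
  have := IsAlgClosed.algebraMap_bijective_of_isIntegral (k := k) (K := integralClosure k L)
  obtain ⟨a, ha⟩ := this.2 ⟨h, hIntg⟩
  exact ⟨a, congrArg Subtype.val ha⟩

theorem Hyp.disjoint (H : Hyp d c G z B) {F : k[X]} (H2 : Hyp2 d c G z F)
    {Y : L} (hY : aeval Y ((uf d c).comp (uf d c)) = algebraMap k[X] L X)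
    (hB1 : d * d * (Module.finrank K L * z.natDegree) ≤ B)
    (hB2 : Module.finrank K L * (Module.finrank K L * z.natDegree + 1) ≤ B) :
    fixingSubgroup (L ≃ₐ[K] L) {v : L | aeval v F = Y} ⊔
      fixingSubgroup (L ≃ₐ[K] L) (Vs L G z) = ⊤ := by
  classical
  obtain ⟨D, hD⟩ := exists_deriv k K L
  have hn : 0 < Module.finrank K L := Module.finrank_pos
  set n := Module.finrank K L with hnd
  set w := n * z.natDegree with hw
  have hw1 : w + 1 ≤ B := le_trans (Nat.le_mul_of_pos_left _ hn) hB2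
  have hnB : n ≤ B := le_trans (Nat.le_mul_of_pos_right _ (by omega)) hB2
  set M := fixingSubgroup (L ≃ₐ[K] L) {v : L | aeval v F = Y} ⊔
      fixingSubgroup (L ≃ₐ[K] L) (Vs L G z) with hM
  have hM1 : ∀ g : L ≃ₐ[K] L, (∀ v, aeval v F = Y → g v = v) → g ∈ M := fun g hg =>
    (le_sup_left : _ ≤ M) ((mem_fixingSubgroup_iff _).2 hg)
  have hM2 : ∀ g : L ≃ₐ[K] L, (∀ v ∈ Vs L G z, g v = v) → g ∈ M := fun g hg =>
    (le_sup_right : _ ≤ M) ((mem_fixingSubgroup_iff _).2 hg)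
  have hcard : ((Fintype.card M : ℕ) : L) ≠ 0 := by
    rw [← map_natCast (algebraMap k L), Ne, FaithfulSMul.algebraMap_eq_zero_iff]
    exact H.hB _ Fintype.card_pos ((card_le_finrank M).trans hnB)
  have hγ := H.hG
  have main : ∀ x : L, (∀ g ∈ M, g x = x) → ∃ a : K, algebraMap K L a = x := by
    intro x hx
    refine fixed_in_base (Vs L G z) M hM2 hcard ?_ hx
    intro s hs
    obtain ⟨hs1, hs2⟩ := H.pow_FW _ hs
    set h0 := ∑ m : M, (m : L ≃ₐ[K] L) s with hh0
    have hFW0 : FW k G z (w : ℤ) h0 := FW.sum _ fun m _ => hs1.gal m.1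
    have hIntg0 : IsIntegral k[X] h0 := IsIntegral.sum _ fun m _ => integral_gal m.1 hs2
    have hfix0 : ∀ g ∈ M, g h0 = h0 := fun g hg => tr_fixed M s hg
    have hiter : ∀ i : ℕ, IsIntegral k[X] (D^[i] h0) ∧
        FW k G z ((w : ℤ) - i * G.natDegree) (D^[i] h0) ∧ ∀ g ∈ M, g (D^[i] h0) = D^[i] h0 := by
      intro i
      induction i with
      | zero => exact ⟨hIntg0, by simpa using hFW0, hfix0⟩
      | succ i ih =>
        obtain ⟨h1, h2, h3⟩ := ih
        rw [Function.iterate_succ_apply']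
        refine ⟨H.claimC H2 hD hY hB1 hnB h1 h2 (fun g _ hg => h3 g (hM1 g hg)), ?_, ?_⟩
        · refine (H.FW_deriv K hD h2).mono ?_
          push_cast; ring_nf; exact le_rfl
        · intro g hg
          rw [← deriv_comm K D hD, h3 g hg]
    have hlast : D^[w + 1] h0 = 0 := by
      obtain ⟨h1, h2, -⟩ := hiter (w + 1)
      refine H.neg_weight h1 ?_ h2 K
      have : (w : ℤ) + 1 ≤ ((w + 1 : ℕ) : ℤ) * G.natDegree := by
        push_cast
        have h3 : (2 : ℤ) ≤ G.natDegree := by exact_mod_cast hγ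
        nlinarith
      omega
    have hback : ∀ j, j ≤ w + 1 → ∃ R : k[X], D^[w + 1 - j] h0 = algebraMap k[X] L R := by
      intro j
      induction j with
      | zero => intro _; exact ⟨0, by rw [Nat.sub_zero, hlast, map_zero]⟩
      | succ j ih =>
        intro hj
        obtain ⟨Q, hQ⟩ := ih (by omega)
        set i := w + 1 - (j + 1) with hi
        have hi1 : w + 1 - j = i + 1 := by omega
        rw [hi1] at hQ
        rw [Function.iterate_succ_apply'] at hQ
        obtain ⟨h1, h2, h3⟩ := hiter i
        set h := D^[i] h0 with hh
        have h2' : FW k G z ((w : ℕ) : ℤ) h := h2.mono (by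
          have : (0 : ℤ) ≤ (i : ℤ) * G.natDegree := by positivity
          omega)
        have hQd : Q.natDegree ≤ w := by
          by_cases hQ0 : Q = 0
          · rw [hQ0]; simp
          have h4 := H.FW_deriv K hD h2'
          rw [hQ] at h4
          have h5 := H.deg_T K hQ0 h4
          have h6 : (Q.natDegree : ℤ) * 1 ≤ Q.natDegree * G.natDegree := by
            gcongr; exact_mod_cast (by omega : 1 ≤ G.natDegree)
          have h7 : (0 : ℤ) ≤ G.natDegree := by positivity
          omega
        obtain ⟨R, hR, hRd⟩ := exists_integral H.hB (Q := Q) (by omega)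
        have h8 : D (h - algebraMap k[X] L R) = 0 := by
          rw [map_sub, hQ, algebraMap_eq_aeval (L := L) R, Derivation.map_aeval, hD, smul_eq_mul,
            mul_one, hR, ← algebraMap_eq_aeval, sub_self]
        have h9 : FW k G z ((w + 1) * G.natDegree : ℕ) (h - algebraMap k[X] L R) := by
          refine FW.sub (h2'.mono ?_) ((FW.poly R (n := w + 1) (by omega)).mono ?_)
          · have : w ≤ (w + 1) * G.natDegree := by nlinarith
            exact_mod_cast this
          · push_cast; exact le_rfl
        obtain ⟨a, ha⟩ := H.const_of_deriv hD (h1.sub isIntegral_algebraMap) h9 h8 K hB2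
        refine ⟨R + C a, ?_⟩
        rw [map_add]
        have : algebraMap k[X] L (C a) = algebraMap k L a := by
          rw [IsScalarTower.algebraMap_apply k k[X] L]; rfl
        rw [this, ha]; ring
    obtain ⟨R, hR⟩ := hback (w + 1) le_rfl
    rw [Nat.sub_self] at hR
    refine ⟨algebraMap k[X] K R, ?_⟩
    rw [← IsScalarTower.algebraMap_apply, ← hR]
    rfl
  have hbot : IntermediateField.fixedField M = ⊥ := by
    rw [eq_bot_iff]
    intro x hx
    rw [IntermediateField.mem_fixedField_iff] at hx
    obtain ⟨a, ha⟩ := main x hx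
    rw [IntermediateField.mem_bot]
    exact ⟨a, ha⟩
  have := IntermediateField.fixingSubgroup_fixedField M
  rw [hbot, IntermediateField.fixingSubgroup_bot] at this
  exact this.symm

end dj
end PC

namespace PC

open Classical in
/-- group theoretic independence -/
lemma indep {Γ : Type*} [Group Γ] [Fintype Γ] (N1 N2 : Subgroup Γ) [N2.Normal] (h : N1 ⊔ N2 = ⊤)
    (a b : Γ → Prop) (ha : ∀ γ, ∀ n ∈ N1, a (γ * n) ↔ a γ) (hb : ∀ γ, ∀ n ∈ N2, b (γ * n) ↔ b γ) :
    Fintype.card Γ * (Finset.univ.filter (fun γ => a γ ∧ b γ)).card =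
      (Finset.univ.filter a).card * (Finset.univ.filter b).card := by
  have key : ∀ g : Γ, (Finset.univ.filter (fun γ => a γ ∧ b (γ * g))).card =
      (Finset.univ.filter (fun γ => a γ ∧ b γ)).card := by
    intro g
    have hg : g ∈ N1 ⊔ N2 := h ▸ Subgroup.mem_top g
    rw [Subgroup.mem_sup_of_normal_right] at hg
    obtain ⟨n1, h1, n2, h2, rfl⟩ := hg
    refine Finset.card_bij' (fun γ _ => γ * n1) (fun γ _ => γ * n1⁻¹) ?_ ?_ ?_ ?_
    · intro γ hγ
      simp only [Finset.mem_filter, Finset.mem_univ, true_and] at hγ ⊢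
      rw [ha _ _ h1]
      rw [← mul_assoc, hb _ _ h2] at hγ
      exact hγ
    · intro γ hγ
      simp only [Finset.mem_filter, Finset.mem_univ, true_and] at hγ ⊢
      rw [ha _ _ (inv_mem h1), ← mul_assoc, hb _ _ h2, inv_mul_cancel_right]
      exact hγ
    · intro γ _; simp
    · intro γ _; simp
  have h1 : ∑ g : Γ, (Finset.univ.filter (fun γ => a γ ∧ b (γ * g))).card =
      Fintype.card Γ * (Finset.univ.filter (fun γ => a γ ∧ b γ)).card := by
    rw [Finset.sum_congr rfl (fun g _ => key g)]
    simp
  rw [← h1]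
  simp only [Finset.card_filter]
  rw [Finset.sum_comm, Finset.sum_mul]
  refine Finset.sum_congr rfl fun γ _ => ?_
  by_cases hγ : a γ
  · simp only [hγ, true_and, if_true, one_mul]
    exact Fintype.sum_equiv (Equiv.mulLeft γ) _ _ (fun g => rfl)
  · simp [hγ]

section sf
variable {k K L : Type*} [Field k] [IsAlgClosed k] [Field K] [Field L] [Algebra k[X] K]
  [IsFractionRing k[X] K]
  [Algebra K L] [Algebra k[X] L] [IsScalarTower k[X] K L] [Algebra k L] [IsScalarTower k k[X] L]
  [Algebra k K] [IsScalarTower k k[X] K] [IsScalarTower k K L]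
  {ι : Type*} [Fintype ι] {A b : ι → k[X]} {n : ℕ}

variable (K) in
/-- the polynomial defining one cover -/
noncomputable def covP (A b : k[X]) : K[X] := A.map (algebraMap k K) - C (algebraMap k[X] K b)

lemma covP_monic {A b : k[X]} (hA : A.Monic) (hd : 0 < A.natDegree) : (covP K A b).Monic := by
  apply Monic.sub_of_left (hA.map _)
  calc (C (algebraMap k[X] K b) : K[X]).degree ≤ 0 := degree_C_le
    _ < _ := by
      rw [degree_map, degree_eq_natDegree hA.ne_zero]; exact_mod_cast hd

lemma covP_natDegree {A b : k[X]} (hA : A.Monic) : (covP K A b).natDegree = A.natDegree := by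
  unfold covP
  rw [natDegree_sub_C, natDegree_map]

lemma covP_aeval {A b : k[X]} (x : L) :
    aeval x (covP K A b) = aeval x A - algebraMap k[X] L b := by
  unfold covP
  rw [map_sub, aeval_C, aeval_map_algebraMap, ← IsScalarTower.algebraMap_apply]

lemma covP_map {A b : k[X]} :
    (covP K A b).map (algebraMap K L) = A.map (algebraMap k L) - C (algebraMap k[X] L b) := by
  unfold covP
  rw [Polynomial.map_sub, map_C, Polynomial.map_map, ← IsScalarTower.algebraMap_eq,
    ← IsScalarTower.algebraMap_apply]

variable (K) in
/-- the product -/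
noncomputable def covPP (A b : ι → k[X]) : K[X] := ∏ i, covP K (A i) (b i)

lemma covPP_monic (hA : ∀ i, (A i).Monic) (hd : ∀ i, 0 < (A i).natDegree) :
    (covPP K A b).Monic := monic_prod_of_monic _ _ fun i _ => covP_monic (hA i) (hd i)

lemma covPP_natDegree (hA : ∀ i, (A i).Monic) (hd : ∀ i, 0 < (A i).natDegree)
    (hn : ∀ i, (A i).natDegree ≤ n) : (covPP K A b).natDegree ≤ Fintype.card ι * n := by
  unfold covPP
  refine (natDegree_prod_le _ _).trans ?_
  refine (Finset.sum_le_card_nsmul _ _ n fun i _ => ?_).trans (by simp)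
  rw [covP_natDegree (hA i)]; exact hn i

lemma mem_rootSet_covPP (hA : ∀ i, (A i).Monic) (hd : ∀ i, 0 < (A i).natDegree) (x : L) :
    x ∈ (covPP K A b).rootSet L ↔ x ∈ VV L A b := by
  rw [mem_rootSet_of_ne (covPP_monic hA hd).ne_zero]
  unfold covPP
  rw [map_prod, Finset.prod_eq_zero_iff]
  simp only [Finset.mem_univ, true_and, covP_aeval, sub_eq_zero]
  rfl

lemma Vs_separable {A b : k[X]} (hA : A.Monic) (hd : 0 < A.natDegree) (hb : 0 < b.natDegree)
    (hder : derivative A ≠ 0) {x : L} (hx : x ∈ Vs L A b) : IsSeparable K x := by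
  have hr : aeval x (covP K A b) = 0 := by rw [covP_aeval, sub_eq_zero]; exact hx
  have hIntg : IsIntegral K x := ⟨covP K A b, covP_monic hA hd, hr⟩
  unfold IsSeparable
  rw [separable_iff_derivative_ne_zero (minpoly.irreducible hIntg)]
  intro h0
  obtain ⟨R, hR⟩ := minpoly.dvd K x hr
  have h1 := congrArg (fun P => aeval x (derivative P)) hR
  simp only [derivative_mul, h0, zero_mul, zero_add, map_mul, minpoly.aeval] at h1
  unfold covP at h1
  rw [derivative_sub, derivative_C, sub_zero, derivative_map, aeval_map_algebraMap] at h1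
  exact aeval_ne hx hb (algebraMap_inj K) hder h1

lemma cov_galois [IsSplittingField K L (covPP K A b)] (hA : ∀ i, (A i).Monic)
    (hd : ∀ i, 0 < (A i).natDegree) (hb : ∀ i, 0 < (b i).natDegree)
    (hder : ∀ i, derivative (A i) ≠ 0) : IsGalois K L ∧
      IntermediateField.adjoin K (VV L A b) = ⊤ := by
  have hset : (covPP K A b).rootSet L = VV L A b := Set.ext fun x => mem_rootSet_covPP hA hd x
  have htop : IntermediateField.adjoin K (VV L A b) = ⊤ := by
    rw [← hset]
    have h := IsSplittingField.adjoin_rootSet L (covPP K A b)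
    rw [eq_top_iff]
    intro x _
    have : x ∈ Algebra.adjoin K ((covPP K A b).rootSet L) := h ▸ Algebra.mem_top
    exact IntermediateField.algebra_adjoin_le_adjoin K _ this
  refine ⟨?_, htop⟩
  have h1 : Algebra.IsSeparable K (IntermediateField.adjoin K (VV L A b)) := by
    rw [IntermediateField.isSeparable_adjoin_iff_isSeparable]
    rintro x ⟨i, hi⟩
    exact Vs_separable (hA i) (hd i) (hb i) (hder i) hi
  rw [htop] at h1
  have h2 : Algebra.IsSeparable K L := AlgEquiv.Algebra.isSeparable IntermediateField.topEquiv
  have h3 : Normal K L := Normal.of_isSplittingField (covPP K A b)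
  exact { }

lemma cov_setup [IsSplittingField K L (covPP K A b)] (hA : ∀ i, (A i).Monic)
    (hd : ∀ i, 0 < (A i).natDegree) (hb : ∀ i, 0 < (b i).natDegree)
    (hder : ∀ i, derivative (A i) ≠ 0) (hAn : ∀ i, (A i).natDegree ≤ n)
    (hbn : ∀ i, (b i).natDegree ≤ n) : Setup k K L A b n where
  monic := hA
  degA_pos := hd
  degA := hAn
  degb_pos := hb
  degb := hbn
  der := hder
  splits i := by
    have h := IsSplittingField.splits L (covPP K A b)
    rw [← covP_map (K := K)]
    refine h.of_dvd ?_ ?_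
    · exact ((covPP_monic hA hd).map _).ne_zero
    · exact Polynomial.map_dvd _ (Finset.dvd_prod_of_mem _ (Finset.mem_univ i))
  gen := (cov_galois hA hd hb hder).2

lemma cov_finrank [IsSplittingField K L (covPP K A b)] [FiniteDimensional K L] [IsGalois K L]
    (hA : ∀ i, (A i).Monic)
    (hd : ∀ i, 0 < (A i).natDegree) (hn : ∀ i, (A i).natDegree ≤ n) :
    Module.finrank K L ≤ (Fintype.card ι * n + 1) ^ (Fintype.card ι * n + 1) := by
  classical
  rw [← IsGalois.card_aut_eq_finrank]
  let R := (covPP K A b).rootSet L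
  have hst : ∀ (g : L ≃ₐ[K] L), ∀ x : R, g x ∈ R := by
    intro g x
    have hx := x.2
    have hne : covPP K A b ≠ 0 := (covPP_monic hA hd).ne_zero
    simp only [R] at hx ⊢
    rw [mem_rootSet_of_ne hne] at hx ⊢
    rw [aeval_algHom_apply, hx, map_zero]
  let φ : (L ≃ₐ[K] L) → (R → R) := fun g x => ⟨g x, hst g x⟩
  have hφ : Function.Injective φ := by
    intro g h hgh
    have : (g : L →ₐ[K] L) = h := by
      refine AlgHom.ext_of_adjoin_eq_top (IsSplittingField.adjoin_rootSet L (covPP K A b)) ?_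
      intro x hx
      exact congrArg Subtype.val (congrFun hgh ⟨x, hx⟩)
    ext x
    exact DFunLike.congr_fun this x
  have h1 := Nat.card_le_card_of_injective φ hφ
  have hR : Nat.card R ≤ Fintype.card ι * n + 1 := by
    have := ncard_rootSet_le (covPP K A b) L
    have h2 := covPP_natDegree (K := K) (b := b) hA hd hn
    have h3 : Nat.card R = ((covPP K A b).rootSet L).ncard := rfl
    omega
  rw [Nat.card_fun] at h1
  refine h1.trans ?_
  exact (Nat.pow_le_pow_left hR _).trans (Nat.pow_le_pow_right (by omega) hR)

lemma exists_theta [IsSplittingField K L (covPP K A b)] {p f : ℕ} [Fact p.Prime] [CharP k p]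
    (hA : ∀ i j, (A i).coeff j ^ p ^ f = (A i).coeff j)
    (hb : ∀ i j, (b i).coeff j ^ p ^ f = (b i).coeff j) :
    ∃ θ0 : L →+* L, θ0 (algebraMap k[X] L X) = algebraMap k[X] L X ∧
    (∀ a : k, θ0 (algebraMap k L a) = algebraMap k L (a ^ p ^ f)) ∧
    (∀ i, ∀ x ∈ Vs L (A i) (b i), θ0 x ∈ Vs L (A i) (b i)) := by
  let φ : k →+* k := iterateFrobenius k p f
  have hφ : ∀ a, φ a = a ^ p ^ f := fun a => iterateFrobenius_def ..
  have hmap : ∀ P : k[X], (∀ j, P.coeff j ^ p ^ f = P.coeff j) → P.map φ = P := by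
    intro P hP; ext j; rw [coeff_map, hφ, hP]
  let σ0 : k[X] →+* K := (algebraMap k[X] K).comp (mapRingHom φ)
  have hσ0 : Function.Injective σ0 :=
    (IsFractionRing.injective k[X] K).comp (Polynomial.map_injective φ φ.injective)
  let σ : K →+* K := IsFractionRing.lift hσ0
  have hσ : ∀ P : k[X], σ (algebraMap k[X] K P) = algebraMap k[X] K (P.map φ) := fun P => by
    simp only [σ]; rw [IsFractionRing.lift_algebraMap]; rfl
  have hσk : ∀ a : k, σ (algebraMap k K a) = algebraMap k K (a ^ p ^ f) := by
    intro a
    rw [IsScalarTower.algebraMap_apply k k[X] K, hσ, IsScalarTower.algebraMap_apply k k[X] K,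
      algebraMap_eq, map_C, hφ]
  have hP : (covPP K A b).map σ = covPP K A b := by
    unfold covPP
    rw [Polynomial.map_prod]
    refine Finset.prod_congr rfl fun i _ => ?_
    unfold covP
    rw [Polynomial.map_sub, map_C, hσ, hmap _ (hb i), Polynomial.map_map]
    congr 1
    ext j
    rw [coeff_map, coeff_map, RingHom.comp_apply, hσk, hA]
  have key : ∃ θ0 : L →+* L, ∀ x : K, θ0 (algebraMap K L x) = algebraMap K L (σ x) := by
    have hs : ((covPP K A b).map ((algebraMap K L).comp σ)).Splits := by
      rw [← Polynomial.map_map, hP]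
      exact IsSplittingField.splits L (covPP K A b)
    have gen : ∀ (M : Type _) [Field M] (j : K →+* M), ((covPP K A b).map j).Splits →
        ∃ θ0 : L →+* M, ∀ x : K, θ0 (algebraMap K L x) = j x := by
      intro M _ j hj
      letI := j.toAlgebra
      let θ : L →ₐ[K] M := IsSplittingField.lift L (covPP K A b) hj
      exact ⟨θ, fun x => θ.commutes x⟩
    exact gen L _ hs
  obtain ⟨θ0, hθ⟩ := key
  have hθP : ∀ P : k[X], θ0 (algebraMap k[X] L P) = algebraMap k[X] L (P.map φ) := by
    intro P
    rw [IsScalarTower.algebraMap_apply k[X] K L, hθ, hσ, ← IsScalarTower.algebraMap_apply]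
  have hθk : ∀ a : k, θ0 (algebraMap k L a) = algebraMap k L (a ^ p ^ f) := by
    intro a
    rw [IsScalarTower.algebraMap_apply k K L, hθ, hσk, ← IsScalarTower.algebraMap_apply]
  refine ⟨θ0, by rw [hθP, map_X], hθk, ?_⟩
  intro i x hx
  have hx' : aeval x (A i) = algebraMap k[X] L (b i) := hx
  change aeval (θ0 x) (A i) = algebraMap k[X] L (b i)
  have h1 := congrArg θ0 hx'
  rw [hθP, hmap _ (hb i)] at h1
  rw [← h1, aeval_def, aeval_def, hom_eval₂]
  rw [eval₂_eq_sum, eval₂_eq_sum]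
  refine Finset.sum_congr rfl fun j _ => ?_
  dsimp only
  rw [RingHom.comp_apply, hθk, hA]

end sf
end PC

namespace PC

/-- iterates of `x^d+c` -/
noncomputable def Fit {k : Type*} [CommRing k] (d : ℕ) (c : k) (N : ℕ) : k[X] := (uf d c).comp^[N] X

section fit
variable {k : Type*} [Field k] {d : ℕ} {c : k}

lemma Fit_zero : Fit d c 0 = X := rfl
lemma Fit_succ (N : ℕ) : Fit d c (N+1) = (uf d c).comp (Fit d c N) := by
  unfold Fit; rw [Function.iterate_succ_apply']

lemma Fit_natDegree (hd : 2 ≤ d) (N : ℕ) : (Fit d c N).natDegree = d ^ N := by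
  induction N with
  | zero => rw [Fit_zero]; simp
  | succ N ih => rw [Fit_succ, natDegree_comp, ih, uf_natDegree hd, pow_succ']

lemma Fit_monic (hd : 2 ≤ d) (N : ℕ) : (Fit d c N).Monic := by
  induction N with
  | zero => rw [Fit_zero]; exact monic_X
  | succ N ih =>
    rw [Fit_succ]
    refine (uf_monic hd).comp ih ?_
    rw [Fit_natDegree hd]; positivity

lemma Fit_eval (N : ℕ) (x : k) : (Fit d c N).eval x = (fun w => w ^ d + c)^[N] x := by
  induction N with
  | zero => simp [Fit_zero]
  | succ N ih => rw [Fit_succ, eval_comp, ih, Function.iterate_succ_apply']; simp [uf]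

lemma monic_derivative_natDegree {G : k[X]} (hG : G.Monic) (h : (G.natDegree : k) ≠ 0) :
    (derivative G).natDegree = G.natDegree - 1 := by
  refine le_antisymm (natDegree_derivative_le G) ?_
  apply le_natDegree_of_ne_zero
  have h0 : 0 < G.natDegree := Nat.pos_of_ne_zero fun h0 => h (by rw [h0]; simp)
  rw [coeff_derivative, Nat.sub_add_cancel h0, hG.coeff_natDegree, one_mul]
  have : ((G.natDegree - 1 : ℕ) : k) + 1 = ((G.natDegree - 1 + 1 : ℕ) : k) := by push_cast; ring
  rw [this, Nat.sub_add_cancel h0]; exact h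

lemma monic_derivative_ne {G : k[X]} (hG : G.Monic) (h : (G.natDegree : k) ≠ 0) :
    derivative G ≠ 0 := by
  intro h1
  have h0 : 0 < G.natDegree := Nat.pos_of_ne_zero fun h0 => h (by rw [h0]; simp)
  have h2 : (derivative G).coeff (G.natDegree - 1) ≠ 0 := by
    rw [coeff_derivative, Nat.sub_add_cancel h0, hG.coeff_natDegree, one_mul]
    have : ((G.natDegree - 1 : ℕ) : k) + 1 = ((G.natDegree - 1 + 1 : ℕ) : k) := by push_cast; ring
    rw [this, Nat.sub_add_cancel h0]; exact h
  rw [h1] at h2; simp at h2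

end fit

section core
variable {k K L : Type*} [Field k] [IsAlgClosed k] [Field K] [Field L] [Algebra k[X] K]
  [IsFractionRing k[X] K]
  [Algebra K L] [Algebra k[X] L] [IsScalarTower k[X] K L] [Algebra k L] [IsScalarTower k k[X] L]
  [Algebra k K] [IsScalarTower k k[X] K] [IsScalarTower k K L] [FiniteDimensional K L]
  [IsGalois K L]
  {d : ℕ} {c : k} {G z F : k[X]} {B : ℕ}

open Classical in
lemma pair_group (H : Hyp d c G z B) (H2 : Hyp2 d c G z F)
    (hB1 : d*d*(Module.finrank K L * z.natDegree) ≤ B)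
    (hB2 : Module.finrank K L*(Module.finrank K L*z.natDegree+1) ≤ B) (θ0 : L →+* L) :
    (Finset.univ.filter (fun γ : L ≃ₐ[K] L =>
        ∃ x ∈ Vs L (((uf d c).comp (uf d c)).comp F) X, θ0 (γ x) = x)).card *
      (Finset.univ.filter (fun γ : L ≃ₐ[K] L => ∃ x ∈ Vs L G z, θ0 (γ x) = x)).card ≤
    d * d * (Fintype.card (L ≃ₐ[K] L) * (Finset.univ.filter (fun γ : L ≃ₐ[K] L =>
        (∃ x ∈ Vs L (((uf d c).comp (uf d c)).comp F) X, θ0 (γ x) = x) ∧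
        ∃ x ∈ Vs L G z, θ0 (γ x) = x)).card) := by
  let g2 := (uf d c).comp (uf d c)
  have hd := H.hd
  have hg2m : g2.Monic := uf_comp_monic hd
  have hg2d : g2.natDegree = d * d := uf_comp_natDegree hd
  let RY : Finset L := (covP K g2 X).rootSet L |>.toFinset
  have hRY : ∀ Y, Y ∈ RY ↔ aeval Y g2 = algebraMap k[X] L X := by
    intro Y
    simp only [RY, Set.mem_toFinset]
    rw [mem_rootSet_of_ne (covP_monic hg2m (by rw [hg2d]; positivity)).ne_zero, covP_aeval,
      sub_eq_zero]
  have hcard : RY.card ≤ d * d := by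
    rw [← hg2d, ← covP_natDegree (K := K) (b := X) hg2m]
    have := ncard_rootSet_le (covP K g2 X) L
    rwa [Set.ncard_eq_toFinset_card'] at this
  let b : (L ≃ₐ[K] L) → Prop := fun γ => ∃ x ∈ Vs L G z, θ0 (γ x) = x
  let a : L → (L ≃ₐ[K] L) → Prop := fun Y γ => ∃ x, aeval x F = Y ∧ θ0 (γ x) = x
  let e : (L ≃ₐ[K] L) → Prop := fun γ => ∃ x ∈ Vs L (g2.comp F) X, θ0 (γ x) = x
  have hea : ∀ γ, e γ ↔ ∃ Y ∈ RY, a Y γ := by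
    intro γ
    constructor
    · rintro ⟨x, hx, h⟩
      refine ⟨aeval x F, ?_, x, rfl, h⟩
      rw [hRY, ← aeval_comp]; exact hx
    · rintro ⟨Y, hY, x, rfl, h⟩
      refine ⟨x, ?_, h⟩
      rw [hRY, ← aeval_comp] at hY
      exact hY
  have hnorm : (fixingSubgroup (L ≃ₐ[K] L) (Vs L G z)).Normal := by
    constructor
    intro n hn g
    rw [mem_fixingSubgroup_iff] at hn ⊢
    intro y hy
    have h1 : (g⁻¹ : L ≃ₐ[K] L) y ∈ Vs L G z := by
      change aeval ((g⁻¹ : L ≃ₐ[K] L) y) G = algebraMap k[X] L z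
      rw [← aeval_gal]
      have : aeval y G = algebraMap k[X] L z := hy
      rw [this, gal_poly]
    have h2 := hn _ h1
    change g (n ((g⁻¹ : L ≃ₐ[K] L) y)) = y
    have h3 : n ((g⁻¹ : L ≃ₐ[K] L) y) = (g⁻¹ : L ≃ₐ[K] L) y := h2
    rw [h3]
    exact AlgEquiv.apply_symm_apply g y
  have hind : ∀ Y ∈ RY, Fintype.card (L ≃ₐ[K] L) *
      (Finset.univ.filter (fun γ => a Y γ ∧ b γ)).card =
      (Finset.univ.filter (a Y)).card * (Finset.univ.filter b).card := by
    intro Y hY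
    refine indep _ _ (H.disjoint H2 ((hRY Y).1 hY) hB1 hB2) _ _ ?_ ?_
    · intro γ n hn
      rw [mem_fixingSubgroup_iff] at hn
      have : ∀ x, aeval x F = Y → n x = x := fun x hx => hn x hx
      constructor
      · rintro ⟨x, hx, h⟩
        refine ⟨x, hx, ?_⟩
        rwa [AlgEquiv.mul_apply, this x hx] at h
      · rintro ⟨x, hx, h⟩
        refine ⟨x, hx, ?_⟩
        rwa [AlgEquiv.mul_apply, this x hx]
    · intro γ n hn
      rw [mem_fixingSubgroup_iff] at hn
      have : ∀ x, x ∈ Vs L G z → n x = x := fun x hx => hn x hx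
      constructor
      · rintro ⟨x, hx, h⟩
        refine ⟨x, hx, ?_⟩
        rwa [AlgEquiv.mul_apply, this x hx] at h
      · rintro ⟨x, hx, h⟩
        refine ⟨x, hx, ?_⟩
        rwa [AlgEquiv.mul_apply, this x hx]
  change (Finset.univ.filter e).card * (Finset.univ.filter b).card ≤
    d * d * (Fintype.card (L ≃ₐ[K] L) * (Finset.univ.filter (fun γ => e γ ∧ b γ)).card)
  have h1 : (Finset.univ.filter e).card ≤ ∑ Y ∈ RY, (Finset.univ.filter (a Y)).card := by
    have : Finset.univ.filter e ⊆ RY.biUnion (fun Y => Finset.univ.filter (a Y)) := by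
      intro γ hγ
      simp only [Finset.mem_filter, Finset.mem_univ, true_and, Finset.mem_biUnion] at hγ ⊢
      exact (hea γ).1 hγ
    exact (Finset.card_le_card this).trans Finset.card_biUnion_le
  calc (Finset.univ.filter e).card * (Finset.univ.filter b).card
      ≤ (∑ Y ∈ RY, (Finset.univ.filter (a Y)).card) * (Finset.univ.filter b).card :=
        Nat.mul_le_mul_right _ h1
    _ = ∑ Y ∈ RY, Fintype.card (L ≃ₐ[K] L) *
      (Finset.univ.filter (fun γ => a Y γ ∧ b γ)).card := by
        rw [Finset.sum_mul]
        exact Finset.sum_congr rfl fun Y hY => (hind Y hY).symm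
    _ ≤ ∑ Y ∈ RY, Fintype.card (L ≃ₐ[K] L) *
      (Finset.univ.filter (fun γ => e γ ∧ b γ)).card := by
        refine Finset.sum_le_sum fun Y hY => Nat.mul_le_mul_left _ (Finset.card_le_card ?_)
        intro γ hγ
        simp only [Finset.mem_filter, Finset.mem_univ, true_and] at hγ ⊢
        exact ⟨(hea γ).2 ⟨Y, hY, hγ.1⟩, hγ.2⟩
    _ ≤ _ := by
        rw [Finset.sum_const, smul_eq_mul]
        exact Nat.mul_le_mul_right _ hcard

end core
end PC

namespace PC

open Classical in
/-- density -/
noncomputable def dens {k : Type*} (𝔉 : Finset k) (P : k → Prop) : ℝ :=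
  ((𝔉.filter P).card : ℝ) / 𝔉.card

lemma dens_nonneg {k : Type*} (𝔉 : Finset k) (P : k → Prop) : 0 ≤ dens 𝔉 P := by
  unfold dens; positivity

lemma dens_le_one {k : Type*} (𝔉 : Finset k) (P : k → Prop) : dens 𝔉 P ≤ 1 := by
  unfold dens
  apply div_le_one_of_le₀ _ (by positivity)
  classical
  exact_mod_cast Finset.card_filter_le _ _

lemma dens_mono {k : Type*} {𝔉 : Finset k} {P Q : k → Prop} (h : ∀ x ∈ 𝔉, P x → Q x) :
    dens 𝔉 P ≤ dens 𝔉 Q := by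
  unfold dens
  gcongr with x hx
  exact h x hx

lemma Fit_coeff_pow {k : Type*} [Field k] {p f : ℕ} [Fact p.Prime] [CharP k p] {d : ℕ} {c : k}
    (hc : c ^ p ^ f = c) (N j : ℕ) : (Fit d c N).coeff j ^ p ^ f = (Fit d c N).coeff j := by
  have h : (Fit d c N).map (iterateFrobenius k p f) = Fit d c N := by
    induction N with
    | zero => rw [Fit_zero, map_X]
    | succ N ih =>
      rw [Fit_succ, Polynomial.map_comp, ih]
      congr 1
      unfold uf
      rw [Polynomial.map_add, Polynomial.map_pow, map_X, map_C, iterateFrobenius_def, hc]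
  conv_rhs => rw [← h]
  rw [coeff_map, iterateFrobenius_def]

set_option maxHeartbeats 2000000 in
theorem pair.{u} (d N n0 : ℕ) (hd : 2 ≤ d) (δ : ℝ) (hδ : 0 < δ) : ∃ P0 : ℕ, ∀ (p f : ℕ)
    [Fact p.Prime], P0 ≤ p → 0 < f → ∀ (k : Type u) [Field k] [IsAlgClosed k] [CharP k p]
    (𝔉 : Finset k) (hF : ∀ t, t ∈ 𝔉 ↔ t ^ p ^ f = t) (hFc : 𝔉.card = p ^ f)
    (c : k) (hc : c ^ p ^ f = c) (G z : k[X]) (hGc : ∀ j, G.coeff j ^ p ^ f = G.coeff j)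
    (hzc : ∀ j, z.coeff j ^ p ^ f = z.coeff j) (hGm : G.Monic) (hG2 : 2 ≤ G.natDegree)
    (hGn : G.natDegree ≤ n0) (hz1 : 1 ≤ z.natDegree) (hzn : z.natDegree ≤ n0)
    (hα : (pil G z).eval c ≠ 0)
    (hβ : ∀ t0 : k, (pil G z).eval t0 = 0 → ∃ y0 : k, ((uf d c).comp (uf d c)).eval y0 = t0 ∧
      (derivative ((uf d c).comp (uf d c))).eval y0 ≠ 0 ∧ (pil (Fit d c N) X).eval y0 ≠ 0),
    dens 𝔉 (fun t => ∃ a ∈ 𝔉, (Fit d c (N+2)).eval a = t) *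
      dens 𝔉 (fun t => ∃ a ∈ 𝔉, G.eval a = z.eval t) ≤
      d * d * (dens 𝔉 (fun t => (∃ a ∈ 𝔉, (Fit d c (N+2)).eval a = t) ∧
        ∃ a ∈ 𝔉, G.eval a = z.eval t) + δ) := by
  set n := d ^ (N+2) + n0 with hn
  set D0 := (Fintype.card (Fin 2) * n + 1) ^ (Fintype.card (Fin 2) * n + 1) with hD0
  obtain ⟨P1, hP1⟩ := step_numeric D0 (D0 * n) (n * n * n + n + Fintype.card (Fin 2) * (n * n))
    (δ / 6) (by positivity)
  have hnum : StepNum D0 (D0 * n) (n * n * n + n + Fintype.card (Fin 2) * (n * n)) (δ/6) P1 := hP1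
  set B := d * d * (D0 * n0) + D0 * (D0 * n0 + 1) + d + n with hBdef
  obtain ⟨P2, hP2⟩ := exists_nat_ge (12 * (n * n : ℝ) / δ)
  refine ⟨P1 + P2 + B + 1, ?_⟩
  intro p f _ hp hf k _ _ _ 𝔉 hF hFc c hc G z hGc hzc hGm hG2 hGn hz1 hzn hα hβ
  have hBk : ∀ m : ℕ, 0 < m → m ≤ B → (m : k) ≠ 0 := by
    intro m h1 h2 h3
    rw [CharP.cast_eq_zero_iff k p] at h3
    have := Nat.le_of_dvd h1 h3
    omega
  have hdN : ∀ M, M ≤ N + 2 → 0 < d ^ M ∧ d ^ M ≤ B := by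
    intro M hM
    have : d ^ M ≤ d ^ (N+2) := Nat.pow_le_pow_right (by omega) hM
    exact ⟨by positivity, by omega⟩
  have hFder : ∀ M, M ≤ N + 2 → derivative (Fit d c M) ≠ 0 := by
    intro M hM
    refine monic_derivative_ne (Fit_monic hd M) ?_
    rw [Fit_natDegree hd]
    exact hBk _ (hdN M hM).1 (hdN M hM).2
  have H : Hyp d c G z B :=
    { hd := hd, hGm := hGm, hG := hG2
      hG' := monic_derivative_natDegree hGm (hBk _ (by omega) (by omega))
      hz := hz1, hα := hα, hB := hBk, hdB := by omega }
  have H2 : Hyp2 d c G z (Fit d c N) :=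
    { hFm := Fit_monic hd N
      hF1 := by rw [Fit_natDegree hd]; positivity
      hF0 := hFder N (by omega)
      hβ := hβ }
  have hFit : ((uf d c).comp (uf d c)).comp (Fit d c N) = Fit d c (N+2) := by
    rw [Fit_succ, Fit_succ, comp_assoc]
  let A : Fin 2 → k[X] := ![Fit d c (N+2), G]
  let b : Fin 2 → k[X] := ![X, z]
  have hA : ∀ i, (A i).Monic := by
    rw [Fin.forall_fin_two]; exact ⟨Fit_monic hd _, hGm⟩
  have hAd : ∀ i, 0 < (A i).natDegree := by
    rw [Fin.forall_fin_two]
    refine ⟨?_, ?_⟩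
    · change 0 < (Fit d c (N+2)).natDegree
      rw [Fit_natDegree hd]; positivity
    · change 0 < G.natDegree; omega
  have hAn : ∀ i, (A i).natDegree ≤ n := by
    rw [Fin.forall_fin_two]
    refine ⟨?_, ?_⟩
    · change (Fit d c (N+2)).natDegree ≤ n
      rw [Fit_natDegree hd]; omega
    · change G.natDegree ≤ n; omega
  have hbd : ∀ i, 0 < (b i).natDegree := by
    rw [Fin.forall_fin_two]
    refine ⟨?_, ?_⟩
    · change 0 < (X : k[X]).natDegree; simp
    · change 0 < z.natDegree; omega
  have hbn : ∀ i, (b i).natDegree ≤ n := by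
    rw [Fin.forall_fin_two]
    refine ⟨?_, ?_⟩
    · change (X : k[X]).natDegree ≤ n; rw [natDegree_X]; omega
    · change z.natDegree ≤ n; omega
  have hder : ∀ i, derivative (A i) ≠ 0 := by
    rw [Fin.forall_fin_two]
    exact ⟨hFder _ le_rfl, monic_derivative_ne hGm
      (hBk G.natDegree (by omega) (by omega))⟩
  have hAc : ∀ i j, (A i).coeff j ^ p ^ f = (A i).coeff j := by
    rw [Fin.forall_fin_two]
    exact ⟨fun j => Fit_coeff_pow hc _ j, hGc⟩
  have hbc : ∀ i j, (b i).coeff j ^ p ^ f = (b i).coeff j := by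
    rw [Fin.forall_fin_two]
    refine ⟨fun j => ?_, hzc⟩
    change (X : k[X]).coeff j ^ p ^ f = (X : k[X]).coeff j
    have hpf : p ^ f ≠ 0 := pow_ne_zero _ (Fact.out : p.Prime).ne_zero
    rw [coeff_X]; split_ifs
    · exact one_pow _
    · exact zero_pow hpf
  let K := FractionRing k[X]
  let L := (covPP K A b).SplittingField
  haveI : IsScalarTower k k[X] L := IsScalarTower.of_algebraMap_eq (fun x => by
    rw [IsScalarTower.algebraMap_apply k K L, IsScalarTower.algebraMap_apply k k[X] K,
      ← IsScalarTower.algebraMap_apply k[X] K L])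
  have hgal := (cov_galois (K := K) (L := L) hA hAd hbd hder).1
  have hfd : FiniteDimensional K L := IsSplittingField.finiteDimensional L (covPP K A b)
  have hs : Setup k K L A b n := cov_setup hA hAd hbd hder hAn hbn
  have hfr : Module.finrank K L ≤ D0 := cov_finrank (A := A) (b := b) hA hAd hAn
  obtain ⟨θ0, hθT, hθk, hθV⟩ := exists_theta (K := K) (L := L) (p := p) (f := f) hAc hbc
  have hequi := hs.equi hf (δ := δ/6) (by positivity) hnum (by omega) hfr θ0 hθT hθk hθV 𝔉 hF hFc
  have e1 := hequi (fun P => P 0)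
  have e2 := hequi (fun P => P 1)
  have e3 := hequi (fun P => P 0 ∧ P 1)
  have hz0 : Module.finrank K L * z.natDegree ≤ D0 * n0 := Nat.mul_le_mul hfr hzn
  have hgrp := pair_group (K := K) (L := L) H H2
    (by have := Nat.mul_le_mul_left (d*d) hz0; omega)
    (by have := Nat.mul_le_mul hfr (Nat.add_le_add_right hz0 1); omega) θ0
  rw [hFit] at hgrp
  classical
  set Γ := Fintype.card (L ≃ₐ[K] L) with hΓ
  have hΓ0 : (0:ℝ) < Γ := by
    have : 0 < Γ := Fintype.card_pos
    exact_mod_cast this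
  set q := p ^ f with hq
  have hpq : p ≤ q := Nat.le_self_pow hf.ne' p
  have hq0 : (0:ℝ) < q := by
    have : 0 < q := pow_pos (Fact.out : p.Prime).pos _
    exact_mod_cast this
  have hsmall : ((Fintype.card (Fin 2) * (n * n) : ℕ) : ℝ) ≤ δ / 6 * q := by
    rw [div_le_iff₀ hδ] at hP2
    have h1 : (P2 : ℝ) ≤ q := by exact_mod_cast (by omega : P2 ≤ q)
    have h2 : (P2 : ℝ) * δ ≤ q * δ := mul_le_mul_of_nonneg_right h1 hδ.le
    rw [Fintype.card_fin]; push_cast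
    linarith
  set x1 := ((Finset.univ.filter (fun γ : L ≃ₐ[K] L =>
        ∃ x ∈ Vs L (Fit d c (N+2)) X, θ0 (γ x) = x)).card : ℝ) / Γ with hx1
  set x2 := ((Finset.univ.filter (fun γ : L ≃ₐ[K] L =>
        ∃ x ∈ Vs L G z, θ0 (γ x) = x)).card : ℝ) / Γ with hx2
  set x3 := ((Finset.univ.filter (fun γ : L ≃ₐ[K] L =>
        (∃ x ∈ Vs L (Fit d c (N+2)) X, θ0 (γ x) = x) ∧ ∃ x ∈ Vs L G z, θ0 (γ x) = x)).card : ℝ) / Γ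
    with hx3
  have hx : x1 * x2 ≤ d * d * x3 := by
    rw [hx1, hx2, hx3, div_mul_div_comm, ← mul_div_assoc, div_le_div_iff₀ (by positivity) hΓ0]
    have : (((Finset.univ.filter (fun γ : L ≃ₐ[K] L =>
        ∃ x ∈ Vs L (Fit d c (N+2)) X, θ0 (γ x) = x)).card *
      (Finset.univ.filter (fun γ : L ≃ₐ[K] L => ∃ x ∈ Vs L G z, θ0 (γ x) = x)).card : ℕ) : ℝ) ≤
      ((d * d * (Γ * (Finset.univ.filter (fun γ : L ≃ₐ[K] L =>
        (∃ x ∈ Vs L (Fit d c (N+2)) X, θ0 (γ x) = x) ∧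
        ∃ x ∈ Vs L G z, θ0 (γ x) = x)).card) : ℕ) : ℝ) := by
      exact_mod_cast (by convert hgrp)
    push_cast at this
    nlinarith [this, hΓ0]
  have conv : ∀ (P : k → Prop) (x : ℝ),
      |((𝔉.filter P).card : ℝ) - x * q| ≤ δ / 6 * q + (Fintype.card (Fin 2) * (n * n) : ℕ) →
      |dens 𝔉 P - x| ≤ δ / 3 := by
    intro P x h
    have h1 : ((𝔉.filter P).card : ℝ) = dens 𝔉 P * q := by
      unfold dens
      rw [hFc, div_mul_cancel₀ _ hq0.ne']
    rw [h1, ← sub_mul, abs_mul, abs_of_pos hq0] at h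
    have h2 : |dens 𝔉 P - x| * q ≤ δ / 3 * q := by linarith
    exact le_of_mul_le_mul_right h2 hq0
  have hX : ∀ t : k, (b 0).eval t = t := fun t => eval_X
  have d1 : |dens 𝔉 (fun t => ∃ a ∈ 𝔉, (Fit d c (N+2)).eval a = t) - x1| ≤ δ / 3 := by
    apply conv
    simp only [hX] at e1
    rw [hx1]
    convert e1 using 7
    all_goals rfl
  have d2 : |dens 𝔉 (fun t => ∃ a ∈ 𝔉, G.eval a = z.eval t) - x2| ≤ δ / 3 := by
    apply conv
    exact e2
  have d3 : |dens 𝔉 (fun t => (∃ a ∈ 𝔉, (Fit d c (N+2)).eval a = t) ∧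
        ∃ a ∈ 𝔉, G.eval a = z.eval t) - x3| ≤ δ / 3 := by
    apply conv
    simp only [hX] at e3
    rw [hx3]
    convert e3 using 7
    all_goals first | exact Iff.rfl | rfl | congr!
  have n1 := dens_nonneg 𝔉 (fun t => ∃ a ∈ 𝔉, (Fit d c (N+2)).eval a = t)
  have n2 := dens_le_one 𝔉 (fun t => ∃ a ∈ 𝔉, (Fit d c (N+2)).eval a = t)
  have n3 : 0 ≤ x2 := by positivity
  have n4 : x2 ≤ 1 := by
    apply div_le_one_of_le₀ _ (by positivity)
    exact_mod_cast Finset.card_le_univ _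
  generalize dens 𝔉 (fun t => ∃ a ∈ 𝔉, (Fit d c (N+2)).eval a = t) = α at *
  generalize dens 𝔉 (fun t => ∃ a ∈ 𝔉, G.eval a = z.eval t) = β at *
  generalize dens 𝔉 (fun t => (∃ a ∈ 𝔉, (Fit d c (N+2)).eval a = t) ∧
        ∃ a ∈ 𝔉, G.eval a = z.eval t) = η at *
  rw [abs_le] at d1 d2 d3
  have hd2 : (4:ℝ) ≤ d * d := by
    have : (2:ℝ) ≤ d := by exact_mod_cast hd
    nlinarith
  have s1 : α * (β - x2) ≤ δ / 3 := by
    calc α * (β - x2) ≤ α * (δ/3) := mul_le_mul_of_nonneg_left d2.2 n1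
      _ ≤ 1 * (δ/3) := mul_le_mul_of_nonneg_right n2 (by positivity)
      _ = _ := one_mul _
  have s2 : x2 * (α - x1) ≤ δ / 3 := by
    calc x2 * (α - x1) ≤ x2 * (δ/3) := mul_le_mul_of_nonneg_left d1.2 n3
      _ ≤ 1 * (δ/3) := mul_le_mul_of_nonneg_right n4 (by positivity)
      _ = _ := one_mul _
  have s3 : (d:ℝ) * d * x3 ≤ d * d * (η + δ/3) :=
    mul_le_mul_of_nonneg_left (by linarith) (by positivity)
  have s4 : (4:ℝ) * δ ≤ d * d * δ := mul_le_mul_of_nonneg_right hd2 hδ.le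
  nlinarith
end PC

namespace PC

/-- critical orbit -/
def pc {R : Type*} [CommRing R] (d : ℕ) (c : R) (i : ℕ) : R := (fun w => w ^ d + c)^[i] 0

section orb
variable {R : Type*} [CommRing R] {d : ℕ} {c : R}
lemma pc_zero : pc d c 0 = 0 := rfl
lemma pc_succ (i : ℕ) : pc d c (i+1) = pc d c i ^ d + c := by
  unfold pc; rw [Function.iterate_succ_apply']
lemma pc_one (hd : 2 ≤ d) : pc d c 1 = c := by
  rw [pc_succ, pc_zero, zero_pow (by omega), zero_add]
lemma pc_map {S : Type*} [CommRing S] (φ : R →+* S) (i : ℕ) : pc d (φ c) i = φ (pc d c i) := by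
  induction i with
  | zero => simp [pc_zero]
  | succ i ih => rw [pc_succ, pc_succ, ih]; simp
end orb

section good
variable {k : Type*} [Field k] {d : ℕ} {c : k}

/-- liftability of a point by two good preimages -/
def Lift (d : ℕ) (c : k) (N : ℕ) (t0 : k) : Prop :=
  ∃ y1 y0 : k, y0 ^ d + c = y1 ∧ y1 ^ d + c = t0 ∧ y0 ≠ 0 ∧ y1 ≠ 0 ∧
    ∀ j, 1 ≤ j → j ≤ N → y0 ≠ pc d c j

/-- the arithmetic condition needed at level `N` -/
def Good (d : ℕ) (c : k) (N : ℕ) : Prop :=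
  (∃ η : k, η ^ d = 1 ∧ η ≠ 1 ∧ (∀ i, 1 ≤ i → i ≤ N → η * c ≠ pc d c i) ∧
    ∀ t0 i, 1 ≤ i → i ≤ N → η * t0 = pc d c i → Lift d c N t0) ∨
  (d = 2 ∧ c ≠ 0 ∧ Lift d c N (-c) ∧ (∀ i, 1 ≤ i → i ≤ N → - pc d c 2 ≠ pc d c i) ∧
    ∀ t0 i, 1 ≤ i → i ≤ N → -(t0 ^ 2 + c) = pc d c i → Lift d c N t0)

lemma lift_free1 [IsAlgClosed k] (hd : 2 ≤ d) {N : ℕ} {t0 y1 : k} (h0 : y1 ≠ 0)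
    (h1 : ∀ j, 1 ≤ j → j ≤ N + 1 → y1 ≠ pc d c j) (h : y1 ^ d + c = t0) : Lift d c N t0 := by
  obtain ⟨y0, hy0⟩ := IsAlgClosed.exists_pow_nat_eq (y1 - c) (n := d) (by omega)
  have e : y0 ^ d + c = y1 := by rw [hy0]; ring
  refine ⟨y1, y0, e, h, ?_, h0, ?_⟩
  · rintro rfl
    refine h1 1 le_rfl (by omega) ?_
    rw [pc_one hd, ← e, zero_pow (by omega), zero_add]
  · rintro j hj1 hj2 rfl
    refine h1 (j+1) (by omega) (by omega) ?_
    rw [← e, pc_succ]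

lemma lift_free [IsAlgClosed k] (hd : 2 ≤ d) {N : ℕ} {t0 : k}
    (h1 : ∀ j, 1 ≤ j → j ≤ N + 2 → t0 ≠ pc d c j) : Lift d c N t0 := by
  obtain ⟨y1, hy1⟩ := IsAlgClosed.exists_pow_nat_eq (t0 - c) (n := d) (by omega)
  have e : y1 ^ d + c = t0 := by rw [hy1]; ring
  refine lift_free1 hd ?_ ?_ e
  · rintro rfl
    refine h1 1 le_rfl (by omega) ?_
    rw [pc_one hd, ← e, zero_pow (by omega), zero_add]
  · rintro j hj1 hj2 rfl
    refine h1 (j+1) (by omega) (by omega) ?_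
    rw [← e, pc_succ]

lemma exists_root [IsAlgClosed k] (hd : 2 ≤ d) (hdk : (d : k) ≠ 0) :
    ∃ η : k, η ^ d = 1 ∧ η ≠ 1 := by
  haveI : NeZero (d : k) := ⟨hdk⟩
  obtain ⟨ζ, hζ⟩ := HasEnoughRootsOfUnity.exists_primitiveRoot k d
  exact ⟨ζ, hζ.pow_eq_one, hζ.ne_one (by omega)⟩

lemma exists_root3 [IsAlgClosed k] (hd : 3 ≤ d) (hdk : (d : k) ≠ 0) {u : k} (hu : u ≠ 0) (v : k) :
    ∃ η : k, η ^ d = 1 ∧ η ≠ 1 ∧ η * u ≠ v := by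
  haveI : NeZero (d : k) := ⟨hdk⟩
  obtain ⟨ζ, hζ⟩ := HasEnoughRootsOfUnity.exists_primitiveRoot k d
  have h1 : ζ ≠ 1 := hζ.ne_one (by omega)
  have h2 : ζ ^ 2 ≠ 1 := hζ.pow_ne_one_of_pos_of_lt (by omega) (by omega)
  by_cases h : ζ * u = v
  · refine ⟨ζ ^ 2, ?_, h2, ?_⟩
    · rw [← pow_mul, mul_comm, pow_mul, hζ.pow_eq_one, one_pow]
    · intro h3
      have h4 : ζ ^ 2 * u = ζ * u := h3.trans h.symm
      have h5 := mul_right_cancel₀ hu h4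
      have h0 : ζ ≠ 0 := hζ.ne_zero (by omega)
      apply h1
      have : ζ * ζ = ζ * 1 := by rw [mul_one, ← pow_two]; exact h5
      exact mul_left_cancel₀ h0 this
  · exact ⟨ζ, hζ.pow_eq_one, h1, h⟩

/-- Case I: `f` injective on the critical orbit -/
lemma good_inj [IsAlgClosed k] (hd : 2 ≤ d) (hdk : (d : k) ≠ 0) (hc : c ≠ 0) {N : ℕ}
    (hinj : ∀ i j, i ≤ N + 2 → j ≤ N + 2 → pc d c (i+1) = pc d c (j+1) → pc d c i = pc d c j) :
    Good d c N := by
  obtain ⟨η, hη, hη1⟩ := exists_root hd hdk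
  have hη0 : η ≠ 0 := by rintro rfl; rw [zero_pow (by omega)] at hη; exact zero_ne_one hη
  -- `η * pc j = pc i` forces `pc i = 0`
  have key : ∀ i j, i ≤ N + 2 → j ≤ N + 2 → η * pc d c j = pc d c i → pc d c i = 0 := by
    intro i j hi hj h
    have h1 : pc d c (i+1) = pc d c (j+1) := by
      rw [pc_succ, pc_succ, ← h, mul_pow, hη, one_mul]
    have h2 := hinj i j hi hj h1
    rw [← h2] at h
    have : (η - 1) * pc d c i = 0 := by rw [sub_mul, h, one_mul, sub_self]
    exact (mul_eq_zero.1 this).resolve_left (sub_ne_zero.2 hη1)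
  have hi2 : ∀ i, i ≤ N → 1 ≤ i → pc d c i = 0 → 2 ≤ i := by
    intro i hi h1 h0
    by_contra hlt
    have : i = 1 := by omega
    rw [this, pc_one hd] at h0
    exact hc h0
  refine Or.inl ⟨η, hη, hη1, ?_, ?_⟩
  · intro i h1 h2 h
    have h0 := key i 1 (by omega) (by omega) (by rw [pc_one hd]; exact h)
    rw [h0] at h
    exact mul_ne_zero hη0 hc h
  · intro t0 i h1 h2 h
    by_cases hfree : ∀ j, 1 ≤ j → j ≤ N + 2 → t0 ≠ pc d c j
    · exact lift_free hd hfree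
    · push Not at hfree
      obtain ⟨j, hj1, hj2, rfl⟩ := hfree
      have h0 := key i j (by omega) hj2 h
      rw [h0] at h
      have ht0 := (mul_eq_zero.1 h).resolve_left hη0
      have hi := hi2 i h2 h1 h0
      obtain ⟨m, rfl⟩ : ∃ m, i = m + 1 := ⟨i - 1, by omega⟩
      have hm : pc d c m ≠ 0 := by
        intro hm
        rw [pc_succ, hm, zero_pow (by omega), zero_add] at h0
        exact hc h0
      rw [ht0]
      refine lift_free1 hd (y1 := η * pc d c m) (mul_ne_zero hη0 hm) ?_ ?_
      · intro j' h3 h4 h5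
        have h6 : pc d c (j'+1) = pc d c (m+1) := by
          rw [pc_succ, pc_succ, ← h5, mul_pow, hη, one_mul]
        have h7 := hinj j' m (by omega) (by omega) h6
        rw [h7] at h5
        have : (η - 1) * pc d c m = 0 := by rw [sub_mul, h5, one_mul, sub_self]
        exact hm ((mul_eq_zero.1 this).resolve_left (sub_ne_zero.2 hη1))
      · rw [mul_pow, hη, one_mul, ← pc_succ, h0]

/-- Case II: strictly preperiodic -/
lemma good_preper [IsAlgClosed k] (hd : 2 ≤ d) (hdk : (d : k) ≠ 0) (hc : c ≠ 0) {l r : ℕ}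
    (hl : 1 ≤ l) (hlr : l < r) (hdist : ∀ i j, i ≤ r → j ≤ r → pc d c i = pc d c j → i = j)
    (hrep : pc d c (r+1) = pc d c (l+1)) (hcheb : ¬ (d = 2 ∧ c = -2)) (N : ℕ) :
    Good d c N := by
  have F1 : ∀ j, 1 ≤ j → ∃ i, 1 ≤ i ∧ i ≤ r ∧ pc d c j = pc d c i := by
    intro j
    induction j with
    | zero => intro h; omega
    | succ j ih =>
      intro _
      rcases Nat.eq_zero_or_pos j with rfl | hj
      · exact ⟨1, le_rfl, by omega, rfl⟩
      · obtain ⟨i, h1, h2, h3⟩ := ih hj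
        rcases h2.eq_or_lt with rfl | h4
        · exact ⟨l+1, by omega, by omega, by rw [pc_succ, h3, ← pc_succ, hrep]⟩
        · exact ⟨i+1, by omega, by omega, by rw [pc_succ, h3, ← pc_succ]⟩
  have F2 : ∀ i j, i ≤ r → j ≤ r → pc d c i ^ d = pc d c j ^ d →
      i = j ∨ (i = l ∧ j = r) ∨ (i = r ∧ j = l) := by
    intro i j hi hj h
    have h' : pc d c (i+1) = pc d c (j+1) := by rw [pc_succ, pc_succ, h]
    rcases hi.eq_or_lt with rfl | hi' <;> rcases hj.eq_or_lt with rfl | hj'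
    · exact Or.inl rfl
    · rw [hrep] at h'
      have := hdist _ _ (by omega) (by omega) h'
      right; right; exact ⟨rfl, by omega⟩
    · rw [hrep] at h'
      have := hdist _ _ (by omega) (by omega) h'
      right; left; exact ⟨by omega, rfl⟩
    · have := hdist _ _ (by omega) (by omega) h'
      left; omega
  have hne : ∀ i, 1 ≤ i → i ≤ r → pc d c i ≠ 0 := by
    intro i h1 h2 h
    have := hdist i 0 h2 (by omega) (by rw [h, pc_zero])
    omega
  have hfree : ∀ t0, (∀ j, 1 ≤ j → j ≤ r → t0 ≠ pc d c j) → Lift d c N t0 := by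
    intro t0 h
    refine lift_free hd ?_
    intro j h1 _ h2
    obtain ⟨i, h3, h4, h5⟩ := F1 j h1
    exact h i h3 h4 (h2.trans h5)
  have hfree1 : ∀ t0 y1, y1 ≠ 0 → (∀ j, 1 ≤ j → j ≤ r → y1 ≠ pc d c j) → y1 ^ d + c = t0 →
      Lift d c N t0 := by
    intro t0 y1 h0 h he
    refine lift_free1 hd h0 ?_ he
    intro j h1 _ h2
    obtain ⟨i, h3, h4, h5⟩ := F1 j h1
    exact h i h3 h4 (h2.trans h5)
  -- generic treatment
  have gen : ∀ η : k, η ^ d = 1 → η ≠ 1 → η * c ≠ pc d c r →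
      Good d c N := by
    intro η hη hη1 hηc
    have hη0 : η ≠ 0 := by rintro rfl; rw [zero_pow (by omega)] at hη; exact zero_ne_one hη
    have fix : ∀ ξ x : k, ξ ≠ 1 → ξ * x = x → x = 0 := by
      intro ξ x hξ h
      have : (ξ - 1) * x = 0 := by rw [sub_mul, h, one_mul, sub_self]
      exact (mul_eq_zero.1 this).resolve_left (sub_ne_zero.2 hξ)
    refine Or.inl ⟨η, hη, hη1, ?_, ?_⟩
    · intro i h1 _ h
      obtain ⟨i', h3, h4, h5⟩ := F1 i h1
      rw [h5] at h
      have h6 : pc d c 1 ^ d = pc d c i' ^ d := by rw [pc_one hd, ← h, mul_pow, hη, one_mul]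
      rcases F2 1 i' (by omega) h4 h6 with h7 | ⟨h7, h8⟩ | ⟨h7, h8⟩
      · rw [← h7, pc_one hd] at h
        exact hc (fix η c hη1 h)
      · rw [h8] at h; exact hηc h
      · omega
    · intro t0 i h1 _ h
      obtain ⟨i', h3, h4, h5⟩ := F1 i h1
      rw [h5] at h
      by_cases hf : ∀ j, 1 ≤ j → j ≤ r → t0 ≠ pc d c j
      · exact hfree t0 hf
      push Not at hf
      obtain ⟨s, hs1, hs2, rfl⟩ := hf
      have h6 : pc d c s ^ d = pc d c i' ^ d := by rw [← h, mul_pow, hη, one_mul]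
      have h7 : (s = l ∧ i' = r) ∨ (s = r ∧ i' = l) := by
        rcases F2 s i' hs2 h4 h6 with h7 | h7
        · exfalso
          rw [← h7] at h
          exact hne s hs1 hs2 (fix η _ hη1 h)
        · exact h7
      have hs : 2 ≤ s := by
        by_contra hlt
        have hs1' : s = 1 := by omega
        rcases h7 with ⟨h8, h9⟩ | ⟨h8, h9⟩
        · rw [hs1', h9, pc_one hd] at h; exact hηc h
        · omega
      obtain ⟨m, rfl⟩ : ∃ m, s = m + 1 := ⟨s - 1, by omega⟩
      have hm : pc d c m ≠ 0 := hne m (by omega) (by omega)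
      have fin : ∀ ξ : k, ξ ^ d = 1 → ξ ≠ 1 → ξ * pc d c m ≠ pc d c r →
          Lift d c N (pc d c (m+1)) := by
        intro ξ hξ hξ1 hξr
        have hξ0 : ξ ≠ 0 := by rintro rfl; rw [zero_pow (by omega)] at hξ; exact zero_ne_one hξ
        refine hfree1 _ (ξ * pc d c m) (mul_ne_zero hξ0 hm) ?_ ?_
        · intro j hj1 hj2 hj
          have h8 : pc d c m ^ d = pc d c j ^ d := by rw [← hj, mul_pow, hξ, one_mul]
          rcases F2 m j (by omega) hj2 h8 with h9 | ⟨h9, h10⟩ | ⟨h9, h10⟩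
          · rw [← h9] at hj; exact hm (fix ξ _ hξ1 hj)
          · rw [h10] at hj; exact hξr hj
          · omega
        · rw [mul_pow, hξ, one_mul, pc_succ]
      by_cases hd3 : 3 ≤ d
      · obtain ⟨ξ, a1, a2, a3⟩ := exists_root3 hd3 hdk hm (pc d c r)
        exact fin ξ a1 a2 a3
      · have hd2 : d = 2 := by omega
        subst hd2
        have h2k : (2 : k) ≠ 0 := by exact_mod_cast hdk
        have hm1 : (-1 : k) ≠ 1 := by
          intro h; apply h2k; linear_combination -h
        by_cases hmr : (-1) * pc 2 c m = pc 2 c r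
        · have h8 : pc 2 c m ^ 2 = pc 2 c r ^ 2 := by rw [← hmr]; ring
          have hml : m = l := by
            rcases F2 m r (by omega) le_rfl h8 with h9 | ⟨h9, h10⟩ | ⟨h9, h10⟩ <;> omega
          have hη' : η = -1 := by
            have : (η - 1) * (η + 1) = 0 := by linear_combination hη
            rcases mul_eq_zero.1 this with h | h
            · exact absurd (sub_eq_zero.1 h) hη1
            · exact eq_neg_of_add_eq_zero_left h
          have hl2 : 2 ≤ l := by
            by_contra hlt
            have hl1 : l = 1 := by omega
            apply hηc
            rw [hη', ← hmr, hml, hl1, pc_one hd]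
          obtain ⟨l', rfl⟩ : ∃ l', l = l' + 1 := ⟨l - 1, by omega⟩
          have hl' : pc 2 c l' ≠ 0 := hne l' (by omega) (by omega)
          refine ⟨pc 2 c m, - pc 2 c l', ?_, ?_, neg_ne_zero.2 hl', hm, ?_⟩
          · rw [hml, pc_succ]; ring
          · rw [pc_succ]
          · intro j hj1 _ hj
            obtain ⟨j', b3, b4, b5⟩ := F1 j hj1
            rw [b5] at hj
            have h8 : pc 2 c l' ^ 2 = pc 2 c j' ^ 2 := by rw [← hj]; ring
            rcases F2 l' j' (by omega) b4 h8 with h9 | ⟨h9, h10⟩ | ⟨h9, h10⟩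
            · rw [← h9] at hj
              exact hl' (fix (-1) _ hm1 (by rw [neg_one_mul]; exact hj))
            · omega
            · omega
        · exact fin (-1) (by norm_num) hm1 hmr
  by_cases hd3 : 3 ≤ d
  · obtain ⟨ξ, a1, a2, a3⟩ := exists_root3 hd3 hdk hc (pc d c r)
    exact gen ξ a1 a2 a3
  have hd2 : d = 2 := by omega
  subst hd2
  have h2k : (2 : k) ≠ 0 := by exact_mod_cast hdk
  have hm1 : (-1 : k) ≠ 1 := by
    intro h; apply h2k; linear_combination -h
  by_cases hcr : (-1) * c = pc 2 c r
  swap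
  · exact gen (-1) (by norm_num) hm1 hcr
  -- now l = 1
  have neg0 : ∀ x : k, -x = x → x = 0 := by
    intro x hx
    have : (2:k) * x = 0 := by linear_combination -hx
    exact (mul_eq_zero.1 this).resolve_left h2k
  have hl1 : l = 1 := by
    have h8 : pc 2 c 1 ^ 2 = pc 2 c r ^ 2 := by rw [← hcr, pc_one hd]; ring
    rcases F2 1 r (by omega) le_rfl h8 with h9 | ⟨h9, h10⟩ | ⟨h9, h10⟩ <;> omega
  subst hl1
  have hr3 : 3 ≤ r := by
    by_contra hlt
    have hr2 : r = 2 := by omega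
    apply hcheb
    refine ⟨rfl, ?_⟩
    rw [hr2, pc_succ, pc_one hd] at hcr
    have : c * (c + 2) = 0 := by linear_combination -hcr
    exact eq_neg_of_add_eq_zero_left ((mul_eq_zero.1 this).resolve_left hc)
  have A2 : ∀ i, 1 ≤ i → i ≤ r → - pc 2 c 2 ≠ pc 2 c i := by
    intro i h1 h2 h
    have h8 : pc 2 c 2 ^ 2 = pc 2 c i ^ 2 := by rw [← h]; ring
    rcases F2 2 i (by omega) h2 h8 with h9 | ⟨h9, h10⟩ | ⟨h9, h10⟩
    · rw [← h9] at h; exact hne 2 (by omega) (by omega) (neg0 _ h)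
    · omega
    · omega
  have negl : ∀ m, 1 ≤ m → m < r → m ≠ 1 → Lift 2 c N (pc 2 c (m+1)) := by
    intro m h1 h2 h3
    refine hfree1 _ (- pc 2 c m) (neg_ne_zero.2 (hne m h1 h2.le)) ?_ ?_
    · intro j hj1 hj2 hj
      have h8 : pc 2 c m ^ 2 = pc 2 c j ^ 2 := by rw [← hj]; ring
      rcases F2 m j (by omega) hj2 h8 with h9 | ⟨h9, h10⟩ | ⟨h9, h10⟩
      · rw [← h9] at hj; exact hne m h1 h2.le (neg0 _ hj)
      · omega
      · omega
    · rw [pc_succ]; ring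
  refine Or.inr ⟨rfl, hc, ?_, ?_, ?_⟩
  · have : -c = pc 2 c ((r-1)+1) := by
      rw [Nat.sub_add_cancel (by omega), ← hcr, neg_one_mul]
    rw [this]
    exact negl _ (by omega) (by omega) (by omega)
  · intro i h1 _ h
    obtain ⟨i', h3, h4, h5⟩ := F1 i h1
    exact A2 i' h3 h4 (h.trans h5)
  · intro t0 i h1 _ h
    obtain ⟨i', h3, h4, h5⟩ := F1 i h1
    rw [h5] at h
    by_cases hf : ∀ j, 1 ≤ j → j ≤ r → t0 ≠ pc 2 c j
    · exact hfree t0 hf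
    push Not at hf
    obtain ⟨s, hs1, hs2, rfl⟩ := hf
    rw [← pc_succ] at h
    rcases hs2.eq_or_lt with rfl | hs3
    · rw [hrep] at h; exact absurd h (A2 i' h3 h4)
    have h8 : pc 2 c (s+1) ^ 2 = pc 2 c i' ^ 2 := by rw [← h]; ring
    have hsr : s + 1 = r := by
      rcases F2 (s+1) i' (by omega) h4 h8 with h9 | ⟨h9, h10⟩ | ⟨h9, h10⟩
      · rw [← h9] at h; exact absurd (neg0 _ h) (hne (s+1) (by omega) (by omega))
      · omega
      · exact h9
    obtain ⟨m, rfl⟩ : ∃ m, s = m + 1 := ⟨s - 1, by omega⟩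
    by_cases hm : m = 1
    · subst hm
      refine ⟨pc 2 c 3, - pc 2 c 2, ?_, ?_, neg_ne_zero.2 (hne 2 (by omega) (by omega)),
        hne 3 (by omega) (by omega), ?_⟩
      · rw [pc_succ 2]; ring
      · have : pc 2 c 3 = -c := by
          have : r = 3 := by omega
          rw [← this, ← hcr]; ring
        rw [this, pc_succ 1, pc_one hd]; ring
      · intro j hj1 _ hj
        obtain ⟨j', b3, b4, b5⟩ := F1 j hj1
        exact A2 j' b3 b4 (hj.trans b5)
    · exact negl m (by omega) (by omega) hm

end good
end PC

namespace PC

open Classical in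
lemma comb {k : Type*} (A E : Finset k) (φ : k → k) (hE : E ⊆ A)
    (h : ∀ x ∈ E, ∃ y ∈ A, y ≠ x ∧ φ y = φ x) :
    E.card + 2 * (A.image φ).card ≤ 2 * A.card := by
  have h1 : A.card = ∑ b ∈ A.image φ, (A.filter (fun a => φ a = b)).card :=
    Finset.card_eq_sum_card_image φ A
  have h2 : E.card = ∑ b ∈ A.image φ, (E.filter (fun a => φ a = b)).card :=
    Finset.card_eq_sum_card_fiberwise (fun x hx => Finset.mem_image_of_mem φ (hE hx))
  rw [h1, h2, Finset.card_eq_sum_ones (A.image φ), Finset.mul_sum, Finset.mul_sum,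
    ← Finset.sum_add_distrib]
  refine Finset.sum_le_sum fun b hb => ?_
  obtain ⟨a, ha, hab⟩ := Finset.mem_image.1 hb
  have hsub : E.filter (fun a => φ a = b) ⊆ A.filter (fun a => φ a = b) :=
    Finset.filter_subset_filter _ hE
  have hle := Finset.card_le_card hsub
  rcases (E.filter (fun a => φ a = b)).eq_empty_or_nonempty with h0 | ⟨x, hx⟩
  · rw [h0, Finset.card_empty]
    have : 0 < (A.filter (fun a => φ a = b)).card :=
      Finset.card_pos.2 ⟨a, Finset.mem_filter.2 ⟨ha, hab⟩⟩
    omega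
  · obtain ⟨hxE, hxb⟩ := Finset.mem_filter.1 hx
    obtain ⟨y, hyA, hyx, hy⟩ := h x hxE
    have : 1 < (A.filter (fun a => φ a = b)).card :=
      Finset.one_lt_card.2 ⟨y, Finset.mem_filter.2 ⟨hyA, hy.trans hxb⟩, x, hsub hx, hyx⟩
    omega

section crit
variable {k : Type*} [Field k] {d : ℕ} {c : k}

lemma Fit_crit (hd : 2 ≤ d) (hdk : (d : k) ≠ 0) (N : ℕ) (r : k)
    (h : (derivative (Fit d c N)).eval r = 0) :
    ∃ i, 1 ≤ i ∧ i ≤ N ∧ (Fit d c N).eval r = pc d c i := by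
  induction N with
  | zero => rw [Fit_zero] at h; simp at h
  | succ N ih =>
    rw [Fit_succ, derivative_comp, eval_mul, eval_comp, uf_derivative] at h
    rcases mul_eq_zero.1 h with h | h
    · obtain ⟨i, h1, h2, h3⟩ := ih h
      refine ⟨i+1, by omega, by omega, ?_⟩
      rw [Fit_succ, eval_comp, h3, pc_succ]; simp [uf]
    · have h0 : (Fit d c N).eval r = 0 := by
        rw [eval_mul, eval_C, eval_pow, eval_X] at h
        exact eq_zero_of_pow_eq_zero ((mul_eq_zero.1 h).resolve_left hdk)
      refine ⟨1, le_rfl, by omega, ?_⟩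
      rw [Fit_succ, eval_comp, h0, pc_succ, pc_zero]; simp [uf]

lemma pil_root {A b : k[X]} {t : k} (h : (pil A b).eval t = 0) :
    ∃ r, (derivative A).eval r = 0 ∧ b.eval t = A.eval r := by
  unfold pil at h
  rw [← coe_evalRingHom, map_multiset_prod, Multiset.prod_eq_zero_iff, Multiset.map_map,
    Multiset.mem_map] at h
  obtain ⟨r, hr, h⟩ := h
  refine ⟨r, (mem_roots'.1 hr).2, ?_⟩
  simpa [sub_eq_zero] using h

lemma lift_hβ (hd : 2 ≤ d) (hdk : (d : k) ≠ 0) {N : ℕ} {t0 : k} (h : Lift d c N t0) :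
    ∃ y0 : k, ((uf d c).comp (uf d c)).eval y0 = t0 ∧
      (derivative ((uf d c).comp (uf d c))).eval y0 ≠ 0 ∧ (pil (Fit d c N) X).eval y0 ≠ 0 := by
  obtain ⟨y1, y0, h1, h2, h3, h4, h5⟩ := h
  have e : (uf d c).eval y0 = y1 := by rw [← h1]; simp [uf]
  refine ⟨y0, ?_, ?_, ?_⟩
  · rw [eval_comp, e, ← h2]; simp [uf]
  · rw [derivative_comp, eval_mul, eval_comp, e, uf_derivative]
    simp only [eval_mul, eval_C, eval_pow, eval_X]
    exact mul_ne_zero (mul_ne_zero hdk (pow_ne_zero _ h3)) (mul_ne_zero hdk (pow_ne_zero _ h4))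
  · intro h
    obtain ⟨r, h6, h7⟩ := pil_root h
    obtain ⟨i, a1, a2, a3⟩ := Fit_crit hd hdk N r h6
    rw [eval_X, a3] at h7
    exact h5 i a1 a2 h7

end crit

/-- the image of the `N`-th iterate -/
noncomputable def al {k : Type*} [Field k] (𝔉 : Finset k) (d : ℕ) (c : k) (N : ℕ) : ℝ :=
  dens 𝔉 (fun t => ∃ a ∈ 𝔉, (Fit d c N).eval a = t)

section dn
variable {k : Type*}

lemma dens_add_le {𝔉 : Finset k} {P Q R : k → Prop} (h : ∀ x ∈ 𝔉, P x → Q x ∨ R x) :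
    dens 𝔉 P ≤ dens 𝔉 Q + dens 𝔉 R := by
  classical
  unfold dens
  rw [← add_div]
  gcongr
  norm_cast
  refine le_trans (Finset.card_le_card ?_) (Finset.card_union_le _ _)
  intro x hx
  obtain ⟨h1, h2⟩ := Finset.mem_filter.1 hx
  rcases h x h1 h2 with h3 | h3
  · exact Finset.mem_union_left _ (Finset.mem_filter.2 ⟨h1, h3⟩)
  · exact Finset.mem_union_right _ (Finset.mem_filter.2 ⟨h1, h3⟩)

lemma dens_single {𝔉 : Finset k} (x : k) : dens 𝔉 (fun t => t = x) ≤ 1 / 𝔉.card := by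
  classical
  unfold dens
  gcongr
  norm_cast
  refine Finset.card_le_one.2 ?_
  intro a ha b hb
  rw [(Finset.mem_filter.1 ha).2, (Finset.mem_filter.1 hb).2]

/-- surjection -/
lemma dens_surj {𝔉 : Finset k} {P Q : k → Prop} (φ : k → k)
    (h : ∀ y ∈ 𝔉, Q y → ∃ x ∈ 𝔉, P x ∧ φ x = y) : dens 𝔉 Q ≤ dens 𝔉 P := by
  classical
  unfold dens
  refine div_le_div_of_nonneg_right (Nat.cast_le.2 ?_) (by positivity)
  refine Finset.card_le_card_of_surjOn φ ?_
  intro y hy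
  obtain ⟨h1, h2⟩ := Finset.mem_filter.1 (Finset.mem_coe.1 hy)
  obtain ⟨x, a, b, e⟩ := h y h1 h2
  exact ⟨x, Finset.mem_coe.2 (Finset.mem_filter.2 ⟨a, b⟩), e⟩

/-- two to one -/
lemma dens_two [Field k] {𝔉 : Finset k} {P Q : k → Prop} (φ : k → k)
    (h2 : ∀ x y, φ x = φ y → x = y ∨ x = -y)
    (h : ∀ x ∈ 𝔉, P x → φ x ∈ 𝔉 ∧ Q (φ x)) : dens 𝔉 P ≤ 2 * dens 𝔉 Q := by
  classical
  unfold dens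
  rw [← mul_div_assoc]
  gcongr
  norm_cast
  have key := Finset.card_le_mul_card_image (f := φ) (𝔉.filter P) 2 (by
    intro b hb
    obtain ⟨y, hy, rfl⟩ := Finset.mem_image.1 hb
    refine le_trans (Finset.card_le_card (t := {y, -y}) ?_) Finset.card_le_two
    intro x hx
    have := h2 x y (Finset.mem_filter.1 hx).2
    simpa using this)
  refine key.trans (Nat.mul_le_mul_left 2 (Finset.card_le_card ?_))
  intro y hy
  obtain ⟨x, hx, rfl⟩ := Finset.mem_image.1 hy
  obtain ⟨a, b⟩ := Finset.mem_filter.1 hx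
  exact Finset.mem_filter.2 (h x a b)

end dn

end PC

namespace PC

lemma dens_def {k : Type*} (𝔉 : Finset k) (P : k → Prop) [DecidablePred P] :
    dens 𝔉 P = ((𝔉.filter P).card : ℝ) / 𝔉.card := by
  unfold dens; congr!

section st
variable {k : Type*} [Field k] {p f : ℕ} [Fact p.Prime] [CharP k p] {𝔉 : Finset k}
  (hF : ∀ t, t ∈ 𝔉 ↔ t ^ p ^ f = t) {d : ℕ} {c : k} (hc : c ^ p ^ f = c)

include hF
lemma F_mul {x y : k} (hx : x ∈ 𝔉) (hy : y ∈ 𝔉) : x * y ∈ 𝔉 := by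
  rw [hF] at *; rw [mul_pow, hx, hy]
lemma F_add {x y : k} (hx : x ∈ 𝔉) (hy : y ∈ 𝔉) : x + y ∈ 𝔉 := by
  rw [hF] at *; rw [add_pow_char_pow, hx, hy]
lemma F_pow {x : k} (hx : x ∈ 𝔉) (n : ℕ) : x ^ n ∈ 𝔉 := by
  rw [hF] at *; rw [← pow_mul, mul_comm, pow_mul, hx]
lemma F_inv {x : k} (hx : x ∈ 𝔉) : x⁻¹ ∈ 𝔉 := by
  rw [hF] at *; rw [inv_pow, hx]
lemma F_root (hdq : d ∣ p ^ f - 1) {η : k} (hη : η ^ d = 1) : η ∈ 𝔉 := by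
  rw [hF]
  obtain ⟨m, hm⟩ := hdq
  have : 0 < p ^ f := pow_pos (Fact.out : p.Prime).pos _
  have e : p ^ f = d * m + 1 := by omega
  rw [e, pow_succ, pow_mul, hη, one_pow, one_mul]
lemma F_neg (hdq : 2 ∣ p ^ f - 1) {x : k} (hx : x ∈ 𝔉) : -x ∈ 𝔉 := by
  rw [← neg_one_mul]
  exact F_mul hF (F_root hF hdq (by norm_num)) hx

include hc
lemma F_Fit (N : ℕ) {x : k} (hx : x ∈ 𝔉) : (Fit d c N).eval x ∈ 𝔉 := by
  induction N with
  | zero => rw [Fit_zero, eval_X]; exact hx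
  | succ N ih =>
    rw [Fit_succ, eval_comp]
    simp only [uf, eval_add, eval_pow, eval_X, eval_C]
    exact F_add hF (F_pow hF ih d) ((hF c).2 hc)

lemma Fit_eval_succ' (N : ℕ) (x : k) : (Fit d c (N+1)).eval x = (Fit d c N).eval (x ^ d + c) := by
  rw [Fit_eval, Fit_eval, Function.iterate_succ_apply]
lemma Fit_eval_succ (N : ℕ) (x : k) : (Fit d c (N+1)).eval x = (Fit d c N).eval x ^ d + c := by
  rw [Fit_eval, Fit_eval, Function.iterate_succ_apply']

lemma im_succ {N : ℕ} {t : k} (h : ∃ a ∈ 𝔉, (Fit d c (N+1)).eval a = t) :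
    ∃ a ∈ 𝔉, (Fit d c N).eval a = t := by
  obtain ⟨a, ha, h⟩ := h
  exact ⟨a ^ d + c, F_add hF (F_pow hF ha d) ((hF c).2 hc), by
    rw [← Fit_eval_succ' hF hc, h]⟩

lemma al_anti (N : ℕ) : al 𝔉 d c (N+1) ≤ al 𝔉 d c N := by
  refine dens_mono fun x _ h => im_succ hF hc h

/-- bound on coincidences -/
lemma coinc (hd : 2 ≤ d) {η : k} (hη : η ^ d = 1) (hη1 : η ≠ 1) (N : ℕ) :
    dens 𝔉 (fun t => (∃ a ∈ 𝔉, (Fit d c N).eval a = t) ∧ ∃ a ∈ 𝔉, (Fit d c N).eval a = η * t) ≤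
      2 * (al 𝔉 d c N - al 𝔉 d c (N+1)) + 1 / 𝔉.card := by
  classical
  refine (dens_add_le (Q := fun t => t ≠ 0 ∧ (∃ a ∈ 𝔉, (Fit d c N).eval a = t) ∧
    ∃ a ∈ 𝔉, (Fit d c N).eval a = η * t) (R := fun t => t = 0) ?_).trans
    (add_le_add ?_ (dens_single 0))
  · intro x _ h
    by_cases h0 : x = 0
    · exact Or.inr h0
    · exact Or.inl ⟨h0, h⟩
  have key := comb (𝔉.filter (fun t => ∃ a ∈ 𝔉, (Fit d c N).eval a = t))
    (𝔉.filter (fun t => t ≠ 0 ∧ (∃ a ∈ 𝔉, (Fit d c N).eval a = t) ∧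
    ∃ a ∈ 𝔉, (Fit d c N).eval a = η * t)) (fun w => w ^ d + c)
    (by
      intro x hx
      obtain ⟨h1, h2, h3, h4⟩ := Finset.mem_filter.1 hx
      exact Finset.mem_filter.2 ⟨h1, h3⟩)
    (by
      intro x hx
      obtain ⟨h1, h2, h3, a, h4, h5⟩ := Finset.mem_filter.1 hx
      refine ⟨η * x, Finset.mem_filter.2 ⟨?_, a, h4, h5⟩, ?_, ?_⟩
      · rw [← h5]; exact F_Fit hF hc N h4
      · intro h6
        have : (η - 1) * x = 0 := by rw [sub_mul, h6, one_mul, sub_self]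
        exact h2 ((mul_eq_zero.1 this).resolve_left (sub_ne_zero.2 hη1))
      · simp only [mul_pow, hη, one_mul])
  have him : (𝔉.filter (fun t => ∃ a ∈ 𝔉, (Fit d c N).eval a = t)).image (fun w => w ^ d + c) =
      𝔉.filter (fun t => ∃ a ∈ 𝔉, (Fit d c (N+1)).eval a = t) := by
    ext t
    constructor
    · intro h
      obtain ⟨x, hx, rfl⟩ := Finset.mem_image.1 h
      obtain ⟨h1, a, h2, h3⟩ := Finset.mem_filter.1 hx
      refine Finset.mem_filter.2 ⟨F_add hF (F_pow hF h1 d) ((hF c).2 hc), a, h2, ?_⟩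
      rw [Fit_eval_succ hF hc, h3]
    · intro h
      obtain ⟨h1, a, h2, h3⟩ := Finset.mem_filter.1 h
      refine Finset.mem_image.2 ⟨(Fit d c N).eval a,
        Finset.mem_filter.2 ⟨F_Fit hF hc N h2, a, h2, rfl⟩, ?_⟩
      rw [← h3, Fit_eval_succ hF hc]
  rw [him] at key
  unfold al
  rw [dens_def, dens_def, dens_def, ← sub_div, ← mul_div_assoc]
  gcongr
  have key' := (Nat.cast_le (α := ℝ)).2 key
  push_cast at key'
  linarith
end st

lemma coeff_fix_of_map {k : Type*} [Field k] {p f : ℕ} [Fact p.Prime] [CharP k p] {z : k[X]}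
    (h : z.map (iterateFrobenius k p f) = z) (j : ℕ) : z.coeff j ^ p ^ f = z.coeff j := by
  conv_rhs => rw [← h]
  rw [coeff_map, iterateFrobenius_def]

set_option maxHeartbeats 1000000 in
theorem stepineq.{u} (d N : ℕ) (hd : 2 ≤ d) (hN : 1 ≤ N) (δ : ℝ) (hδ : 0 < δ) : ∃ P0 : ℕ,
    ∀ (p f : ℕ) [Fact p.Prime], P0 ≤ p → 0 < f → d ∣ p ^ f - 1 →
    ∀ (k : Type u) [Field k] [IsAlgClosed k] [CharP k p]
    (𝔉 : Finset k) (hF : ∀ t, t ∈ 𝔉 ↔ t ^ p ^ f = t) (hFc : 𝔉.card = p ^ f)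
    (c : k) (hc : c ^ p ^ f = c) (hdk : (d : k) ≠ 0) (hg : Good d c N),
    al 𝔉 d c (N+2) ^ 2 ≤ 128 * d * d * (al 𝔉 d c N - al 𝔉 d c (N+1)) +
      128 * d * d * (δ + 1 / (p ^ f : ℕ)) := by
  obtain ⟨P0, hP⟩ := pair.{u} d N (d ^ N + 2) hd δ hδ
  refine ⟨P0, ?_⟩
  intro p f _ hp hf hdq k _ _ _ 𝔉 hF hFc c hc hdk hg
  have hdN : 2 ≤ d ^ N := hd.trans (Nat.le_self_pow (by omega) d)
  have hanti := al_anti (𝔉 := 𝔉) hF (d := d) hc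
  have hD := sub_nonneg.2 (hanti N)
  have hmono : al 𝔉 d c (N+2) ≤ al 𝔉 d c N := (hanti (N+1)).trans (hanti N)
  have ha0 : 0 ≤ al 𝔉 d c (N+2) := dens_nonneg _ _
  have ha1 : al 𝔉 d c (N+2) ≤ 1 := dens_le_one _ _
  have hq : (0:ℝ) ≤ 1 / (p ^ f : ℕ) := by positivity
  have hd' : (2:ℝ) ≤ d := by exact_mod_cast hd
  have hdd : (0:ℝ) ≤ d * d := by positivity
  rcases hg with ⟨η, hη, hη1, hα, hβ⟩ | ⟨rfl, hc0, hL, hα, hβ⟩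
  · have hη0 : η ≠ 0 := by rintro rfl; rw [zero_pow (by omega)] at hη; exact zero_ne_one hη
    have hηF := F_root hF hdq hη
    have key := hP p f hp hf k 𝔉 hF hFc c hc (Fit d c N) (C η * X)
      (fun j => Fit_coeff_pow hc N j)
      (coeff_fix_of_map (by
        rw [Polynomial.map_mul, map_C, map_X, iterateFrobenius_def, (hF η).1 hηF]))
      (Fit_monic hd N) (by rw [Fit_natDegree hd]; exact hdN) (by rw [Fit_natDegree hd]; omega)
      (by rw [natDegree_C_mul_X _ hη0]) (by rw [natDegree_C_mul_X _ hη0]; omega)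
      (by
        intro h
        obtain ⟨r, h1, h2⟩ := pil_root h
        obtain ⟨i, h3, h4, h5⟩ := Fit_crit hd hdk N r h1
        refine hα i h3 h4 ?_
        rw [← h5, ← h2]; simp)
      (by
        intro t0 h
        obtain ⟨r, h1, h2⟩ := pil_root h
        obtain ⟨i, h3, h4, h5⟩ := Fit_crit hd hdk N r h1
        refine lift_hβ hd hdk (hβ t0 i h3 h4 ?_)
        rw [← h5, ← h2]; simp)
    simp only [eval_mul, eval_C, eval_X] at key
    have e1 : al 𝔉 d c N ≤ dens 𝔉 (fun t => ∃ a ∈ 𝔉, (Fit d c N).eval a = η * t) := by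
      refine dens_surj (fun x => η * x) ?_
      rintro y hy ⟨a, h1, h2⟩
      refine ⟨η⁻¹ * y, F_mul hF (F_inv hF hηF) hy, ⟨a, h1, ?_⟩, ?_⟩
      · rw [h2, mul_inv_cancel_left₀ hη0]
      · exact mul_inv_cancel_left₀ hη0 y
    have e2 : dens 𝔉 (fun t => (∃ a ∈ 𝔉, (Fit d c (N+2)).eval a = t) ∧
        ∃ a ∈ 𝔉, (Fit d c N).eval a = η * t) ≤ 2 * (al 𝔉 d c N - al 𝔉 d c (N+1)) + 1 / 𝔉.card := by
      refine (dens_mono ?_).trans (coinc hF hc hd hη hη1 N)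
      rintro x _ ⟨h1, h2⟩
      exact ⟨im_succ hF hc (im_succ hF hc h1), h2⟩
    rw [hFc] at e2
    have e3 : al 𝔉 d c (N+2) ^ 2 ≤ al 𝔉 d c (N+2) *
        dens 𝔉 (fun t => ∃ a ∈ 𝔉, (Fit d c N).eval a = η * t) := by
      rw [pow_two]
      exact mul_le_mul_of_nonneg_left (hmono.trans e1) ha0
    have e4 := e3.trans key
    have e5 : (d * d : ℝ) * (dens 𝔉 (fun t => (∃ a ∈ 𝔉, (Fit d c (N+2)).eval a = t) ∧
        ∃ a ∈ 𝔉, (Fit d c N).eval a = η * t) + δ) ≤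
        (d * d : ℝ) * (2 * (al 𝔉 d c N - al 𝔉 d c (N+1)) + 1 / (p ^ f : ℕ) + δ) := by
      gcongr
    refine (e4.trans e5).trans ?_
    nlinarith [mul_nonneg hdd hD, mul_nonneg hdd hδ.le, mul_nonneg hdd hq]
  · have hc0' : c ∈ 𝔉 := (hF c).2 hc
    have h2k : (2:k) ≠ 0 := by exact_mod_cast hdk
    have hm1 : (-1 : k) ≠ 1 := by
      intro h; apply h2k; linear_combination -h
    have hneg : (-1 : k) ^ p ^ f = -1 := (hF _).1 (F_root hF hdq (by norm_num))
    have sq2 : ∀ x y : k, x ^ 2 = y ^ 2 → x = y ∨ x = -y := fun x y h => sq_eq_sq_iff_eq_or_eq_neg.1 h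
    have keyA := hP p f hp hf k 𝔉 hF hFc c hc (X ^ 2) (C (-1) * (X + C c))
      (coeff_fix_of_map (by rw [Polynomial.map_pow, map_X]))
      (coeff_fix_of_map (by
        rw [Polynomial.map_mul, Polynomial.map_add, map_C, map_X, map_C, iterateFrobenius_def,
          iterateFrobenius_def, hneg, hc]))
      (monic_X_pow 2) (by rw [natDegree_X_pow]) (by rw [natDegree_X_pow]; omega)
      (by rw [natDegree_C_mul (neg_ne_zero.2 one_ne_zero), natDegree_X_add_C])
      (by rw [natDegree_C_mul (neg_ne_zero.2 one_ne_zero), natDegree_X_add_C]; omega)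
      (by
        intro h
        obtain ⟨r, h1, h2⟩ := pil_root h
        have hr : r = 0 := by simpa [derivative_X_pow, one_add_one_eq_two, h2k] using h1
        rw [hr] at h2
        simp at h2
        apply mul_ne_zero h2k hc0
        linear_combination -h2)
      (by
        intro t0 h
        obtain ⟨r, h1, h2⟩ := pil_root h
        have hr : r = 0 := by simpa [derivative_X_pow, one_add_one_eq_two, h2k] using h1
        rw [hr] at h2
        simp at h2
        have : t0 = -c := by linear_combination -h2
        rw [this]
        exact lift_hβ hd hdk hL)
    have keyB := hP p f hp hf k 𝔉 hF hFc c hc (Fit 2 c N) (C (-1) * (X ^ 2 + C c))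
      (fun j => Fit_coeff_pow hc N j)
      (coeff_fix_of_map (by
        rw [Polynomial.map_mul, Polynomial.map_add, Polynomial.map_pow, map_C, map_X, map_C,
          iterateFrobenius_def, iterateFrobenius_def, hneg, hc]))
      (Fit_monic hd N) (by rw [Fit_natDegree hd]; exact hdN) (by rw [Fit_natDegree hd]; omega)
      (by rw [natDegree_C_mul (neg_ne_zero.2 one_ne_zero), natDegree_X_pow_add_C]; omega)
      (by rw [natDegree_C_mul (neg_ne_zero.2 one_ne_zero), natDegree_X_pow_add_C]; omega)
      (by
        intro h
        obtain ⟨r, h1, h2⟩ := pil_root h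
        obtain ⟨i, h3, h4, h5⟩ := Fit_crit hd hdk N r h1
        refine hα i h3 h4 ?_
        rw [← h5, ← h2, pc_succ, pc_one hd]; simp)
      (by
        intro t0 h
        obtain ⟨r, h1, h2⟩ := pil_root h
        obtain ⟨i, h3, h4, h5⟩ := Fit_crit hd hdk N r h1
        refine lift_hβ hd hdk (hβ t0 i h3 h4 ?_)
        rw [← h5, ← h2]; simp)
    simp only [eval_mul, eval_C, eval_X, eval_add, eval_pow] at keyA keyB
    set β := dens 𝔉 (fun t => ∃ a ∈ 𝔉, (Fit 2 c N).eval a = -1 * (t ^ 2 + c)) with hβdef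
    have a1 : (1:ℝ) ≤ 2 * dens 𝔉 (fun t => ∃ a ∈ 𝔉, a ^ 2 = -1 * (t + c)) := by
      have h1 : dens 𝔉 (fun _ => True) = 1 := by
        unfold dens
        rw [Finset.filter_true, div_self]
        rw [hFc]
        exact_mod_cast (pow_pos (Fact.out : p.Prime).pos _).ne'
      rw [← h1]
      refine dens_two (fun x => -(x ^ 2 + c)) ?_ ?_
      · intro x y h
        refine sq2 x y ?_
        have h : -(x ^ 2 + c) = -(y ^ 2 + c) := h
        linear_combination -h
      · intro x hx _
        exact ⟨F_neg hF hdq (F_add hF (F_pow hF hx 2) hc0'), x, hx, by ring⟩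
    have a2 : dens 𝔉 (fun t => (∃ a ∈ 𝔉, (Fit 2 c (N+2)).eval a = t) ∧
        ∃ a ∈ 𝔉, a ^ 2 = -1 * (t + c)) ≤ β := by
      refine dens_surj (fun x => -(x ^ 2 + c)) ?_
      rintro y hy ⟨h1, a, h2, h3⟩
      have e : -(a ^ 2 + c) = y := by rw [h3]; ring
      obtain ⟨b, h4, h5⟩ := im_succ hF hc (im_succ hF hc h1)
      refine ⟨a, h2, ⟨b, h4, ?_⟩, e⟩
      rw [h5, ← e]; ring
    have b1 : dens 𝔉 (fun t => (∃ a ∈ 𝔉, (Fit 2 c (N+2)).eval a = t) ∧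
        ∃ a ∈ 𝔉, (Fit 2 c N).eval a = -1 * (t ^ 2 + c)) ≤
        2 * (2 * (al 𝔉 2 c N - al 𝔉 2 c (N+1)) + 1 / 𝔉.card) := by
      refine le_trans (dens_two (fun x => x ^ 2 + c) ?_ ?_)
        (mul_le_mul_of_nonneg_left (coinc hF hc hd (η := -1) (by norm_num) hm1 N) zero_le_two)
      · intro x y h
        exact sq2 x y (add_right_cancel h)
      · rintro x hx ⟨h1, h2⟩
        refine ⟨F_add hF (F_pow hF hx 2) hc0', ?_, h2⟩
        obtain ⟨b, h4, h5⟩ := im_succ hF hc (im_succ hF hc h1)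
        refine im_succ hF hc ⟨b, h4, ?_⟩
        rw [Fit_eval_succ hF hc, h5]
    rw [hFc] at b1
    have keyA' : al 𝔉 2 c (N+2) * dens 𝔉 (fun t => ∃ a ∈ 𝔉, a ^ 2 = -1 * (t + c)) ≤
      ((2:ℕ):ℝ) * (2:ℕ) * (β + δ) := keyA.trans (by gcongr)
    have keyB' : al 𝔉 2 c (N+2) * β ≤ ((2:ℕ):ℝ) * (2:ℕ) *
      (2 * (2 * (al 𝔉 2 c N - al 𝔉 2 c (N+1)) + 1 / (p ^ f : ℕ)) + δ) := keyB.trans (by gcongr)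
    push_cast at keyA' keyB' ⊢
    push_cast at hq
    have c1 : al 𝔉 2 c (N+2) / 8 - δ ≤ β := by nlinarith
    have c2 : al 𝔉 2 c (N+2) * (al 𝔉 2 c (N+2) / 8 - δ) ≤ al 𝔉 2 c (N+2) * β :=
      mul_le_mul_of_nonneg_left c1 ha0
    nlinarith

end PC

namespace PC

theorem main_local.{u} (d : ℕ) (hd : 2 ≤ d) (ε : ℝ) (hε : 0 < ε) : ∃ T P0 : ℕ,
    ∀ (p f : ℕ) [Fact p.Prime], P0 ≤ p → 0 < f → d ∣ p ^ f - 1 →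
    ∀ (k : Type u) [Field k] [IsAlgClosed k] [CharP k p]
    (𝔉 : Finset k) (hF : ∀ t, t ∈ 𝔉 ↔ t ^ p ^ f = t) (hFc : 𝔉.card = p ^ f)
    (c : k) (hc : c ^ p ^ f = c) (hdk : (d : k) ≠ 0) (hg : ∀ N ≤ T, Good d c N),
    al 𝔉 d c (T+2) ≤ ε := by
  set Cc : ℝ := 128 * d * d with hC
  have hd' : (2:ℝ) ≤ d := by exact_mod_cast hd
  have hCpos : 0 < Cc := by rw [hC]; positivity
  obtain ⟨M, hM⟩ := exists_nat_gt (3 * Cc / ε ^ 2)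
  have hε2 : 0 < ε ^ 2 := by positivity
  have hMpos : (0:ℝ) < M := lt_trans (by positivity) hM
  have hM1 : 3 * Cc < M * ε ^ 2 := (div_lt_iff₀ hε2).1 hM
  set δ : ℝ := ε ^ 2 / (3 * Cc) with hδd
  have hδ : 0 < δ := by positivity
  choose! P hP using fun N (hN : 1 ≤ N) => stepineq.{u} d N hd hN δ hδ
  refine ⟨M, M + (Finset.range (M+1)).sup P, ?_⟩
  intro p f _ hp hf hdq k _ _ _ 𝔉 hF hFc c hc hdk hg
  have hanti : Antitone (al 𝔉 d c) := antitone_nat_of_succ_le fun N => al_anti hF hc N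
  have hstep : ∀ n ∈ Finset.range M, al 𝔉 d c (M+2) ^ 2 ≤
      Cc * (al 𝔉 d c (n+1) - al 𝔉 d c (n+1+1)) + Cc * (δ + 1 / (p ^ f : ℕ)) := by
    intro n hn
    have hn' := Finset.mem_range.1 hn
    have hsup : P (n+1) ≤ (Finset.range (M+1)).sup P :=
      Finset.le_sup (Finset.mem_range.2 (by omega))
    have := hP (n+1) (by omega) p f (by omega) hf hdq k 𝔉 hF hFc c hc hdk (hg _ (by omega))
    refine le_trans ?_ this
    exact pow_le_pow_left₀ (dens_nonneg _ _) (hanti (by omega)) 2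
  have hsum := Finset.sum_le_sum hstep
  rw [Finset.sum_const, Finset.card_range, Finset.sum_add_distrib, ← Finset.mul_sum,
    Finset.sum_const, Finset.card_range, Finset.sum_range_sub' (fun n => al 𝔉 d c (n+1))] at hsum
  simp only [nsmul_eq_mul] at hsum
  have h1 : al 𝔉 d c (0+1) ≤ 1 := dens_le_one _ _
  have h2 : 0 ≤ al 𝔉 d c (M+1) := dens_nonneg _ _
  have hq : (1:ℝ) / (p ^ f : ℕ) ≤ 1 / M := by
    apply one_div_le_one_div_of_le hMpos
    have : M ≤ p ^ f := le_trans (by omega) (Nat.le_self_pow (by omega : f ≠ 0) p)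
    exact_mod_cast this
  have hCδ : Cc * δ = ε ^ 2 / 3 := by rw [hδd]; field_simp
  have hCM : Cc * (1 / M) ≤ ε ^ 2 / 3 := by
    rw [mul_one_div, div_le_iff₀ hMpos]; linarith
  have hCq : Cc * (δ + 1 / (p ^ f : ℕ)) ≤ 2 * ε ^ 2 / 3 := by
    have := mul_le_mul_of_nonneg_left hq hCpos.le
    rw [mul_add]; linarith
  have h3 : Cc * (al 𝔉 d c (0+1) - al 𝔉 d c (M+1)) ≤ Cc := by
    have := mul_le_mul_of_nonneg_left (show al 𝔉 d c (0+1) - al 𝔉 d c (M+1) ≤ 1 by linarith) hCpos.le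
    linarith
  have h4 : (M:ℝ) * (Cc * (δ + 1 / (p ^ f : ℕ))) ≤ M * (2 * ε ^ 2 / 3) :=
    mul_le_mul_of_nonneg_left hCq hMpos.le
  have h5 : (M:ℝ) * al 𝔉 d c (M+2) ^ 2 ≤ M * ε ^ 2 := by linarith
  have h6 := le_of_mul_le_mul_left h5 hMpos
  exact le_of_sq_le_sq h6 hε.le

/-- reduction of the arithmetic condition -/
theorem good_red {R : Type*} [CommRing R] [IsDomain R] (d : ℕ) (hd : 2 ≤ d) (c : R) (hc : c ≠ 0)
    (hnc : ¬ (d = 2 ∧ c = -2)) (T : ℕ) : ∃ b : R, b ≠ 0 ∧ ∀ (k : Type*) [Field k] [IsAlgClosed k]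
    (φ : R →+* k), φ b ≠ 0 → (d : k) ≠ 0 → ∀ N ≤ T, Good d (φ c) N := by
  classical
  have bad : ∀ B : ℕ, ∃ b : R, b ≠ 0 ∧ ∀ (k : Type _) [Field k] (φ : R →+* k), φ b ≠ 0 →
      φ c ≠ 0 ∧ ¬ (d = 2 ∧ φ c = -2) ∧
      ∀ i j, i ≤ B → j ≤ B → pc d (φ c) i = pc d (φ c) j → pc d c i = pc d c j := by
    intro B
    let g : ℕ × ℕ → R := fun x => if pc d c x.1 = pc d c x.2 then 1 else pc d c x.1 - pc d c x.2
    let S := Finset.range (B+1) ×ˢ Finset.range (B+1)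
    refine ⟨c * (if c + 2 = 0 then 1 else c + 2) * ∏ x ∈ S, g x, ?_, ?_⟩
    · refine mul_ne_zero (mul_ne_zero hc ?_) (Finset.prod_ne_zero_iff.2 ?_)
      · split_ifs with h
        · exact one_ne_zero
        · exact h
      · intro x _
        simp only [g]
        split_ifs with h
        · exact one_ne_zero
        · exact sub_ne_zero.2 h
    · intro k _ φ hb
      rw [map_mul, map_mul, map_prod] at hb
      have h1 := left_ne_zero_of_mul hb
      have h2 := right_ne_zero_of_mul hb
      refine ⟨left_ne_zero_of_mul h1, ?_, ?_⟩
      · rintro ⟨hd2, h3⟩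
        have h4 := right_ne_zero_of_mul h1
        rw [if_neg] at h4
        · apply h4; rw [map_add, h3, map_ofNat]; ring
        · intro h5; exact hnc ⟨hd2, eq_neg_of_add_eq_zero_left h5⟩
      · intro i j hi hj h
        by_contra hne
        have h3 := Finset.prod_ne_zero_iff.1 h2 (i, j)
          (Finset.mem_product.2 ⟨Finset.mem_range.2 (by omega), Finset.mem_range.2 (by omega)⟩)
        simp only [g, if_neg hne] at h3
        apply h3
        rw [map_sub, ← pc_map, ← pc_map, h, sub_self]
  by_cases hinj : ∀ i j, pc d c (i+1) = pc d c (j+1) → pc d c i = pc d c j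
  · obtain ⟨b, hb, H⟩ := bad (T+3)
    refine ⟨b, hb, ?_⟩
    intro k _ _ φ hφ hdk N hN
    obtain ⟨h1, h2, h3⟩ := H k φ hφ
    refine good_inj hd hdk h1 ?_
    intro i j hi hj h
    have := hinj i j (h3 _ _ (by omega) (by omega) h)
    rw [pc_map, pc_map, this]
  · have hex : ∃ r, ∃ l, l < r ∧ pc d c (l+1) = pc d c (r+1) ∧ pc d c l ≠ pc d c r := by
      push Not at hinj
      obtain ⟨i, j, h1, h2⟩ := hinj
      rcases lt_trichotomy i j with h | h | h
      · exact ⟨j, i, h, h1, h2⟩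
      · rw [h] at h2; exact absurd rfl h2
      · exact ⟨i, j, h, h1.symm, h2.symm⟩
    set r := Nat.find hex with hr
    obtain ⟨l, hlr, hrep, hne⟩ := Nat.find_spec hex
    rw [← hr] at hlr hrep hne
    have hmin : ∀ i j, i < j → j < r → pc d c (i+1) = pc d c (j+1) → pc d c i = pc d c j := by
      intro i j hij hj h
      by_contra hne
      exact Nat.find_min hex (hr ▸ hj) ⟨i, hij, h, hne⟩
    have hdesc : ∀ i m, 0 < m → i + m ≤ r → pc d c i = pc d c (i+m) → pc d c 0 = pc d c m := by
      intro i
      induction i with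
      | zero => intro m _ _ h; rwa [zero_add] at h
      | succ i ih =>
        intro m hm h1 h2
        refine ih m hm (by omega) (hmin i (i+m) (by omega) (by omega) ?_)
        rw [h2]; congr 1; omega
    have hdist : ∀ i j, i < j → j ≤ r → pc d c i ≠ pc d c j := by
      intro i j hij hj h
      have h0 := hdesc i (j-i) (by omega) (by omega) (by rw [h]; congr 1; omega)
      set m := j - i with hm
      have hper : ∀ x, pc d c x = pc d c (x+m) := by
        intro x
        induction x with
        | zero => rw [zero_add]; exact h0
        | succ x ih => rw [show x + 1 + m = (x+m)+1 by omega, pc_succ, pc_succ, ih]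
      have h1 := hper (r-m)
      rw [show r - m + m = r by omega] at h1
      have h2 := hper (r-m+1)
      rw [show r - m + 1 + m = r + 1 by omega] at h2
      rcases lt_trichotomy l (r-m) with h3 | h3 | h3
      · exact hne ((hmin l (r-m) h3 (by omega) (hrep.trans h2.symm)).trans h1)
      · rw [h3] at hne; exact hne h1
      · exact hne ((hmin (r-m) l h3 hlr (h2.trans hrep.symm)).symm.trans h1)
    have hl : 1 ≤ l := by
      by_contra hl0
      have : l = 0 := by omega
      subst this
      rw [pc_succ, pc_succ, pc_zero, zero_pow (by omega)] at hrep
      have h1 : pc d c r ^ d = 0 := (add_right_cancel hrep).symm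
      have h2 := eq_zero_of_pow_eq_zero h1
      exact hne (by rw [pc_zero, h2])
    obtain ⟨b, hb, H⟩ := bad (r+1)
    refine ⟨b, hb, ?_⟩
    intro k _ _ φ hφ hdk N hN
    obtain ⟨h1, h2, h3⟩ := H k φ hφ
    refine good_preper hd hdk h1 hl hlr ?_ ?_ h2 N
    · intro i j hi hj h
      have := h3 i j (by omega) (by omega) h
      rcases lt_trichotomy i j with h4 | h4 | h4
      · exact absurd this (hdist i j h4 hj)
      · exact h4
      · exact absurd this.symm (hdist j i h4 hi)
    · rw [pc_map, pc_map, hrep]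

end PC

namespace PC

lemma per_image {α : Type*} (g : α → α) {z : α} {m : ℕ} (hm : 0 < m) (h : g^[m] z = z) (N : ℕ) :
    ∃ a, g^[N] a = z := by
  refine ⟨g^[(m-1)*N] z, ?_⟩
  rw [← Function.iterate_add_apply]
  have e : N + (m-1)*N = m * N := by
    obtain ⟨n, rfl⟩ : ∃ n, m = n + 1 := ⟨m - 1, by omega⟩
    rw [Nat.add_sub_cancel]; ring
  rw [e, Function.iterate_mul]
  exact Function.iterate_fixed h N

lemma per_le {F : Type*} [Field F] [Finite F] {q : ℕ} (hq1 : 1 < q) (hq : Nat.card F = q) (d : ℕ)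
    (c : F) : ∃ 𝔉 : Finset (AlgebraicClosure F), (∀ t, t ∈ 𝔉 ↔ t ^ q = t) ∧ 𝔉.card = q ∧
      ∀ N, (Set.ncard {z : F | ∃ m, 0 < m ∧ (fun w => w ^ d + c)^[m] z = z} : ℝ) ≤
        al 𝔉 d (algebraMap F (AlgebraicClosure F) c) N * q := by
  classical
  haveI := Fintype.ofFinite F
  set ι := algebraMap F (AlgebraicClosure F) with hι
  have hinj : Function.Injective ι := ι.injective
  have hqF : Fintype.card F = q := by rw [← Nat.card_eq_fintype_card, hq]
  have hpow : ∀ a : F, ι a ^ q = ι a := by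
    intro a; rw [← map_pow, ← hqF, FiniteField.pow_card]
  have hcard : (Finset.univ.image ι).card = q := by
    rw [Finset.card_image_of_injective _ hinj, Finset.card_univ, hqF]
  have hne := FiniteField.X_pow_card_sub_X_ne_zero (AlgebraicClosure F) hq1
  have hsub : Finset.univ.image ι ⊆ (X ^ q - X : (AlgebraicClosure F)[X]).roots.toFinset := by
    intro t ht
    obtain ⟨a, _, rfl⟩ := Finset.mem_image.1 ht
    rw [Multiset.mem_toFinset, mem_roots hne]
    simp [hpow a]
  have heq : Finset.univ.image ι = (X ^ q - X : (AlgebraicClosure F)[X]).roots.toFinset := by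
    refine Finset.eq_of_subset_of_card_le hsub ?_
    rw [hcard]
    refine (Multiset.toFinset_card_le _).trans ((card_roots' _).trans ?_)
    rw [FiniteField.X_pow_card_sub_X_natDegree_eq _ hq1]
  refine ⟨Finset.univ.image ι, ?_, hcard, ?_⟩
  · intro t
    rw [heq, Multiset.mem_toFinset, mem_roots hne]
    simp [sub_eq_zero]
  · intro N
    unfold al
    rw [dens_def, hcard, div_mul_cancel₀ _ (by positivity), Nat.cast_le]
    rw [← Set.ncard_image_of_injective _ hinj, ← Set.ncard_coe_finset]
    refine Set.ncard_le_ncard ?_ (Finset.finite_toSet _)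
    rintro _ ⟨z, ⟨m, hm, hz⟩, rfl⟩
    rw [Finset.mem_coe, Finset.mem_filter]
    refine ⟨Finset.mem_image_of_mem _ (Finset.mem_univ _), ?_⟩
    obtain ⟨a, ha⟩ := per_image _ hm hz N
    refine ⟨ι a, Finset.mem_image_of_mem _ (Finset.mem_univ _), ?_⟩
    rw [Fit_eval, ← ha]
    have hs : Function.Semiconj ι (fun w => w ^ d + c) (fun w => w ^ d + ι c) := by
      intro x; simp
    exact ((hs.iterate_right N) a).symm

lemma per_zero {F : Type*} [Field F] [Finite F] {q n m : ℕ} (hq : Nat.card F = q) {d : ℕ}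
    (hd : 2 ≤ d) (hm : 0 < m) (h : q - 1 = d ^ n * m) :
    Set.ncard {z : F | ∃ m, 0 < m ∧ (fun w : F => w ^ d + 0)^[m] z = z} ≤ m + 1 := by
  classical
  haveI := Fintype.ofFinite F
  have hqF : Fintype.card F = q := by rw [← Nat.card_eq_fintype_card, hq]
  have hsub : {z : F | ∃ m, 0 < m ∧ (fun w : F => w ^ d + 0)^[m] z = z} ⊆
      ((insert 0 (nthRoots m (1:F)).toFinset : Finset F) : Set F) := by
    rintro z ⟨j, hj, hz⟩
    obtain ⟨a, ha⟩ := per_image _ hj hz n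
    have e : ∀ i (x : F), (fun w : F => w ^ d + 0)^[i] x = x ^ d ^ i := by
      intro i x
      induction i with
      | zero => simp
      | succ i ih => rw [Function.iterate_succ_apply', ih, add_zero, ← pow_mul, pow_succ]
    rw [e] at ha
    rw [Finset.mem_coe, Finset.mem_insert, Multiset.mem_toFinset, mem_nthRoots hm]
    by_cases ha0 : a = 0
    · left; rw [← ha, ha0, zero_pow (by positivity)]
    · right
      rw [← ha, ← pow_mul, ← h, ← hqF, FiniteField.pow_card_sub_one_eq_one a ha0]
  refine (Set.ncard_le_ncard hsub (Finset.finite_toSet _)).trans ?_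
  rw [Set.ncard_coe_finset]
  refine (Finset.card_insert_le _ _).trans ?_
  have := (Multiset.toFinset_card_le (nthRoots m (1:F))).trans (card_nthRoots m 1)
  omega

lemma not_mem_of_gt {K : Type*} [Field K] [NumberField K] {b : 𝓞 K} (hb : b ≠ 0) {p : ℕ}
    (hp : p.Prime) (h : Ideal.absNorm (Ideal.span {b}) < p) {𝔭 : Ideal (𝓞 K)} (hP : 𝔭.IsPrime)
    (hpP : (p : 𝓞 K) ∈ 𝔭) : b ∉ 𝔭 := by
  intro hbP
  have h1 : ((Ideal.absNorm (Ideal.span {b}) : ℕ) : 𝓞 K) ∈ 𝔭 :=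
    (Ideal.span_singleton_le_iff_mem 𝔭).2 hbP (Ideal.absNorm_mem _)
  have h0 : Ideal.absNorm (Ideal.span {b}) ≠ 0 := by
    rw [Ne, Ideal.absNorm_eq_zero_iff, Ideal.span_singleton_eq_bot]; exact hb
  have hcop : Nat.Coprime (Ideal.absNorm (Ideal.span {b})) p :=
    (((Nat.Prime.coprime_iff_not_dvd hp).2 fun h' => by
      have := Nat.le_of_dvd (Nat.pos_of_ne_zero h0) h'
      omega).symm)
  obtain ⟨u, v, huv⟩ := Nat.isCoprime_iff_coprime.2 hcop
  apply hP.ne_top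
  rw [Ideal.eq_top_iff_one]
  have h2 := congrArg (Int.cast : ℤ → 𝓞 K) huv
  push_cast at h2
  rw [← h2]
  exact 𝔭.add_mem (𝔭.mul_mem_left _ h1) (𝔭.mul_mem_left _ hpP)

lemma perCount_eq {R : Type*} [CommRing R] (d : ℕ) (c : R) (I : Ideal R) :
    perCount (X ^ d + C c) I = Set.ncard {z : R ⧸ I | ∃ m, 0 < m ∧
      (fun w => w ^ d + Ideal.Quotient.mk I c)^[m] z = z} := by
  unfold perCount
  simp

/-- the bound for all large primes congruent to one -/
theorem bound {K : Type*} [Field K] [NumberField K] (d : ℕ) (hd : 2 ≤ d) (c : 𝓞 K)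
    (hnc : ¬(d = 2 ∧ c = -2)) (ε : ℝ) (hε : 0 < ε) : ∃ P D : ℕ, D ≠ 0 ∧ ∀ p : ℕ, p.Prime → P < p →
    p ≡ 1 [MOD D] → ∀ 𝔭 : Ideal (𝓞 K), 𝔭.IsPrime → 𝔭 ≠ ⊥ → (p : 𝓞 K) ∈ 𝔭 →
    (p ≤ Ideal.absNorm 𝔭 ∧
      (perCount (X ^ d + C c) 𝔭 : ℝ) ≤ ε * ((Ideal.absNorm 𝔭 : ℝ) + 1)) := by
  have setup : ∀ (p : ℕ), p.Prime → ∀ 𝔭 : Ideal (𝓞 K), 𝔭.IsPrime → 𝔭 ≠ ⊥ → (p : 𝓞 K) ∈ 𝔭 →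
      ∃ (_ : 𝔭.IsMaximal), Finite (𝓞 K ⧸ 𝔭) ∧ CharP (𝓞 K ⧸ 𝔭) p ∧ ∃ f : ℕ, 0 < f ∧
        Ideal.absNorm 𝔭 = p ^ f ∧ Nat.card (𝓞 K ⧸ 𝔭) = p ^ f := by
    intro p hp 𝔭 hP hbot hpP
    have hmax : 𝔭.IsMaximal := hP.isMaximal hbot
    haveI : Finite (𝓞 K ⧸ 𝔭) := Ideal.finiteQuotientOfFreeOfNeBot 𝔭 hbot
    letI := Ideal.Quotient.field 𝔭
    haveI := Fintype.ofFinite (𝓞 K ⧸ 𝔭)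
    have h0 : ((p : ℕ) : 𝓞 K ⧸ 𝔭) = 0 := by
      rw [← map_natCast (Ideal.Quotient.mk 𝔭)]
      exact Ideal.Quotient.eq_zero_iff_mem.2 hpP
    haveI hch : CharP (𝓞 K ⧸ 𝔭) p := by
      obtain ⟨p', hp'⟩ := CharP.exists (𝓞 K ⧸ 𝔭)
      have h1 : p' ∣ p := (CharP.cast_eq_zero_iff (𝓞 K ⧸ 𝔭) p' p).1 h0
      rcases (Nat.dvd_prime hp).1 h1 with h | h
      · exact absurd h (CharP.char_ne_one (𝓞 K ⧸ 𝔭) p')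
      · rw [← h]; exact hp'
    haveI : Fact p.Prime := ⟨hp⟩
    obtain ⟨n, _, hn⟩ := FiniteField.card (𝓞 K ⧸ 𝔭) p
    have hcard : Nat.card (𝓞 K ⧸ 𝔭) = p ^ (n:ℕ) := by rw [Nat.card_eq_fintype_card, hn]
    refine ⟨hmax, inferInstance, hch, n, n.pos, ?_, hcard⟩
    rw [Ideal.absNorm_apply, Submodule.cardQuot_apply]; exact hcard
  by_cases hc : c = 0
  · subst hc
    obtain ⟨M, hM⟩ := exists_nat_gt (2 / ε)
    have hM1 : 2 < M * ε := (div_lt_iff₀ hε).1 hM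
    have hMpos : (0:ℝ) < M := lt_trans (by positivity) hM
    have hdM : M < d ^ M := Nat.lt_pow_self (by omega)
    refine ⟨M, d ^ M, by positivity, ?_⟩
    intro p hp hPp hmod 𝔭 hP hbot hpP
    obtain ⟨hmax, hfin, hch, f, hf, hN, hcard⟩ := setup p hp 𝔭 hP hbot hpP
    have hppf : p ≤ p ^ f := Nat.le_self_pow (by omega) p
    refine ⟨hN ▸ hppf, ?_⟩
    letI := Ideal.Quotient.field 𝔭
    have hdvd : d ^ M ∣ p ^ f - 1 := by
      have := (hmod.pow f).symm
      rw [one_pow] at this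
      exact (Nat.modEq_iff_dvd' (pow_pos hp.pos _)).1 this
    obtain ⟨m, hm⟩ := hdvd
    have hm0 : 0 < m := by
      rcases Nat.eq_zero_or_pos m with h | h
      · have := hp.two_le
        rw [h] at hm; omega
      · exact h
    have key := per_zero hcard hd hm0 hm
    rw [perCount_eq, map_zero, hN]
    refine (Nat.cast_le.2 key).trans ?_
    have h1 : M * m ≤ p ^ f := by
      have : M * m ≤ d ^ M * m := Nat.mul_le_mul_right _ hdM.le
      omega
    have h2 : (M:ℝ) * m ≤ (p ^ f : ℕ) := by exact_mod_cast h1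
    have h3 : (M:ℝ) ≤ (p ^ f : ℕ) := by exact_mod_cast (by omega : M ≤ p ^ f)
    push_cast at h2 h3 ⊢
    have h4 : (2:ℝ) * m ≤ ε * (p:ℝ) ^ f := by
      have a1 := mul_le_mul_of_nonneg_left h2 hε.le
      have a2 := mul_le_mul_of_nonneg_right hM1.le (Nat.cast_nonneg (α := ℝ) m)
      nlinarith
    have h5 : (2:ℝ) ≤ ε * (p:ℝ) ^ f := by nlinarith
    linarith
  · obtain ⟨T, P0, hloc⟩ := main_local d hd ε hε
    obtain ⟨b, hb, hgood⟩ := good_red d hd c hc hnc T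
    refine ⟨P0 + d + Ideal.absNorm (Ideal.span {b}), d, by omega, ?_⟩
    intro p hp hPp hmod 𝔭 hP hbot hpP
    obtain ⟨hmax, hfin, hch, f, hf, hN, hcard⟩ := setup p hp 𝔭 hP hbot hpP
    have hppf : p ≤ p ^ f := Nat.le_self_pow (by omega) p
    refine ⟨hN ▸ hppf, ?_⟩
    letI := Ideal.Quotient.field 𝔭
    haveI : Fact p.Prime := ⟨hp⟩
    have hdvd : d ∣ p ^ f - 1 := by
      have := (hmod.pow f).symm
      rw [one_pow] at this
      exact (Nat.modEq_iff_dvd' (pow_pos hp.pos _)).1 this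
    obtain ⟨𝔉, hF, hFc, hper⟩ := per_le (F := 𝓞 K ⧸ 𝔭) (lt_of_lt_of_le hp.one_lt hppf) hcard d
      (Ideal.Quotient.mk 𝔭 c)
    haveI : CharP (AlgebraicClosure (𝓞 K ⧸ 𝔭)) p :=
      charP_of_injective_algebraMap (algebraMap (𝓞 K ⧸ 𝔭) _).injective p
    have hbP := not_mem_of_gt hb hp (by omega) hP hpP
    let φ : 𝓞 K →+* AlgebraicClosure (𝓞 K ⧸ 𝔭) :=
      (algebraMap (𝓞 K ⧸ 𝔭) (AlgebraicClosure (𝓞 K ⧸ 𝔭))).comp (Ideal.Quotient.mk 𝔭)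
    have hφb : φ b ≠ 0 := by
      intro h
      apply hbP
      rw [← Ideal.Quotient.eq_zero_iff_mem]
      exact (map_eq_zero (algebraMap (𝓞 K ⧸ 𝔭) (AlgebraicClosure (𝓞 K ⧸ 𝔭)))).1 h
    have hdk : (d : AlgebraicClosure (𝓞 K ⧸ 𝔭)) ≠ 0 := by
      intro h
      have := Nat.le_of_dvd (by omega) ((CharP.cast_eq_zero_iff _ p d).1 h)
      omega
    have hmem : φ c ∈ 𝔉 := by
      rw [hF]
      show (algebraMap (𝓞 K ⧸ 𝔭) (AlgebraicClosure (𝓞 K ⧸ 𝔭)) (Ideal.Quotient.mk 𝔭 c)) ^ _ = _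
      haveI := Fintype.ofFinite (𝓞 K ⧸ 𝔭)
      rw [← map_pow, ← hcard, Nat.card_eq_fintype_card, FiniteField.pow_card]
      rfl
    have hal := hloc p f (by omega) hf hdvd _ 𝔉 hF hFc (φ c) ((hF _).1 hmem) hdk
      (fun N hN => hgood _ φ hφb hdk N hN)
    rw [perCount_eq, hN]
    refine (hper (T+2)).trans ?_
    have h1 : al 𝔉 d (φ c) (T+2) * ((p ^ f : ℕ) : ℝ) ≤ ε * ((p ^ f : ℕ) : ℝ) :=
      mul_le_mul_of_nonneg_right hal (by positivity)
    refine le_trans h1 ?_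
    exact mul_le_mul_of_nonneg_left (by linarith) hε.le

theorem final {K : Type*} [Field K] [NumberField K] (d : ℕ) (hd : 2 ≤ d) (c : 𝓞 K)
    (hnc : ¬(d = 2 ∧ c = -2)) (ε : ℝ) (hε : 0 < ε) :
    {𝔭 : Ideal (𝓞 K) | 𝔭.IsPrime ∧ 𝔭 ≠ ⊥ ∧
        (perCount (X ^ d + C c) 𝔭 : ℝ) ≤ ε * ((Ideal.absNorm 𝔭 : ℝ) + 1)}.Infinite := by
  obtain ⟨P, D, hD, H⟩ := bound d hd c hnc ε hε
  intro hfin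
  obtain ⟨M, hM⟩ := (hfin.image Ideal.absNorm).bddAbove
  obtain ⟨p, hp, hgt, hmod⟩ := Nat.exists_prime_gt_modEq_one (P + M) hD
  have hpne : (p : 𝓞 K) ≠ 0 := Nat.cast_ne_zero.2 hp.ne_zero
  have htop : Ideal.span {(p : 𝓞 K)} ≠ ⊤ := by
    intro h
    have h1 := congrArg Ideal.absNorm h
    rw [Ideal.absNorm_span_natCast, Ideal.absNorm_top] at h1
    rcases Nat.pow_eq_one.1 h1 with h2 | h2
    · exact hp.one_lt.ne' h2
    · rw [RingOfIntegers.rank] at h2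
      exact Module.finrank_pos.ne' h2
  obtain ⟨𝔭, hmax, hle⟩ := Ideal.exists_le_maximal _ htop
  have hpP : (p : 𝓞 K) ∈ 𝔭 := (Ideal.span_singleton_le_iff_mem 𝔭).1 hle
  have hbot : 𝔭 ≠ ⊥ := by
    rintro rfl
    exact hpne (Ideal.mem_bot.1 hpP)
  obtain ⟨h1, h2⟩ := H p hp (by omega) hmod 𝔭 hmax.isPrime hbot hpP
  have h3 := hM ⟨𝔭, ⟨hmax.isPrime, hbot, h2⟩, rfl⟩
  omega

end PC

/-- For `f(x) = x^d + c` over `𝓞_K` with `d ≥ 2`, if `f` is not the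
Chebyshev polynomial `x² − 2` (i.e. not `d = 2 ∧ c = −2`), then for every `ε > 0`
there are infinitely many nonzero primes `𝔭` of `𝓞_K` with
`#Per(f_𝔭) ≤ ε·(N(𝔭) + 1)`. -/
theorem unicritical_liminf_zero_unless_chebyshev {K : Type*} [Field K] [NumberField K]
    (d : ℕ) (hd : 2 ≤ d) (c : 𝓞 K) (f : Polynomial (𝓞 K)) (hf : f = X ^ d + C c)
    (hnc : ¬(d = 2 ∧ c = -2)) :
    ∀ ε : ℝ, 0 < ε →
      {𝔭 : Ideal (𝓞 K) | 𝔭.IsPrime ∧ 𝔭 ≠ ⊥ ∧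
        (perCount f 𝔭 : ℝ) ≤ ε * ((Ideal.absNorm 𝔭 : ℝ) + 1)}.Infinite := by
  subst hf
  exact fun ε hε => PC.final d hd c hnc ε hε
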